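/- Let n and k be positive integers with n ≥ k+2, and let F be a family of meromorphic functions on a domain D ⊂ ℂ. If every f ∈ F satisfies (f^n)^{(k)}(z) ≠ 1 for all z ∈ D, then F is a normal family in D. -/

import Mathlib

open Complex Topology Filter Set MeasureTheory
open scoped ENNReal NNReal Classical

noncomputable section


/-- The chordal (spherical) distance on the Riemann sphere `ℂ ∪ {∞}`. -/
def sphDist (a b : OnePoint ℂ) : ℝ :=
  Option.elim a (Option.elim b 0 fun w => 1 / Real.sqrt (1 + ‖w‖ ^ 2))
    fun z => Option.elim b (1 / Real.sqrt (1 + ‖z‖ ^ 2))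
      fun w => ‖z - w‖ / (Real.sqrt (1 + ‖z‖ ^ 2) * Real.sqrt (1 + ‖w‖ ^ 2))

/-- The natural Riemann-sphere-valued version of a meromorphic function:
at points where the function blows up (poles) the value is `∞`. -/
def toSphere (f : ℂ → ℂ) : ℂ → OnePoint ℂ := fun z =>
  if Tendsto (fun w => ‖f w‖) (𝓝[≠] z) atTop then OnePoint.infty else (f z : OnePoint ℂ)

/-- A meromorphic function given by an honest representative: at each point of `D` it is
either continuous (analytic points) or blows up (a pole). -/
def MeromorphicNiceOn (f : ℂ → ℂ) (D : Set ℂ) : Prop :=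
  MeromorphicOn f D ∧ ∀ z ∈ D, ContinuousAt f z ∨ Tendsto (fun w => ‖f w‖) (𝓝[≠] z) atTop

/-- The order (multiplicity) of a meromorphic function at a point: positive for a zero of that
multiplicity, negative of the multiplicity for a pole, `⊤` if the function vanishes identically
near the point, and junk value `0` when not defined. -/
def merOrder (f : ℂ → ℂ) (z : ℂ) : WithTop ℤ :=
  if ∀ᶠ w in 𝓝[≠] z, f w = 0 then ⊤
  else if h : ∃ n : ℤ, ∃ g : ℂ → ℂ, AnalyticAt ℂ g z ∧ g z ≠ 0 ∧
      ∀ᶠ w in 𝓝[≠] z, f w = (w - z) ^ n * g w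
    then (h.choose : WithTop ℤ) else 0

/-- `F j → g` spherically uniformly on compact subsets of `D`. -/
def ConvSphLocUnif (F : ℕ → ℂ → ℂ) (g : ℂ → ℂ) (D : Set ℂ) : Prop :=
  ∀ K ⊆ D, IsCompact K → ∀ ε > 0, ∀ᶠ j in atTop, ∀ z ∈ K,
    sphDist (toSphere (F j) z) (toSphere g z) < ε

/-- `F j → ∞` spherically uniformly on compact subsets of `D`. -/
def ConvInftyLocUnif (F : ℕ → ℂ → ℂ) (D : Set ℂ) : Prop :=
  ∀ K ⊆ D, IsCompact K → ∀ ε > 0, ∀ᶠ j in atTop, ∀ z ∈ K,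
    sphDist (toSphere (F j) z) OnePoint.infty < ε

/-- A family of meromorphic functions is normal in `D` if every sequence from the family has a
subsequence converging spherically uniformly on compact subsets of `D` to a meromorphic
function or to `∞`. -/
def NormalFamilyOn (𝓕 : Set (ℂ → ℂ)) (D : Set ℂ) : Prop :=
  ∀ f : ℕ → ℂ → ℂ, (∀ j, f j ∈ 𝓕) → ∃ φ : ℕ → ℕ, StrictMono φ ∧
    ((∃ g : ℂ → ℂ, MeromorphicNiceOn g D ∧ ConvSphLocUnif (fun j => f (φ j)) g D) ∨
      ConvInftyLocUnif (fun j => f (φ j)) D)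

/-- A sequence of meromorphic functions is normal in `D` if every subsequence has a further
subsequence converging spherically uniformly on compact subsets of `D` to a meromorphic
function or to `∞`. -/
def NormalSeqOn (f : ℕ → ℂ → ℂ) (D : Set ℂ) : Prop :=
  ∀ φ : ℕ → ℕ, StrictMono φ → ∃ σ : ℕ → ℕ, StrictMono σ ∧
    ((∃ g : ℂ → ℂ, MeromorphicNiceOn g D ∧ ConvSphLocUnif (fun j => f (φ (σ j))) g D) ∨
      ConvInftyLocUnif (fun j => f (φ (σ j))) D)

/-- In one of the two charts of the sphere, `g` is analytic at `z` and its spherical derivative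
is at most `C`. -/
def SphDerivLE (g : ℂ → ℂ) (C : ℝ) (z : ℂ) : Prop :=
  (AnalyticAt ℂ g z ∧ ‖deriv g z‖ ≤ C * (1 + ‖g z‖ ^ 2)) ∨
    (AnalyticAt ℂ g⁻¹ z ∧ ‖deriv g⁻¹ z‖ ≤ C * (1 + ‖g⁻¹ z‖ ^ 2))

theorem SphDerivLE.inv {g : ℂ → ℂ} {C : ℝ} {z : ℂ} (h : SphDerivLE g C z) :
    SphDerivLE g⁻¹ C z := by
  unfold SphDerivLE at *
  rw [inv_inv]
  exact h.symm

theorem SphDerivLE.mono {g : ℂ → ℂ} {C C' : ℝ} {z : ℂ} (h : SphDerivLE g C z) (hC : C ≤ C') :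
    SphDerivLE g C' z := by
  rcases h with ⟨h1, h2⟩ | ⟨h1, h2⟩
  · exact Or.inl ⟨h1, h2.trans (by gcongr)⟩
  · exact Or.inr ⟨h1, h2.trans (by gcongr)⟩

theorem SphDerivLE.analyticAt_or {g : ℂ → ℂ} {C : ℝ} {z : ℂ} (h : SphDerivLE g C z) :
    AnalyticAt ℂ g z ∨ AnalyticAt ℂ g⁻¹ z := by
  rcases h with ⟨h1, h2⟩ | ⟨h1, h2⟩
  exacts [Or.inl h1, Or.inr h1]

theorem deriv_inv_apply {g : ℂ → ℂ} {z : ℂ} (h : AnalyticAt ℂ g z) (hz : g z ≠ 0) :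
    deriv g⁻¹ z = - deriv g z / g z ^ 2 :=
  (h.differentiableAt.hasDerivAt.inv hz).deriv

theorem eventually_eq_zero_of_analyticAt_inv {g : ℂ → ℂ} {z : ℂ} (h : AnalyticAt ℂ g z)
    (h' : AnalyticAt ℂ g⁻¹ z) (hz : g z = 0) : ∀ᶠ w in 𝓝 z, g w = 0 := by
  rcases h.eventually_eq_zero_or_eventually_ne_zero with h0 | h0
  · exact h0
  · exfalso
    have h1 : Tendsto (fun w => g w * g⁻¹ w) (𝓝[≠] z) (𝓝 (g z * g⁻¹ z)) :=
      ((h.continuousAt.mul h'.continuousAt).tendsto).mono_left nhdsWithin_le_nhds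
    have h2 : Tendsto (fun w => g w * g⁻¹ w) (𝓝[≠] z) (𝓝 1) := by
      refine tendsto_const_nhds.congr' ?_
      filter_upwards [h0] with w hw
      simp [hw]
    have := tendsto_nhds_unique h1 h2
    simp [hz] at this

theorem SphDerivLE.norm_deriv_le {g : ℂ → ℂ} {C : ℝ} {z : ℂ} (h : SphDerivLE g C z)
    (hg : AnalyticAt ℂ g z) : ‖deriv g z‖ ≤ C * (1 + ‖g z‖ ^ 2) := by
  rcases h with ⟨h1, h2⟩ | ⟨h1, h2⟩
  · exact h2
  · have hC : 0 ≤ C * (1 + ‖g⁻¹ z‖ ^ 2) := (norm_nonneg _).trans h2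
    have hC0 : 0 ≤ C := by
      by_contra! hc
      nlinarith [sq_nonneg ‖g⁻¹ z‖]
    by_cases hz : g z = 0
    · have h0 := eventually_eq_zero_of_analyticAt_inv hg h1 hz
      have : deriv g z = 0 := by
        have : g =ᶠ[𝓝 z] fun _ => 0 := h0
        rw [this.deriv_eq]; simp
      rw [this]; simp; positivity
    · rw [deriv_inv_apply hg hz] at h2
      have hp : 0 < ‖g z‖ := norm_pos_iff.2 hz
      simp only [norm_div, norm_neg, norm_pow, Pi.inv_apply, norm_inv] at h2
      rw [div_le_iff₀ (by positivity)] at h2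
      refine h2.trans (le_of_eq ?_)
      field_simp
      ring

theorem analyticAt_inv_of_one_lt {g : ℂ → ℂ} {z : ℂ} (h : AnalyticAt ℂ g z ∨ AnalyticAt ℂ g⁻¹ z)
    (h' : ¬ (AnalyticAt ℂ g z ∧ ‖g z‖ ≤ 1)) : AnalyticAt ℂ g⁻¹ z ∧ ‖g⁻¹ z‖ ≤ 1 := by
  have key : AnalyticAt ℂ g z → AnalyticAt ℂ g⁻¹ z ∧ ‖g⁻¹ z‖ ≤ 1 := by
    intro ha
    have h1 : 1 < ‖g z‖ := by
      by_contra! hc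
      exact h' ⟨ha, hc⟩
    have h0 : g z ≠ 0 := by
      intro h0; rw [h0] at h1; simp at h1; linarith
    exact ⟨ha.inv h0, by simpa using inv_le_one_of_one_le₀ h1.le⟩
  rcases h with ha | ha
  · exact key ha
  · by_cases h1 : ‖g⁻¹ z‖ ≤ 1
    · exact ⟨ha, h1⟩
    · push Not at h1
      have h0 : g⁻¹ z ≠ 0 := by
        intro h0; rw [h0] at h1; simp at h1; linarith
      have := ha.inv h0
      rw [inv_inv] at this
      exact key this

/-- A bound for the spherical derivative keeps a function in one chart of the sphere on a
disc of controlled radius. -/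
theorem analyticAt_and_norm_le_two {g : ℂ → ℂ} {C r : ℝ} {z : ℂ} (hC : 0 ≤ C)
    (hr : 10 * C * r ≤ 1) (hg : ∀ w ∈ Metric.ball z r, SphDerivLE g C w)
    (hz : AnalyticAt ℂ g z) (hz1 : ‖g z‖ ≤ 1) :
    ∀ w ∈ Metric.ball z r, AnalyticAt ℂ g w ∧ ‖g w‖ ≤ 2 := by
  intro w hw
  set γ : ℝ → ℂ := fun s => z + s * (w - z) with hγ
  have hγc : Continuous γ := by fun_prop
  have hwz : ‖w - z‖ < r := by simpa [dist_eq_norm] using hw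
  have hγmem : ∀ s ∈ Icc (0 : ℝ) 1, γ s ∈ Metric.ball z r := by
    intro s hs
    simp only [hγ, Metric.mem_ball, dist_eq_norm, add_sub_cancel_left, norm_mul, norm_real,
      Real.norm_eq_abs, abs_of_nonneg hs.1]
    nlinarith [hs.2, norm_nonneg (w - z)]
  set S : Set ℝ := {s | AnalyticAt ℂ g (γ s) ∧ ‖g (γ s)‖ ≤ 1 + s} with hS
  have hclosed : IsClosed (S ∩ Icc 0 1) := by
    rw [← closure_subset_iff_isClosed]
    intro s hs
    have hsI : s ∈ Icc (0 : ℝ) 1 := by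
      have := closure_mono (inter_subset_right : S ∩ Icc (0 : ℝ) 1 ⊆ Icc 0 1) hs
      rwa [isClosed_Icc.closure_eq] at this
    refine ⟨?_, hsI⟩
    have hfreq : ∃ᶠ t in 𝓝 s, t ∈ S ∩ Icc 0 1 := mem_closure_iff_frequently.1 hs
    have hconv : Tendsto γ (𝓝 s) (𝓝 (γ s)) := hγc.tendsto s
    have han : AnalyticAt ℂ g (γ s) := by
      rcases (hg _ (hγmem s hsI)).analyticAt_or with h | h
      · exact h
      · by_contra hna
        have h0 : g⁻¹ (γ s) = 0 := by
          by_contra h0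
          have := h.inv h0
          rw [inv_inv] at this
          exact hna this
        have hev : ∀ᶠ t in 𝓝 s, ‖g⁻¹ (γ t)‖ < 1 / 2 := by
          have : Tendsto (fun t => ‖g⁻¹ (γ t)‖) (𝓝 s) (𝓝 ‖g⁻¹ (γ s)‖) :=
            (h.continuousAt.tendsto.comp hconv).norm
          rw [h0, norm_zero] at this
          exact this.eventually_lt_const (by norm_num)
        have hne : ∀ᶠ t in 𝓝 s, AnalyticAt ℂ g⁻¹ (γ t) :=
          hconv.eventually h.eventually_analyticAt
        have hinvne : ∀ᶠ w in 𝓝 (γ s), g w = 0 := by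
          obtain ⟨t, ⟨⟨⟨ht1, ht2⟩, ht3⟩, ht4⟩⟩ := (hfreq.and_eventually hev).exists
          rcases h.eventually_eq_zero_or_eventually_ne_zero with h5 | h5
          · filter_upwards [h5] with w hw
            simpa using hw
          · exfalso
            by_cases hst : γ t = γ s
            · rw [hst] at ht1; exact hna ht1
            · obtain ⟨t, ⟨⟨⟨ht1, ht2⟩, ht3⟩, ht4⟩, ht5⟩ := ((hfreq.and_eventually hev).and_eventually
                (hconv.eventually (eventually_nhdsWithin_iff.1 h5))).exists
              by_cases hst : γ t = γ s
              · rw [hst] at ht1; exact hna ht1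
              · have h7 : g (γ t) ≠ 0 := by
                  have := ht5 hst
                  simpa using this
                have h8 : ‖g (γ t)‖ ≤ 2 := ht2.trans (by linarith [ht3.2])
                have h9 : 0 < ‖g (γ t)‖ := norm_pos_iff.2 h7
                simp only [Pi.inv_apply, norm_inv] at ht4
                rw [inv_lt_comm₀ h9 (by norm_num)] at ht4
                norm_num at ht4; linarith
        exact hna ((analyticAt_const (v := (0 : ℂ))).congr
          (hinvne.mono fun w hw => hw.symm))
    refine ⟨han, ?_⟩
    by_contra! hc
    have h1 : Tendsto (fun t => ‖g (γ t)‖ - (1 + t)) (𝓝 s) (𝓝 (‖g (γ s)‖ - (1 + s))) :=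
      ((han.continuousAt.tendsto.comp hconv).norm).sub (tendsto_const_nhds.add tendsto_id)
    have h2 : ∀ᶠ t in 𝓝 s, 0 < ‖g (γ t)‖ - (1 + t) := h1.eventually_const_lt (by linarith)
    obtain ⟨t, ⟨⟨_, ht2⟩, _⟩, ht4⟩ := (hfreq.and_eventually h2).exists
    linarith
  have h0S : (0 : ℝ) ∈ S := by simpa [hS, hγ] using ⟨hz, hz1⟩
  have hsub : Icc (0 : ℝ) 1 ⊆ S := by
    refine hclosed.Icc_subset_of_forall_exists_gt h0S ?_
    rintro s ⟨⟨hs1, hs2⟩, hs0, hslt⟩ y hy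
    have hsy : s < y := hy
    have hlt2 : ‖g (γ s)‖ < 2 := by linarith
    have hev : ∀ᶠ v in 𝓝 (γ s), AnalyticAt ℂ g v ∧ ‖g v‖ < 2 :=
      hs1.eventually_analyticAt.and
        ((hs1.continuousAt.norm.tendsto).eventually_lt_const hlt2)
    have hev2 : ∀ᶠ v in 𝓝 (γ s), v ∈ Metric.ball z r :=
      Metric.isOpen_ball.mem_nhds (hγmem s ⟨hs0, hslt.le⟩)
    obtain ⟨ε, hε, hball⟩ := Metric.eventually_nhds_iff_ball.1 (hev.and hev2)
    have hev3 : ∀ᶠ t in 𝓝[>] s, γ t ∈ Metric.ball (γ s) ε :=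
      ((hγc.tendsto s).eventually (Metric.ball_mem_nhds _ hε)).filter_mono nhdsWithin_le_nhds
    have hev4 : ∀ᶠ t in 𝓝[>] s, t ∈ Ioc s y := Ioc_mem_nhdsGT hsy
    obtain ⟨t, ht1, ht2⟩ := (hev3.and hev4).exists
    refine ⟨t, ⟨(hball _ ht1).1.1, ?_⟩, ht2⟩
    have hmvt := (convex_ball (γ s) ε).norm_image_sub_le_of_norm_deriv_le (f := g) (C := 5 * C)
      (fun x hx => (hball x hx).1.1.differentiableAt)
      (fun x hx => by
        have h1 := (hg x (hball x hx).2).norm_deriv_le (hball x hx).1.1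
        have h2 := (hball x hx).1.2
        refine h1.trans ?_
        have h3 : ‖g x‖ ^ 2 ≤ 4 := by nlinarith [norm_nonneg (g x)]
        nlinarith)
      (Metric.mem_ball_self hε) ht1
    have hγd : γ t - γ s = (t - s : ℝ) * (w - z) := by simp [hγ]; ring
    rw [hγd, norm_mul, norm_real, Real.norm_eq_abs, abs_of_pos (by linarith [ht2.1])] at hmvt
    have h3 : ‖g (γ t)‖ ≤ ‖g (γ s)‖ + ‖g (γ t) - g (γ s)‖ := by
      have := norm_add_le (g (γ s)) (g (γ t) - g (γ s))
      simpa using this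
    have h4 : 5 * C * ((t - s) * ‖w - z‖) ≤ t - s := by
      have h5 : C * ‖w - z‖ ≤ C * r := by gcongr
      have h6 : 0 < t - s := by linarith [ht2.1]
      nlinarith
    linarith
  have h1 := hsub (show (1 : ℝ) ∈ Icc (0 : ℝ) 1 by simp)
  have h2 : γ 1 = w := by simp [hγ]
  rw [hS, mem_ofPred_eq, h2] at h1
  exact ⟨h1.1, by linarith [h1.2]⟩

theorem SphDerivLE.comp_affine {g : ℂ → ℂ} {C a b : ℝ} {p q : ℂ} (ha : 0 < a) (hb : 0 ≤ b)
    (hC : 0 ≤ C) (h : SphDerivLE g C (p + b * q)) :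
    SphDerivLE (fun ζ => (a : ℂ) * g (p + b * ζ)) (C * b * max a a⁻¹) q := by
  have haff : AnalyticAt ℂ (fun ζ : ℂ => p + b * ζ) q := by fun_prop
  have hder : HasDerivAt (fun ζ : ℂ => p + b * ζ) (b : ℂ) q := by
    simpa using ((hasDerivAt_id q).const_mul (b : ℂ)).const_add p
  have hinv : (fun ζ => (a : ℂ) * g (p + b * ζ))⁻¹ = fun ζ => (a : ℂ)⁻¹ * g⁻¹ (p + b * ζ) := by
    ext ζ; simp [mul_comm]
  have key : ∀ (c : ℝ) (f : ℂ → ℂ), 0 < c → AnalyticAt ℂ f (p + b * q) →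
      ‖deriv f (p + b * q)‖ ≤ C * (1 + ‖f (p + b * q)‖ ^ 2) →
      AnalyticAt ℂ (fun ζ => (c : ℂ) * f (p + b * ζ)) q ∧
      ‖deriv (fun ζ => (c : ℂ) * f (p + b * ζ)) q‖ ≤
        (C * b * max c c⁻¹) * (1 + ‖(c : ℂ) * f (p + b * q)‖ ^ 2) := by
    intro c f hc hf hd
    refine ⟨analyticAt_const.mul (AnalyticAt.comp (g := f) (f := fun ζ : ℂ => p + b * ζ) hf haff), ?_⟩
    have h1 : HasDerivAt (fun ζ => (c : ℂ) * f (p + b * ζ)) (c * (deriv f (p + b * q) * b)) q :=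
      ((hf.differentiableAt.hasDerivAt).comp q hder).const_mul (c : ℂ)
    rw [h1.deriv]
    simp only [norm_mul, norm_real, Real.norm_eq_abs, abs_of_pos hc, abs_of_nonneg hb]
    have h2 : c * (1 + ‖f (p + b * q)‖ ^ 2) ≤
        max c c⁻¹ * (1 + (c * ‖f (p + b * q)‖) ^ 2) := by
      rcases le_total 1 c with h | h
      · calc c * (1 + ‖f (p + b * q)‖ ^ 2) ≤ c * (1 + (c * ‖f (p + b * q)‖) ^ 2) := by
              gcongr; nlinarith [norm_nonneg (f (p + b * q))]
          _ ≤ _ := by gcongr; exact le_max_left _ _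
      · calc c * (1 + ‖f (p + b * q)‖ ^ 2) ≤ c⁻¹ * (1 + (c * ‖f (p + b * q)‖) ^ 2) := by
              have : c⁻¹ * (1 + (c * ‖f (p + b * q)‖) ^ 2) = c⁻¹ + c * ‖f (p + b * q)‖ ^ 2 := by
                field_simp
              rw [this]
              have : c ≤ c⁻¹ := h.trans (one_le_inv₀ hc |>.2 h)
              linarith
          _ ≤ _ := by gcongr; exact le_max_right _ _
    calc c * (‖deriv f (p + b * q)‖ * b) ≤ c * (C * (1 + ‖f (p + b * q)‖ ^ 2) * b) := by gcongr
      _ = C * b * (c * (1 + ‖f (p + b * q)‖ ^ 2)) := by ring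
      _ ≤ C * b * (max c c⁻¹ * (1 + (c * ‖f (p + b * q)‖) ^ 2)) := by gcongr
      _ = _ := by ring
  rcases h with ⟨h1, h2⟩ | ⟨h1, h2⟩
  · exact Or.inl (key a g ha h1 h2)
  · right
    rw [hinv]
    have := key a⁻¹ g⁻¹ (inv_pos.2 ha) h1 h2
    rw [inv_inv, max_comm] at this
    push_cast at this
    exact this

/-- The pointwise limit along a filter (with value `0` where there is no finite limit). -/
def filterLim (l : Filter ℕ) (g : ℕ → ℂ → ℂ) : ℂ → ℂ := fun z =>
  if h : ∃ L, Tendsto (fun j => g j z) l (𝓝 L) then h.choose else 0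

/-- Uniform convergence of analytic functions on a disc about `z`. -/
def ConvNear (l : Filter ℕ) (g : ℕ → ℂ → ℂ) (h : ℂ → ℂ) (z : ℂ) : Prop :=
  ∃ r > 0, (∀ᶠ j in l, ∀ w ∈ Metric.ball z r, AnalyticAt ℂ (g j) w) ∧
    TendstoUniformlyOn g h l (Metric.ball z r)

/-- Uniform convergence to infinity of meromorphic functions on a disc about `z`. -/
def InftyNear (l : Filter ℕ) (g : ℕ → ℂ → ℂ) (z : ℂ) : Prop :=
  ∃ r > 0, (∀ᶠ j in l, (∀ w ∈ Metric.ball z r, AnalyticAt ℂ (g j)⁻¹ w) ∧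
      ∃ w ∈ Metric.ball z r, g j w ≠ 0) ∧
    TendstoUniformlyOn (fun j => (g j)⁻¹) 0 l (Metric.ball z r)

theorem filterLim_eq {l : Filter ℕ} [l.NeBot] {g : ℕ → ℂ → ℂ} {z L : ℂ}
    (h : Tendsto (fun j => g j z) l (𝓝 L)) : filterLim l g z = L := by
  have hex : ∃ L, Tendsto (fun j => g j z) l (𝓝 L) := ⟨L, h⟩
  rw [filterLim, dif_pos hex]
  exact tendsto_nhds_unique hex.choose_spec h

theorem filterLim_eq_inv {l : Filter ℕ} [l.NeBot] {g : ℕ → ℂ → ℂ} {z v : ℂ}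
    (h : Tendsto (fun j => (g j)⁻¹ z) l (𝓝 v)) : filterLim l g z = v⁻¹ := by
  by_cases hv : v = 0
  · by_cases hex : ∃ L, Tendsto (fun j => g j z) l (𝓝 L)
    · obtain ⟨L, hL⟩ := hex
      rw [filterLim_eq hL]
      by_contra hne
      have hL0 : L ≠ 0 := by
        intro h0; apply hne; rw [h0, hv, inv_zero]
      have := tendsto_nhds_unique h (hL.inv₀ hL0)
      rw [hv] at this
      exact inv_ne_zero hL0 this.symm
    · rw [filterLim, dif_neg hex, hv, inv_zero]
  · refine filterLim_eq ?_
    have := h.inv₀ hv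
    simpa using this

theorem tendstoUniformlyOn_filterLim {l : Ultrafilter ℕ} {g : ℕ → ℂ → ℂ} {z : ℂ} {r M : ℝ}
    (hM : 0 ≤ M)
    (h : ∀ᶠ j in (l : Filter ℕ), ∀ w ∈ Metric.ball z r, AnalyticAt ℂ (g j) w ∧ ‖g j w‖ ≤ 2 ∧
      ‖deriv (g j) w‖ ≤ M) :
    (∀ w ∈ Metric.ball z r, Tendsto (fun j => g j w) l (𝓝 (filterLim l g w))) ∧
    TendstoUniformlyOn g (filterLim l g) l (Metric.ball z r) := by
  have hlim : ∀ w ∈ Metric.ball z r, Tendsto (fun j => g j w) l (𝓝 (filterLim l g w)) := by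
    intro w hw
    have hmem : (l.map fun j => g j w : Filter ℂ) ≤ 𝓟 (Metric.closedBall 0 2) := by
      rw [Filter.le_principal_iff, Ultrafilter.coe_map, Filter.mem_map]
      filter_upwards [h] with j hj
      simpa using (hj w hw).2.1
    obtain ⟨L, _, hL⟩ := (isCompact_closedBall (0 : ℂ) 2).ultrafilter_le_nhds _ hmem
    have hL' : Tendsto (fun j => g j w) l (𝓝 L) := hL
    rwa [filterLim_eq hL']
  refine ⟨hlim, ?_⟩
  have hlip : ∀ᶠ j in (l : Filter ℕ), ∀ w ∈ Metric.ball z r, ∀ w' ∈ Metric.ball z r,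
      ‖g j w' - g j w‖ ≤ M * ‖w' - w‖ := by
    filter_upwards [h] with j hj w hw w' hw'
    exact (convex_ball z r).norm_image_sub_le_of_norm_deriv_le
      (fun x hx => (hj x hx).1.differentiableAt) (fun x hx => (hj x hx).2.2) hw hw'
  have hlip' : ∀ w ∈ Metric.ball z r, ∀ w' ∈ Metric.ball z r,
      ‖filterLim l g w' - filterLim l g w‖ ≤ M * ‖w' - w‖ := by
    intro w hw w' hw'
    refine le_of_tendsto ((hlim w' hw').sub (hlim w hw)).norm ?_
    filter_upwards [hlip] with j hj using hj w hw w' hw'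
  rw [Metric.tendstoUniformlyOn_iff]
  intro ε hε
  have hδ : 0 < ε / (3 * (M + 1)) := by positivity
  have htb : TotallyBounded (Metric.ball z r) :=
    (isCompact_closedBall z r).totallyBounded.subset Metric.ball_subset_closedBall
  obtain ⟨t, hts, htf, htc⟩ := Metric.finite_approx_of_totallyBounded htb _ hδ
  have hnet : ∀ᶠ j in (l : Filter ℕ), ∀ p ∈ t, ‖g j p - filterLim l g p‖ < ε / 3 := by
    rw [eventually_all_finite htf]
    intro p hp
    have := ((hlim p (hts hp)).sub_const (filterLim l g p)).norm
    rw [sub_self, norm_zero] at this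
    exact this.eventually_lt_const (by positivity)
  filter_upwards [hnet, hlip] with j hj1 hj2 w hw
  obtain ⟨p, hp, hwp⟩ := mem_iUnion₂.1 (htc hw)
  have hd : ‖w - p‖ < ε / (3 * (M + 1)) := by simpa [dist_eq_norm] using hwp
  have hMd : M * ‖w - p‖ ≤ ε / 3 := by
    calc M * ‖w - p‖ ≤ M * (ε / (3 * (M + 1))) := by gcongr
      _ = (M / (M + 1)) * (ε / 3) := by field_simp
      _ ≤ 1 * (ε / 3) := by
        gcongr
        rw [div_le_one (by positivity)]; linarith
      _ = ε / 3 := one_mul _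
  have h1 := hj1 p hp
  have h2 := hj2 p (hts hp) w hw
  have h3 := hlip' p (hts hp) w hw
  rw [dist_eq_norm]
  have : filterLim l g w - g j w = (filterLim l g w - filterLim l g p) -
      (g j p - filterLim l g p) - (g j w - g j p) := by ring
  rw [this]
  have h4 := norm_sub_le ((filterLim l g w - filterLim l g p) - (g j p - filterLim l g p))
    (g j w - g j p)
  have h5 := norm_sub_le (filterLim l g w - filterLim l g p) (g j p - filterLim l g p)
  linarith

theorem eventually_eq_zero_on_ball {f : ℂ → ℂ} {z w : ℂ} {r : ℝ}
    (hf : ∀ x ∈ Metric.ball z r, AnalyticAt ℂ f x) (hw : w ∈ Metric.ball z r)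
    (h : ∃ᶠ x in 𝓝[≠] w, f x = 0) : ∀ x ∈ Metric.ball z r, f x = 0 := fun _ hx =>
  AnalyticOnNhd.eqOn_zero_of_preconnected_of_frequently_eq_zero hf
    (convex_ball z r).isPreconnected hw h hx

theorem convNear_or_convNear_inv {l : Ultrafilter ℕ} {g : ℕ → ℂ → ℂ} {z : ℂ}
    (h : ∃ r > 0, ∃ C ≥ 0, ∀ᶠ j in (l : Filter ℕ), ∀ w ∈ Metric.ball z r,
      SphDerivLE (g j) C w) :
    ConvNear l g (filterLim l g) z ∨
    ∃ r > 0, (∀ᶠ j in (l : Filter ℕ), (∀ w ∈ Metric.ball z r, AnalyticAt ℂ (g j)⁻¹ w) ∧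
      ∃ w ∈ Metric.ball z r, g j w ≠ 0) ∧
    TendstoUniformlyOn (fun j => (g j)⁻¹) (filterLim l g)⁻¹ l (Metric.ball z r) := by
  obtain ⟨r, hr, C, hC, h⟩ := h
  set ρ := min r (1 / (10 * C + 1)) with hρ
  have hρ0 : 0 < ρ := lt_min hr (by positivity)
  have hρC : 10 * C * ρ ≤ 1 := by
    calc 10 * C * ρ ≤ 10 * C * (1 / (10 * C + 1)) := by gcongr; exact min_le_right _ _
      _ ≤ 1 := by
        rw [mul_one_div, div_le_one (by positivity)]; linarith
  have hsub : Metric.ball z ρ ⊆ Metric.ball z r := Metric.ball_subset_ball (min_le_left _ _)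
  have hbound : ∀ (f : ℂ → ℂ), (∀ w ∈ Metric.ball z r, SphDerivLE f C w) →
      AnalyticAt ℂ f z → ‖f z‖ ≤ 1 → ∀ w ∈ Metric.ball z ρ, AnalyticAt ℂ f w ∧ ‖f w‖ ≤ 2 ∧
        ‖deriv f w‖ ≤ 5 * C := by
    intro f hf h1 h2 w hw
    obtain ⟨h3, h4⟩ := analyticAt_and_norm_le_two hC hρC (fun w hw => hf w (hsub hw)) h1 h2 w hw
    refine ⟨h3, h4, ((hf w (hsub hw)).norm_deriv_le h3).trans ?_⟩
    have h5 : ‖f w‖ ^ 2 ≤ 4 := by nlinarith [norm_nonneg (f w)]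
    nlinarith
  by_cases hA : ∀ᶠ j in (l : Filter ℕ), AnalyticAt ℂ (g j) z ∧ ‖g j z‖ ≤ 1
  · left
    have hev : ∀ᶠ j in (l : Filter ℕ), ∀ w ∈ Metric.ball z ρ, AnalyticAt ℂ (g j) w ∧
        ‖g j w‖ ≤ 2 ∧ ‖deriv (g j) w‖ ≤ 5 * C := by
      filter_upwards [h, hA] with j hj1 hj2
      exact hbound (g j) hj1 hj2.1 hj2.2
    exact ⟨ρ, hρ0, hev.mono fun j hj w hw => (hj w hw).1,
      (tendstoUniformlyOn_filterLim (by positivity) hev).2⟩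
  · right
    have hA' : ∀ᶠ j in (l : Filter ℕ), ¬ (AnalyticAt ℂ (g j) z ∧ ‖g j z‖ ≤ 1) :=
      Ultrafilter.eventually_not.2 hA
    have hev : ∀ᶠ j in (l : Filter ℕ), ∀ w ∈ Metric.ball z ρ, AnalyticAt ℂ (g j)⁻¹ w ∧
        ‖(g j)⁻¹ w‖ ≤ 2 ∧ ‖deriv (g j)⁻¹ w‖ ≤ 5 * C := by
      filter_upwards [h, hA'] with j hj1 hj2
      have h3 := analyticAt_inv_of_one_lt (hj1 z (Metric.mem_ball_self hr)).analyticAt_or hj2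
      exact hbound (g j)⁻¹ (fun w hw => (hj1 w hw).inv) h3.1 h3.2
    have hne : ∀ᶠ j in (l : Filter ℕ), ∃ w ∈ Metric.ball z ρ, g j w ≠ 0 := by
      filter_upwards [hA'] with j hj
      by_contra! hc
      apply hj
      have h0 : (fun _ => (0 : ℂ)) =ᶠ[𝓝 z] g j := by
        filter_upwards [Metric.ball_mem_nhds z hρ0] with w hw
        exact (hc w hw).symm
      refine ⟨analyticAt_const.congr h0, ?_⟩
      rw [hc z (Metric.mem_ball_self hρ0)]; simp
    obtain ⟨h1, h2⟩ := tendstoUniformlyOn_filterLim (g := fun j => (g j)⁻¹)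
      (by positivity : (0 : ℝ) ≤ 5 * C) hev
    refine ⟨ρ, hρ0, (hev.and hne).mono fun j hj => ⟨fun w hw => (hj.1 w hw).1, hj.2⟩, ?_⟩
    refine h2.congr_right ?_
    intro w hw
    simp only [Pi.inv_apply]
    rw [filterLim_eq_inv (h1 w hw), inv_inv]

theorem ConvNear.tendsto {l : Filter ℕ} {g : ℕ → ℂ → ℂ} {h : ℂ → ℂ} {z : ℂ}
    (hc : ConvNear l g h z) : Tendsto (fun j => g j z) l (𝓝 (h z)) := by
  obtain ⟨r, hr, _, h1⟩ := hc
  exact h1.tendsto_at (Metric.mem_ball_self hr)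

theorem ConvNear.eventually {l : Filter ℕ} {g : ℕ → ℂ → ℂ} {h : ℂ → ℂ} {z : ℂ}
    (hc : ConvNear l g h z) : ∀ᶠ w in 𝓝 z, ConvNear l g h w := by
  obtain ⟨r, hr, h1, h2⟩ := hc
  filter_upwards [Metric.ball_mem_nhds z hr] with w hw
  obtain ⟨s, hs, hsub⟩ := Metric.isOpen_iff.1 Metric.isOpen_ball w hw
  exact ⟨s, hs, h1.mono fun j hj x hx => hj x (hsub hx), h2.mono hsub⟩

theorem InftyNear.eventually {l : Filter ℕ} {g : ℕ → ℂ → ℂ} {z : ℂ}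
    (hc : InftyNear l g z) : ∀ᶠ w in 𝓝 z, InftyNear l g w := by
  obtain ⟨r, hr, h1, h2⟩ := hc
  filter_upwards [Metric.ball_mem_nhds z hr] with w hw
  obtain ⟨s, hs, hsub⟩ := Metric.isOpen_iff.1 Metric.isOpen_ball w hw
  refine ⟨s, hs, h1.mono fun j hj => ⟨fun x hx => hj.1 x (hsub hx), ?_⟩, h2.mono hsub⟩
  by_contra! hc
  obtain ⟨x, hx, hx0⟩ := hj.2
  apply hx0
  have := eventually_eq_zero_on_ball hj.1 hw (Eventually.frequently ?_) x hx
  · simpa using this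
  · have : ∀ᶠ x in 𝓝 w, (g j)⁻¹ x = 0 := by
      filter_upwards [Metric.ball_mem_nhds w hs] with y hy
      simp [hc y hy]
    exact this.filter_mono nhdsWithin_le_nhds

theorem InftyNear.tendsto_inv {l : Filter ℕ} {g : ℕ → ℂ → ℂ} {z : ℂ}
    (hc : InftyNear l g z) : Tendsto (fun j => (g j)⁻¹ z) l (𝓝 0) := by
  obtain ⟨r, hr, _, h1⟩ := hc
  exact h1.tendsto_at (Metric.mem_ball_self hr)

theorem InftyNear.not_convNear {l : Filter ℕ} [l.NeBot] {g : ℕ → ℂ → ℂ} {h : ℂ → ℂ} {z : ℂ}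
    (hi : InftyNear l g z) : ¬ ConvNear l g h z := by
  intro hc
  have ht := hc.tendsto
  have hti := hi.tendsto_inv
  obtain ⟨r, hr, h1, _⟩ := hi
  obtain ⟨s, hs, h2, _⟩ := hc
  have hne : ∀ᶠ j in l, g j z ≠ 0 := by
    filter_upwards [h1, h2] with j hj1 hj2 h0
    have hev := eventually_eq_zero_of_analyticAt_inv (hj2 z (Metric.mem_ball_self hs))
      (hj1.1 z (Metric.mem_ball_self hr)) h0
    obtain ⟨x, hx, hx0⟩ := hj1.2
    apply hx0
    have := eventually_eq_zero_on_ball hj1.1 (Metric.mem_ball_self hr) (Eventually.frequently ?_) x hx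
    · simpa using this
    · have : ∀ᶠ x in 𝓝 z, (g j)⁻¹ x = 0 := hev.mono fun x hx => by simp [hx]
      exact this.filter_mono nhdsWithin_le_nhds
  have h3 : Tendsto (fun j => g j z * (g j)⁻¹ z) l (𝓝 (h z * 0)) := ht.mul hti
  have h4 : Tendsto (fun j => g j z * (g j)⁻¹ z) l (𝓝 1) := by
    refine tendsto_const_nhds.congr' ?_
    filter_upwards [hne] with j hj
    simp [hj]
  have := tendsto_nhds_unique h3 h4
  simp at this

theorem ConvNear.analyticAt {l : Filter ℕ} [l.NeBot] {g : ℕ → ℂ → ℂ} {h : ℂ → ℂ} {z : ℂ}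
    (hc : ConvNear l g h z) : AnalyticAt ℂ h z := by
  obtain ⟨r, hr, h1, h2⟩ := hc
  have hd : DifferentiableOn ℂ h (Metric.ball z r) :=
    h2.tendstoLocallyUniformlyOn.differentiableOn
      (h1.mono fun j hj x hx => (hj x hx).differentiableAt.differentiableWithinAt)
      Metric.isOpen_ball
  exact hd.analyticAt (Metric.ball_mem_nhds z hr)

/-- Convergence along an ultrafilter of functions with locally bounded spherical derivatives:
either to infinity everywhere, or to a meromorphic function. -/
theorem inftyNear_or_convNear {l : Ultrafilter ℕ} {g : ℕ → ℂ → ℂ} {D : Set ℂ} (hD : IsOpen D)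
    (hconn : IsPreconnected D)
    (h : ∀ z ∈ D, ∃ r > 0, ∃ C ≥ 0, ∀ᶠ j in (l : Filter ℕ), ∀ w ∈ Metric.ball z r,
      SphDerivLE (g j) C w) :
    (∀ z ∈ D, InftyNear l g z) ∨
    ∀ z ∈ D, ConvNear l g (filterLim l g) z ∨
      (ConvNear l (fun j => (g j)⁻¹) (filterLim l g)⁻¹ z ∧
        ∀ᶠ w in 𝓝[≠] z, filterLim l g w ≠ 0) := by
  have hloc : ∀ z ∈ D, ¬ InftyNear l g z → ConvNear l g (filterLim l g) z ∨
      (ConvNear l (fun j => (g j)⁻¹) (filterLim l g)⁻¹ z ∧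
        ∀ᶠ w in 𝓝[≠] z, filterLim l g w ≠ 0) := by
    intro z hz hnot
    rcases convNear_or_convNear_inv (h z hz) with hc | ⟨r, hr, h1, h2⟩
    · exact Or.inl hc
    · right
      have hcn : ConvNear l (fun j => (g j)⁻¹) (filterLim l g)⁻¹ z :=
        ⟨r, hr, h1.mono fun j hj => hj.1, h2⟩
      refine ⟨hcn, ?_⟩
      rcases hcn.analyticAt.eventually_eq_zero_or_eventually_ne_zero with h0 | h0
      · exfalso
        apply hnot
        obtain ⟨s, hs, hball⟩ := Metric.eventually_nhds_iff_ball.1 h0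
        have hall : ∀ x ∈ Metric.ball z r, (filterLim l g)⁻¹ x = 0 := by
          refine eventually_eq_zero_on_ball ?_ (Metric.mem_ball_self hr)
            (h0.filter_mono nhdsWithin_le_nhds).frequently
          have hd : DifferentiableOn ℂ (filterLim l g)⁻¹ (Metric.ball z r) :=
            h2.tendstoLocallyUniformlyOn.differentiableOn
              (h1.mono fun j hj x hx => (hj.1 x hx).differentiableAt.differentiableWithinAt)
              Metric.isOpen_ball
          exact fun x hx => hd.analyticAt (Metric.isOpen_ball.mem_nhds hx)
        exact ⟨r, hr, h1, h2.congr_right fun x hx => by simpa using hall x hx⟩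
      · filter_upwards [h0] with w hw
        simpa using hw
  by_cases hex : ∃ z ∈ D, InftyNear l g z
  · left
    by_contra! hne
    obtain ⟨z0, hz0, hz0'⟩ := hne
    have hU : IsOpen {z | InftyNear l g z} := by
      rw [isOpen_iff_mem_nhds]
      intro z hz
      exact InftyNear.eventually hz
    have hV : IsOpen {z | z ∈ D ∧ ¬ InftyNear l g z} := by
      rw [isOpen_iff_mem_nhds]
      rintro z ⟨hzD, hz⟩
      have hDn := hD.mem_nhds hzD
      rcases hloc z hzD hz with hc | ⟨hc, hc'⟩
      · filter_upwards [hc.eventually, hDn] with w hw1 hw2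
        exact ⟨hw2, fun hi => hi.not_convNear hw1⟩
      · filter_upwards [hc.eventually, hDn, eventually_nhdsWithin_iff.1 hc'] with w hw1 hw2 hw3
        refine ⟨hw2, fun hi => ?_⟩
        by_cases hwz : w = z
        · rw [hwz] at hi; exact hz hi
        · have := tendsto_nhds_unique hi.tendsto_inv hw1.tendsto
          exact hw3 hwz (by simpa using this.symm)
    obtain ⟨z, hz1, hz2, hz3⟩ := hconn _ _ hU hV
      (fun z hz => by by_cases hi : InftyNear l g z; exacts [Or.inl hi, Or.inr ⟨hz, hi⟩])
      hex ⟨z0, hz0, hz0, hz0'⟩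
    exact hz3.2 hz2
  · right
    push Not at hex
    exact fun z hz => hloc z hz (hex z hz)

theorem convNear_of_tendstoLocallyUniformlyOn {l : Filter ℕ} {g : ℕ → ℂ → ℂ} {h : ℂ → ℂ} {z : ℂ}
    {r : ℝ} (hr : 0 < r) (ha : ∀ᶠ j in l, ∀ w ∈ Metric.ball z r, AnalyticAt ℂ (g j) w)
    (hc : TendstoLocallyUniformlyOn g h l (Metric.ball z r)) : ConvNear l g h z := by
  have hsub : Metric.closedBall z (r / 2) ⊆ Metric.ball z r :=
    Metric.closedBall_subset_ball (by linarith)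
  refine ⟨r / 2, by positivity, ha.mono fun j hj w hw =>
    hj w (hsub (Metric.ball_subset_closedBall hw)), ?_⟩
  exact ((tendstoLocallyUniformlyOn_iff_forall_isCompact Metric.isOpen_ball).1 hc _ hsub
    (isCompact_closedBall _ _)).mono Metric.ball_subset_closedBall

theorem ConvNear.exists_tendsto {l : Filter ℕ} [l.NeBot] {g : ℕ → ℂ → ℂ} {h : ℂ → ℂ} {z : ℂ}
    (hc : ConvNear l g h z) : ∃ r > 0, (∀ᶠ j in l, ∀ w ∈ Metric.ball z r, AnalyticAt ℂ (g j) w) ∧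
      ∀ w ∈ Metric.ball z r, Tendsto (fun p : ℕ × ℂ => g p.1 p.2) (l ×ˢ 𝓝 w) (𝓝 (h w)) := by
  obtain ⟨r, hr, h1, h2⟩ := hc
  refine ⟨r, hr, h1, fun w hw => ?_⟩
  have hcont : ContinuousAt h w := by
    have hd : DifferentiableOn ℂ h (Metric.ball z r) :=
      h2.tendstoLocallyUniformlyOn.differentiableOn
        (h1.mono fun j hj x hx => (hj x hx).differentiableAt.differentiableWithinAt)
        Metric.isOpen_ball
    exact (hd.differentiableAt (Metric.isOpen_ball.mem_nhds hw)).continuousAt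
  rw [Metric.tendsto_nhds]
  intro ε hε
  have h3 := Metric.tendstoUniformlyOn_iff.1 h2 (ε / 2) (by positivity)
  have h4 : ∀ᶠ x in 𝓝 w, x ∈ Metric.ball z r ∧ dist (h x) (h w) < ε / 2 :=
    (Metric.isOpen_ball.eventually_mem hw).and
      (Metric.tendsto_nhds.1 hcont _ (by positivity))
  filter_upwards [h3.prod_mk h4] with p hp
  calc dist (g p.1 p.2) (h w) ≤ dist (g p.1 p.2) (h p.2) + dist (h p.2) (h w) := dist_triangle _ _ _
    _ < ε / 2 + ε / 2 := by
      have := hp.1 p.2 hp.2.1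
      rw [dist_comm] at this
      exact add_lt_add this hp.2.2
    _ = ε := by ring

theorem convNear_of_tendsto {l : Filter ℕ} [l.NeBot] {g : ℕ → ℂ → ℂ} {h : ℂ → ℂ} {z : ℂ} {r : ℝ}
    (hr : 0 < r) (ha : ∀ᶠ j in l, ∀ w ∈ Metric.ball z r, AnalyticAt ℂ (g j) w)
    (hc : ∀ w ∈ Metric.ball z r, Tendsto (fun p : ℕ × ℂ => g p.1 p.2) (l ×ˢ 𝓝 w) (𝓝 (h w))) :
    ConvNear l g h z := by
  refine convNear_of_tendstoLocallyUniformlyOn hr ha ?_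
  rw [Metric.tendstoLocallyUniformlyOn_iff]
  intro ε hε w hw
  have h1 := Metric.tendsto_nhds.1 (hc w hw) (ε / 3) (by positivity)
  obtain ⟨P, hP, Q, hQ, hPQ⟩ := eventually_prod_iff.1 h1
  have hQ' : ∀ᶠ x in 𝓝 w, dist (h x) (h w) ≤ ε / 3 := by
    filter_upwards [hQ, Metric.isOpen_ball.eventually_mem hw] with x hx hxb
    have ht : Tendsto (fun j => g j x) l (𝓝 (h x)) :=
      (hc x hxb).comp (tendsto_id.prodMk tendsto_const_pure |>.mono_right
        (Filter.prod_mono_right _ (pure_le_nhds x)))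
    exact le_of_tendsto (ht.dist tendsto_const_nhds) (hP.mono fun j hj => (hPQ hj hx).le)
  refine ⟨_, (hQ.and hQ').filter_mono nhdsWithin_le_nhds, ?_⟩
  filter_upwards [hP] with j hj x hx
  calc dist (h x) (g j x) ≤ dist (h x) (h w) + dist (h w) (g j x) := dist_triangle _ _ _
    _ < ε := by
      have := hPQ hj hx.1
      rw [dist_comm] at this
      have h2 : dist (h x) (h w) ≤ ε / 3 := hx.2
      linarith

theorem ConvNear.pow {l : Filter ℕ} [l.NeBot] {g : ℕ → ℂ → ℂ} {h : ℂ → ℂ} {z : ℂ}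
    (hc : ConvNear l g h z) (n : ℕ) : ConvNear l (fun j => g j ^ n) (h ^ n) z := by
  obtain ⟨r, hr, h1, h2⟩ := hc.exists_tendsto
  exact convNear_of_tendsto hr (h1.mono fun j hj w hw => (hj w hw).pow n)
    fun w hw => (h2 w hw).pow n

theorem ConvNear.sub_const {l : Filter ℕ} [l.NeBot] {g : ℕ → ℂ → ℂ} {h : ℂ → ℂ} {z : ℂ}
    (hc : ConvNear l g h z) (c : ℂ) : ConvNear l (fun j w => g j w - c) (fun w => h w - c) z := by
  obtain ⟨r, hr, h1, h2⟩ := hc.exists_tendsto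
  exact convNear_of_tendsto hr (h1.mono fun j hj w hw => (hj w hw).sub analyticAt_const)
    fun w hw => (h2 w hw).sub_const c

theorem ConvNear.inv {l : Filter ℕ} [l.NeBot] {g : ℕ → ℂ → ℂ} {h : ℂ → ℂ} {z : ℂ}
    (hc : ConvNear l g h z) (hz : h z ≠ 0) : ConvNear l (fun j => (g j)⁻¹) h⁻¹ z := by
  have hcont := hc.analyticAt.continuousAt
  obtain ⟨r, hr, h1, h2⟩ := hc.exists_tendsto
  obtain ⟨P, hP, Q, hQ, hPQ⟩ := eventually_prod_iff.1
    ((h2 z (Metric.mem_ball_self hr)).eventually_ne hz)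
  obtain ⟨s, hs, hball⟩ := Metric.eventually_nhds_iff_ball.1
    ((hQ.and (Metric.isOpen_ball.eventually_mem (Metric.mem_ball_self (x := z) hr))).and
      (hcont.eventually_ne hz))
  refine convNear_of_tendsto hs ?_ fun w hw => (h2 w (hball w hw).1.2).inv₀ (hball w hw).2
  filter_upwards [h1, hP] with j hj hj' w hw
  exact (hj w (hball w hw).1.2).inv (hPQ hj' (hball w hw).1.1)

theorem ConvNear.deriv {l : Filter ℕ} [l.NeBot] {g : ℕ → ℂ → ℂ} {h : ℂ → ℂ} {z : ℂ}
    (hc : ConvNear l g h z) : ConvNear l (fun j => deriv (g j)) (deriv h) z := by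
  obtain ⟨r, hr, h1, h2⟩ := hc
  refine convNear_of_tendstoLocallyUniformlyOn hr (h1.mono fun j hj w hw => (hj w hw).deriv) ?_
  exact h2.tendstoLocallyUniformlyOn.deriv
    (h1.mono fun j hj x hx => (hj x hx).differentiableAt.differentiableWithinAt)
    Metric.isOpen_ball

theorem ConvNear.iteratedDeriv {l : Filter ℕ} [l.NeBot] {g : ℕ → ℂ → ℂ} {h : ℂ → ℂ} {z : ℂ}
    (hc : ConvNear l g h z) (k : ℕ) :
    ConvNear l (fun j => iteratedDeriv k (g j)) (iteratedDeriv k h) z := by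
  induction k with
  | zero => simpa using hc
  | succ k ih => simpa only [iteratedDeriv_succ] using ih.deriv

theorem ConvNear.norm_deriv_le {l : Filter ℕ} [l.NeBot] {g : ℕ → ℂ → ℂ} {h : ℂ → ℂ} {z : ℂ} {C : ℝ}
    (hc : ConvNear l g h z) (hg : ∀ᶠ j in l, SphDerivLE (g j) C z) :
    ‖_root_.deriv h z‖ ≤ C * (1 + ‖h z‖ ^ 2) := by
  have h1 := hc.deriv.tendsto.norm
  have h2 : Tendsto (fun j => C * (1 + ‖g j z‖ ^ 2)) l (𝓝 (C * (1 + ‖h z‖ ^ 2))) :=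
    ((hc.tendsto.norm.pow 2).const_add 1).const_mul C
  refine le_of_tendsto_of_tendsto h1 h2 ?_
  obtain ⟨r, hr, h3, _⟩ := hc
  filter_upwards [hg, h3] with j hj1 hj2
  exact hj1.norm_deriv_le (hj2 z (Metric.mem_ball_self hr))

/-- Convergence to `h` near `z` in one of the charts of the sphere, excluding the constant
limit infinity. -/
def ConvSphNear (l : Filter ℕ) (g : ℕ → ℂ → ℂ) (h : ℂ → ℂ) (z : ℂ) : Prop :=
  ConvNear l g h z ∨ (ConvNear l (fun j => (g j)⁻¹) h⁻¹ z ∧ ∀ᶠ w in 𝓝[≠] z, h w ≠ 0)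

theorem ConvSphNear.sphDerivLE {l : Filter ℕ} [l.NeBot] {g : ℕ → ℂ → ℂ} {h : ℂ → ℂ} {z : ℂ} {C : ℝ}
    (hc : ConvSphNear l g h z) (hg : ∀ᶠ j in l, SphDerivLE (g j) C z) : SphDerivLE h C z := by
  rcases hc with hc | ⟨hc, _⟩
  · exact Or.inl ⟨hc.analyticAt, hc.norm_deriv_le hg⟩
  · exact Or.inr ⟨hc.analyticAt, hc.norm_deriv_le (hg.mono fun j hj => hj.inv)⟩

theorem ConvSphNear.convNear {l : Filter ℕ} [l.NeBot] {g : ℕ → ℂ → ℂ} {h : ℂ → ℂ} {z : ℂ}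
    (hc : ConvSphNear l g h z) (ha : AnalyticAt ℂ h z) : ConvNear l g h z := by
  rcases hc with hc | ⟨hc, h0⟩
  · exact hc
  · have hz : h⁻¹ z ≠ 0 := by
      intro hz
      have hz' : h z = 0 := by simpa using hz
      have hev := eventually_eq_zero_of_analyticAt_inv ha hc.analyticAt hz'
      obtain ⟨w, hw1, hw2⟩ := (h0.and (hev.filter_mono nhdsWithin_le_nhds)).exists
      exact hw1 hw2
    have := hc.inv hz
    simpa using this

/-- Hurwitz's theorem, in a form at a point. -/
theorem ConvNear.hurwitz {l : Filter ℕ} [l.NeBot] {g : ℕ → ℂ → ℂ} {h : ℂ → ℂ} {z : ℂ} {r : ℝ}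
    (hr : 0 < r) (hc : ConvNear l g h z) (hg : ∀ᶠ j in l, ∀ w ∈ Metric.ball z r, g j w ≠ 0) :
    h z ≠ 0 ∨ ∀ᶠ w in 𝓝 z, h w = 0 := by
  rcases hc.analyticAt.eventually_eq_zero_or_eventually_ne_zero with h0 | h0
  · exact Or.inr h0
  · left
    have hlim := hc.tendsto
    have hcn := hc.eventually
    obtain ⟨s, hs, hsa, hsc⟩ := hc
    obtain ⟨t, ht, htb⟩ := Metric.eventually_nhds_iff_ball.1
      ((eventually_nhdsWithin_iff.1 h0).and hcn)
    set ρ := min (min r s) t / 2 with hρ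
    have hm : 0 < min (min r s) t := lt_min (lt_min hr hs) ht
    have hρ0 : 0 < ρ := by positivity
    have hρm : ρ < min (min r s) t := by rw [hρ]; linarith
    have hρr : ρ < r := hρm.trans_le ((min_le_left _ _).trans (min_le_left _ _))
    have hρs : ρ < s := hρm.trans_le ((min_le_left _ _).trans (min_le_right _ _))
    have hρt : ρ < t := hρm.trans_le (min_le_right _ _)
    have hcont : ContinuousOn h (Metric.sphere z ρ) := by
      intro w hw
      have : w ∈ Metric.ball z t := by
        rw [Metric.mem_ball, Metric.mem_sphere.1 hw]; exact hρt
      exact (htb w this).2.analyticAt.continuousAt.continuousWithinAt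
    obtain ⟨w0, hw0, hmin⟩ := (isCompact_sphere z ρ).exists_isMinOn
      (NormedSpace.sphere_nonempty.2 hρ0.le) hcont.norm
    have hw0pos : 0 < ‖h w0‖ := by
      rw [norm_pos_iff]
      have hmem : w0 ∈ Metric.ball z t := by
        rw [Metric.mem_ball, Metric.mem_sphere.1 hw0]; exact hρt
      refine (htb w0 hmem).1 ?_
      rintro rfl
      have := Metric.mem_sphere.1 hw0
      rw [dist_self] at this
      linarith
    have hunif := Metric.tendstoUniformlyOn_iff.1 hsc (‖h w0‖ / 2) (by positivity)
    have hlow : ∀ᶠ j in l, ‖h w0‖ / 2 ≤ ‖g j z‖ := by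
      filter_upwards [hunif, hsa, hg] with j hj1 hj2 hj3
      have hclb : Metric.closedBall z ρ ⊆ Metric.ball z s := Metric.closedBall_subset_ball hρs
      have hdiff : DifferentiableOn ℂ (g j)⁻¹ (Metric.closedBall z ρ) := fun w hw =>
        ((hj2 w (hclb hw)).inv (hj3 w (Metric.closedBall_subset_ball hρr hw))).differentiableAt.differentiableWithinAt
      have hbd : ∀ w ∈ frontier (Metric.ball z ρ), ‖(g j)⁻¹ w‖ ≤ (‖h w0‖ / 2)⁻¹ := by
        intro w hw
        rw [frontier_ball z hρ0.ne'] at hw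
        have h1 : ‖h w0‖ ≤ ‖h w‖ := hmin hw
        have h2 : dist (h w) (g j w) < ‖h w0‖ / 2 :=
          hj1 w (hclb (Metric.sphere_subset_closedBall hw))
        rw [dist_eq_norm] at h2
        have h3 := norm_sub_norm_le (h w) (g j w)
        simp only [Pi.inv_apply, norm_inv]
        gcongr
        linarith
      have hmax := Complex.norm_le_of_forall_mem_frontier_norm_le Metric.isBounded_ball
        ⟨hdiff.mono Metric.ball_subset_closedBall, by
          rw [closure_ball z hρ0.ne']; exact hdiff.continuousOn⟩ hbd
        (subset_closure (Metric.mem_ball_self hρ0))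
      simp only [Pi.inv_apply, norm_inv] at hmax
      have hgz : 0 < ‖g j z‖ := norm_pos_iff.2 (hj3 z (Metric.mem_ball_self hr))
      exact (inv_le_inv₀ hgz (by positivity)).1 hmax
    have :=
      ge_of_tendsto hlim.norm hlow
    rw [← norm_pos_iff]
    linarith

theorem iteratedDeriv_comp_affine (k : ℕ) (f : ℂ → ℂ) (p b q : ℂ) :
    iteratedDeriv k (fun ζ => f (p + b * ζ)) q = b ^ k * iteratedDeriv k f (p + b * q) := by
  induction k generalizing q with
  | zero => simp
  | succ k ih =>
    rw [iteratedDeriv_succ, iteratedDeriv_succ]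
    have : iteratedDeriv k (fun ζ => f (p + b * ζ)) =
        fun q => b ^ k * iteratedDeriv k f (p + b * q) := funext ih
    rw [this, deriv_const_mul_field]
    have h1 : deriv (fun q => iteratedDeriv k f (p + b * q)) q =
        b • deriv (fun w => iteratedDeriv k f (p + w)) (b * q) :=
      deriv_comp_mul_left b (fun w => iteratedDeriv k f (p + w)) q
    rw [h1, deriv_comp_const_add]
    simp only [smul_eq_mul]
    ring

theorem iteratedDeriv_pow_comp_affine (k n : ℕ) (g : ℂ → ℂ) (a p b q : ℂ) :
    iteratedDeriv k ((fun ζ => a * g (p + b * ζ)) ^ n) q =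
      a ^ n * b ^ k * iteratedDeriv k (g ^ n) (p + b * q) := by
  have h1 : (fun ζ => a * g (p + b * ζ)) ^ n = a ^ n • fun ζ => (g ^ n) (p + b * ζ) := by
    ext ζ; simp [mul_pow]
  rw [h1, iteratedDeriv_const_smul_field, iteratedDeriv_comp_affine, smul_eq_mul, mul_assoc]

theorem meromorphicAt_of_analyticAt_or {g : ℂ → ℂ} {z : ℂ}
    (h : AnalyticAt ℂ g z ∨ AnalyticAt ℂ g⁻¹ z) : MeromorphicAt g z := by
  rcases h with h | h
  · exact h.meromorphicAt
  · simpa using h.meromorphicAt.inv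

theorem inv_eq_zero_of_not_analyticAt {g : ℂ → ℂ} {p : ℂ} (hna : ¬ AnalyticAt ℂ g p)
    (h : AnalyticAt ℂ g⁻¹ p) : g⁻¹ p = 0 ∧ ∀ᶠ w in 𝓝[≠] p, g⁻¹ w ≠ 0 := by
  constructor
  · by_contra h0
    have := h.inv h0
    rw [inv_inv] at this
    exact hna this
  · rcases h.eventually_eq_zero_or_eventually_ne_zero with h0 | h0
    · exfalso
      apply hna
      have h1 : (fun _ => (0 : ℂ)) =ᶠ[𝓝 p] g := h0.mono fun w hw => by
        simpa using hw.symm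
      exact analyticAt_const.congr h1
    · exact h0

theorem exists_pole_order {g : ℂ → ℂ} {p : ℂ} (hna : ¬ AnalyticAt ℂ g p)
    (h : AnalyticAt ℂ g⁻¹ p) : ∃ m : ℕ, 1 ≤ m ∧ meromorphicOrderAt g p = ((-(m : ℤ) : ℤ) : WithTop ℤ) ∧
      meromorphicOrderAt g⁻¹ p = ((m : ℤ) : WithTop ℤ) := by
  obtain ⟨h0, h1⟩ := inv_eq_zero_of_not_analyticAt hna h
  have hne : meromorphicOrderAt g⁻¹ p ≠ ⊤ :=
    (meromorphicOrderAt_ne_top_iff_eventually_ne_zero h.meromorphicAt).2 h1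
  have hpos : 0 < meromorphicOrderAt g⁻¹ p := by
    rw [← tendsto_zero_iff_meromorphicOrderAt_pos h.meromorphicAt]
    have := h.continuousAt.tendsto.mono_left (nhdsWithin_le_nhds (s := {p}ᶜ))
    rwa [h0] at this
  obtain ⟨m, hm⟩ := WithTop.ne_top_iff_exists.1 hne
  rw [← hm] at hpos
  have hm0 : 0 < m := by exact_mod_cast hpos
  lift m to ℕ using hm0.le
  refine ⟨m, by exact_mod_cast hm0, ?_, hm.symm⟩
  have h2 : meromorphicOrderAt g p = -meromorphicOrderAt g⁻¹ p := by
    rw [← meromorphicOrderAt_inv, inv_inv]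
  rw [h2, ← hm]
  rfl

theorem meromorphicOrderAt_iteratedDeriv {f : ℂ → ℂ} {p : ℂ} {a : ℕ} (ha : 1 ≤ a)
    (h : meromorphicOrderAt f p = ((-(a : ℤ) : ℤ) : WithTop ℤ)) (k : ℕ) :
    meromorphicOrderAt (iteratedDeriv k f) p = ((-((a + k : ℕ) : ℤ) : ℤ) : WithTop ℤ) := by
  induction k with
  | zero => simpa using h
  | succ k ih =>
    rw [iteratedDeriv_succ, meromorphicOrderAt_deriv_eq_sub_one ?_ ih]
    · congr 1
      push_cast
      ring
    · push_cast
      rw [neg_ne_zero]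
      norm_cast
      omega

theorem MeromorphicAt.iteratedDeriv {f : ℂ → ℂ} {p : ℂ} (h : MeromorphicAt f p) (k : ℕ) :
    MeromorphicAt (iteratedDeriv k f) p := by
  rw [iteratedDeriv_eq_iterate]
  exact h.iterated_deriv

theorem meromorphicOrderAt_iteratedDeriv_pow_sub_one {g : ℂ → ℂ} {p : ℂ} {m n k : ℕ} (hm : 1 ≤ m)
    (hn : 1 ≤ n) (h : meromorphicOrderAt g p = ((-(m : ℤ) : ℤ) : WithTop ℤ)) :
    meromorphicOrderAt (fun z => iteratedDeriv k (g ^ n) z - 1) p =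
      ((-((n * m + k : ℕ) : ℤ) : ℤ) : WithTop ℤ) := by
  have hg : MeromorphicAt g p := by
    refine meromorphicAt_of_meromorphicOrderAt_ne_zero ?_
    rw [h]
    norm_cast
    omega
  have hpow : meromorphicOrderAt (g ^ n) p = ((-((n * m : ℕ) : ℤ) : ℤ) : WithTop ℤ) := by
    rw [meromorphicOrderAt_pow hg, h]
    have : ((n : ℤ) : WithTop ℤ) * ((-(m : ℤ) : ℤ) : WithTop ℤ) =
      ((n * (-m) : ℤ) : WithTop ℤ) := (WithTop.coe_mul ..).symm
    refine this.trans ?_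
    congr 1
    push_cast
    ring
  have hk := meromorphicOrderAt_iteratedDeriv (Nat.mul_pos hn hm) hpow k
  have h1 : (fun z => iteratedDeriv k (g ^ n) z - 1) = iteratedDeriv k (g ^ n) + fun _ => -1 := by
    ext z; simp [sub_eq_add_neg]
  rw [h1, meromorphicOrderAt_add_eq_left_of_lt, hk]
  · exact MeromorphicAt.const _ _
  · rw [hk, meromorphicOrderAt_const]
    simp only [neg_eq_zero, one_ne_zero, if_false]
    have h2 := Nat.mul_pos hn hm
    have : (-((n * m + k : ℕ) : ℤ)) < 0 := by push_cast; nlinarith [Nat.zero_le k]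
    exact_mod_cast this

theorem norm_le_of_norm_deriv_le {f : ℂ → ℂ} (hf : Differentiable ℂ f) {M : ℝ} (hM : 0 ≤ M) {a : ℕ}
    (h : ∀ z, ‖deriv f z‖ ≤ M * (1 + ‖z‖) ^ a) :
    ∃ M' ≥ 0, ∀ z, ‖f z‖ ≤ M' * (1 + ‖z‖) ^ (a + 1) := by
  refine ⟨M + ‖f 0‖, by positivity, fun z => ?_⟩
  have h1 := (convex_closedBall (0 : ℂ) ‖z‖).norm_image_sub_le_of_norm_deriv_le (f := f)
    (C := M * (1 + ‖z‖) ^ a) (x := 0) (y := z) (fun x _ => hf x) (fun x hx => by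
      refine (h x).trans ?_
      gcongr
      simpa using hx) (by simp) (by simp)
  have h2 : ‖f z‖ ≤ ‖f 0‖ + ‖f z - f 0‖ := by
    have := norm_add_le (f 0) (f z - f 0)
    simpa using this
  have h3 : 1 ≤ (1 + ‖z‖) ^ (a + 1) := one_le_pow₀ (by linarith [norm_nonneg z])
  rw [sub_zero] at h1
  calc ‖f z‖ ≤ ‖f 0‖ * 1 + M * (1 + ‖z‖) ^ a * ‖z‖ := by linarith
    _ ≤ ‖f 0‖ * (1 + ‖z‖) ^ (a + 1) + M * (1 + ‖z‖) ^ a * (1 + ‖z‖) := by gcongr; linarith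
    _ = _ := by ring

theorem norm_le_of_norm_iteratedDeriv_le {f : ℂ → ℂ} (hf : Differentiable ℂ f) {M : ℝ} (hM : 0 ≤ M)
    (k : ℕ) {a : ℕ} (h : ∀ z, ‖iteratedDeriv k f z‖ ≤ M * (1 + ‖z‖) ^ a) :
    ∃ M' ≥ 0, ∀ z, ‖f z‖ ≤ M' * (1 + ‖z‖) ^ (a + k) := by
  induction k generalizing a M with
  | zero => exact ⟨M, hM, by simpa using h⟩
  | succ k ih =>
    have hd : Differentiable ℂ (iteratedDeriv k f) :=
      hf.contDiff.differentiable_iteratedDeriv k (WithTop.coe_lt_top _)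
    obtain ⟨M', hM', h'⟩ := norm_le_of_norm_deriv_le hd hM (a := a)
      (by simpa only [iteratedDeriv_succ] using h)
    obtain ⟨M'', h1, h2⟩ := ih hM' h'
    exact ⟨M'', h1, by simpa [add_assoc, add_comm 1 k] using h2⟩

/-- An entire function whose `n`-th power has a bounded derivative of order `k < n` is constant. -/
theorem eq_const_of_norm_iteratedDeriv_pow_le {g : ℂ → ℂ} (hg : Differentiable ℂ g) {k n : ℕ}
    (hkn : k < n) {M : ℝ} (h : ∀ z, ‖iteratedDeriv k (g ^ n) z‖ ≤ M) : ∀ z, g z = g 0 := by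
  have hM : 0 ≤ M := (norm_nonneg _).trans (h 0)
  obtain ⟨M', hM', h1⟩ := norm_le_of_norm_iteratedDeriv_le (hg.pow n) hM k (a := 0) (by simpa using h)
  have hder : ∀ z, deriv g z = 0 := by
    intro z
    have hbound : ∀ R : ℝ, 1 + ‖z‖ ≤ R → ‖deriv g z‖ ^ n ≤ M' * 2 ^ k / R := by
      intro R hR
      have hR0 : 0 < R := by linarith [norm_nonneg z]
      have hR1 : 1 ≤ R := by linarith [norm_nonneg z]
      obtain ⟨w, hw, hmax⟩ := (isCompact_sphere z R).exists_isMaxOn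
        (NormedSpace.sphere_nonempty.2 hR0.le) hg.continuous.norm.continuousOn
      have h2 := Complex.norm_deriv_le_of_forall_mem_sphere_norm_le hR0 hg.diffContOnCl
        (fun x hx => hmax hx)
      have h3 := h1 w
      simp only [zero_add, Pi.pow_apply, norm_pow] at h3
      have h4 : ‖w‖ ≤ ‖z‖ + R := by
        have := norm_add_le z (w - z)
        rw [← dist_eq_norm w z, Metric.mem_sphere.1 hw] at this
        simpa using this
      calc ‖deriv g z‖ ^ n ≤ (‖g w‖ / R) ^ n := by gcongr
        _ = ‖g w‖ ^ n / R ^ n := div_pow _ _ _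
        _ ≤ (M' * (1 + ‖w‖) ^ k) / R ^ (k + 1) := by
          gcongr
          exact hkn
        _ ≤ (M' * (2 * R) ^ k) / R ^ (k + 1) := by gcongr; linarith
        _ = _ := by rw [mul_pow, pow_succ]; field_simp
    by_contra hne
    have hpos : 0 < ‖deriv g z‖ ^ n := pow_pos (norm_pos_iff.2 hne) n
    have hlim : Tendsto (fun R : ℝ => M' * 2 ^ k / R) atTop (𝓝 0) :=
      tendsto_const_nhds.div_atTop tendsto_id
    obtain ⟨R, hR1, hR2⟩ := ((hlim.eventually_lt_const hpos).and
      (eventually_ge_atTop (1 + ‖z‖))).exists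
    exact absurd (hbound R hR2) (not_le.2 hR1)
  exact fun z => is_const_of_deriv_eq_zero hg hder z 0

/-- The class of meromorphic functions in the plane arising as rescaling limits. -/
structure IsLimitFun (n k : ℕ) (C : ℝ) (g : ℂ → ℂ) : Prop where
  sph : ∀ z, SphDerivLE g C z
  ne_one : ∀ z, AnalyticAt ℂ g z → iteratedDeriv k (g ^ n) z ≠ 1

theorem AnalyticAt.iteratedDeriv' {f : ℂ → ℂ} {z : ℂ} (h : AnalyticAt ℂ f z) (k : ℕ) :
    AnalyticAt ℂ (iteratedDeriv k f) z := by
  rw [iteratedDeriv_eq_iterate]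
  exact h.iterated_deriv k

theorem isLimitFun_of_convSphNear {n k : ℕ} (hk : 1 ≤ k) (hkn : k < n) {l : Filter ℕ} [l.NeBot]
    {g : ℕ → ℂ → ℂ} {h : ℂ → ℂ} {C : ℝ} (hconv : ∀ z, ConvSphNear l g h z)
    (hsph : ∀ z, ∀ᶠ j in l, SphDerivLE (g j) C z)
    (hne : ∀ z, ∃ r > 0, ∀ᶠ j in l, ∀ w ∈ Metric.ball z r, AnalyticAt ℂ (g j) w →
      iteratedDeriv k (g j ^ n) w ≠ 1) : IsLimitFun n k C h := by
  have hsphh : ∀ z, SphDerivLE h C z := fun z => (hconv z).sphDerivLE (hsph z)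
  refine ⟨hsphh, fun z hz h1 => ?_⟩
  have hmer : ∀ z, MeromorphicAt (fun z => iteratedDeriv k (h ^ n) z - 1) z := fun z =>
    (((meromorphicAt_of_analyticAt_or (hsphh z).analyticAt_or).pow n).iteratedDeriv k).sub
      (MeromorphicAt.const _ _)
  have hc := (hconv z).convNear hz
  have hc2 := ((hc.pow n).iteratedDeriv k).sub_const 1
  obtain ⟨r, hr, hne'⟩ := hne z
  obtain ⟨s, hs, han, _⟩ := hc
  have hz0 : ∀ᶠ w in 𝓝 z, iteratedDeriv k (h ^ n) w - 1 = 0 := by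
    refine (hc2.hurwitz (lt_min hr hs) ?_).resolve_left (by simp [h1])
    filter_upwards [hne', han] with j hj1 hj2 w hw
    rw [sub_ne_zero]
    exact hj1 w (Metric.ball_subset_ball (min_le_left _ _) hw)
      (hj2 w (Metric.ball_subset_ball (min_le_right _ _) hw))
  have htop : ∀ w, meromorphicOrderAt (fun z => iteratedDeriv k (h ^ n) z - 1) w = ⊤ := by
    intro w
    by_contra hw
    refine MeromorphicOn.meromorphicOrderAt_ne_top_of_isPreconnected (U := univ)
      (fun z _ => hmer z) isPreconnected_univ (mem_univ w) (mem_univ z) hw ?_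
    rw [meromorphicOrderAt_eq_top_iff]
    exact hz0.filter_mono nhdsWithin_le_nhds
  have hentire : ∀ w, AnalyticAt ℂ h w := by
    intro w
    by_contra hw
    obtain ⟨m, hm, hm1, _⟩ := exists_pole_order hw ((hsphh w).analyticAt_or.resolve_left hw)
    have := meromorphicOrderAt_iteratedDeriv_pow_sub_one (n := n) (k := k) hm (by omega) hm1
    rw [htop w] at this
    exact WithTop.coe_ne_top this.symm
  have hone : ∀ w, iteratedDeriv k (h ^ n) w = 1 := by
    intro w
    have ha : AnalyticAt ℂ (fun z => iteratedDeriv k (h ^ n) z - 1) w :=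
      (((hentire w).pow n).iteratedDeriv' k).sub analyticAt_const
    have h2 := meromorphicOrderAt_eq_top_iff.1 (htop w)
    have h3 := (ha.frequently_zero_iff_eventually_zero.1 h2.frequently).self_of_nhds
    exact sub_eq_zero.1 h3
  have hconst := eq_const_of_norm_iteratedDeriv_pow_le (g := h)
    (fun w => (hentire w).differentiableAt) hkn (M := 1) (fun w => by rw [hone w]; simp)
  have h4 : h ^ n = fun _ => h 0 ^ n := by
    ext w; simp [hconst w]
  have h5 := hone 0
  rw [h4, iteratedDeriv_const, if_neg (by omega)] at h5
  exact zero_ne_one h5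

theorem hasDerivAt_intervalIntegral_of_continuousOn {E : Type*} [NormedAddCommGroup E]
    [NormedSpace ℝ E] [CompleteSpace E] {F F' : ℝ → ℝ → E} {T a b : ℝ}
    (hF : ∀ t < T, ∀ θ, HasDerivAt (fun s => F s θ) (F' t θ) t)
    (hFc : ∀ t < T, Continuous (F t))
    (hF' : ContinuousOn (fun p : ℝ × ℝ => F' p.1 p.2) (Iio T ×ˢ univ)) {t : ℝ} (ht : t < T) :
    HasDerivAt (fun s => ∫ θ in a..b, F s θ) (∫ θ in a..b, F' t θ) t := by
  set ε := (T - t) / 2 with hε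
  have hε0 : 0 < ε := by linarith
  have hK : IsCompact (Icc (t - ε) (t + ε) ×ˢ uIcc a b) := isCompact_Icc.prod isCompact_uIcc
  obtain ⟨M, hM⟩ := hK.exists_bound_of_continuousOn (hF'.mono (by
    rintro ⟨x, y⟩ ⟨hx, -⟩
    refine ⟨?_, mem_univ _⟩
    simp only [mem_Icc, mem_Iio] at hx ⊢
    linarith [hx.2]))
  have hF'c : ∀ t < T, Continuous (F' t) := fun t ht => by
    rw [← continuousOn_univ]
    exact hF'.comp (f := fun θ : ℝ => (t, θ)) (by fun_prop) (fun θ _ => ⟨ht, mem_univ _⟩)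
  refine (intervalIntegral.hasDerivAt_integral_of_dominated_loc_of_deriv_le (μ := volume)
    (s := Ioo (t - ε) (t + ε)) (bound := fun _ => M) (Ioo_mem_nhds (by linarith) (by linarith))
    ?_ ((hFc t ht).intervalIntegrable _ _) (hF'c t ht).aestronglyMeasurable ?_
    (by simp) ?_).2
  · filter_upwards [Iio_mem_nhds ht] with s hs
    exact (hFc s hs).aestronglyMeasurable
  · filter_upwards with θ hθ s hs
    exact hM (s, θ) ⟨Ioo_subset_Icc_self hs, uIoc_subset_uIcc hθ⟩
  · filter_upwards with θ hθ s hs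
    exact hF s (by linarith [hs.2]) θ

/-- The complex derivative of `log (‖b₁‖² + ‖b₂‖²)`. -/
def sphDlog (b₁ b₂ : ℂ → ℂ) (z : ℂ) : ℂ :=
  (deriv b₁ z * star (b₁ z) + deriv b₂ z * star (b₂ z)) /
    (b₁ z * star (b₁ z) + b₂ z * star (b₂ z))

/-- Its derivative in the real direction `c`. -/
def sphDlog' (b₁ b₂ : ℂ → ℂ) (c z : ℂ) : ℂ :=
  ((c * deriv (deriv b₁) z * star (b₁ z) + deriv b₁ z * star (c * deriv b₁ z) +
      (c * deriv (deriv b₂) z * star (b₂ z) + deriv b₂ z * star (c * deriv b₂ z))) *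
      (b₁ z * star (b₁ z) + b₂ z * star (b₂ z)) -
    (deriv b₁ z * star (b₁ z) + deriv b₂ z * star (b₂ z)) *
      (c * deriv b₁ z * star (b₁ z) + b₁ z * star (c * deriv b₁ z) +
        (c * deriv b₂ z * star (b₂ z) + b₂ z * star (c * deriv b₂ z)))) /
    (b₁ z * star (b₁ z) + b₂ z * star (b₂ z)) ^ 2

theorem mul_star_add_mul_star (a b : ℂ) :
    a * star a + b * star b = ((‖a‖ ^ 2 + ‖b‖ ^ 2 : ℝ) : ℂ) := by
  simp only [RCLike.star_def, Complex.mul_conj, Complex.normSq_eq_norm_sq]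
  push_cast; ring

theorem norm_sq_add_norm_sq_pos {a b : ℂ} (h : a ≠ 0 ∨ b ≠ 0) : 0 < ‖a‖ ^ 2 + ‖b‖ ^ 2 := by
  rcases h with h | h
  · have := norm_pos_iff.2 h; positivity
  · have := norm_pos_iff.2 h; positivity

theorem mul_star_add_mul_star_ne_zero {a b : ℂ} (h : a ≠ 0 ∨ b ≠ 0) :
    a * star a + b * star b ≠ 0 := by
  rw [mul_star_add_mul_star]
  exact_mod_cast (norm_sq_add_norm_sq_pos h).ne'

theorem hasDerivAt_comp_line {b : ℂ → ℂ} {γ : ℝ → ℂ} {c : ℂ} {s : ℝ} (hγ : HasDerivAt γ c s)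
    (hb : DifferentiableAt ℂ b (γ s)) : HasDerivAt (fun t => b (γ t)) (c * deriv b (γ s)) s := by
  have := hb.hasDerivAt.comp_of_eq s hγ rfl
  rwa [mul_comm] at this

theorem hasDerivAt_sphDlog {b₁ b₂ : ℂ → ℂ} {γ : ℝ → ℂ} {c : ℂ} {s : ℝ} (hγ : HasDerivAt γ c s)
    (h₁ : AnalyticAt ℂ b₁ (γ s)) (h₂ : AnalyticAt ℂ b₂ (γ s)) (h0 : b₁ (γ s) ≠ 0 ∨ b₂ (γ s) ≠ 0) :
    HasDerivAt (fun t => sphDlog b₁ b₂ (γ t)) (sphDlog' b₁ b₂ c (γ s)) s := by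
  have e₁ := hasDerivAt_comp_line hγ h₁.differentiableAt
  have e₂ := hasDerivAt_comp_line hγ h₂.differentiableAt
  have f₁ := hasDerivAt_comp_line hγ h₁.deriv.differentiableAt
  have f₂ := hasDerivAt_comp_line hγ h₂.deriv.differentiableAt
  exact ((f₁.mul e₁.star).add (f₂.mul e₂.star)).div ((e₁.mul e₁.star).add (e₂.mul e₂.star))
    (mul_star_add_mul_star_ne_zero h0)

theorem hasDerivAt_log_norm_sq {b₁ b₂ : ℂ → ℂ} {γ : ℝ → ℂ} {s : ℝ} (hγ : HasDerivAt γ 1 s)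
    (h₁ : AnalyticAt ℂ b₁ (γ s)) (h₂ : AnalyticAt ℂ b₂ (γ s)) (h0 : b₁ (γ s) ≠ 0 ∨ b₂ (γ s) ≠ 0) :
    HasDerivAt (fun t => Real.log (‖b₁ (γ t)‖ ^ 2 + ‖b₂ (γ t)‖ ^ 2))
      (2 * (sphDlog b₁ b₂ (γ s)).re) s := by
  have e₁ := (hasDerivAt_comp_line hγ h₁.differentiableAt).norm_sq
  have e₂ := (hasDerivAt_comp_line hγ h₂.differentiableAt).norm_sq
  refine ((e₁.add e₂).log (norm_sq_add_norm_sq_pos h0).ne').congr_deriv ?_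
  rw [sphDlog, mul_star_add_mul_star, Complex.div_ofReal_re]
  simp only [one_mul, Complex.inner, Complex.add_re, RCLike.star_def, Pi.add_apply]
  ring_nf

theorem sphDlog'_one_add {b₁ b₂ : ℂ → ℂ} {z : ℂ} (h0 : b₁ z ≠ 0 ∨ b₂ z ≠ 0) :
    sphDlog' b₁ b₂ 1 z + I * sphDlog' b₁ b₂ I z =
      ((2 * ‖deriv b₁ z * b₂ z - b₁ z * deriv b₂ z‖ ^ 2 / (‖b₁ z‖ ^ 2 + ‖b₂ z‖ ^ 2) ^ 2 : ℝ) : ℂ) := by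
  have hne := mul_star_add_mul_star_ne_zero h0
  have h1 : ((2 * ‖deriv b₁ z * b₂ z - b₁ z * deriv b₂ z‖ ^ 2 /
      (‖b₁ z‖ ^ 2 + ‖b₂ z‖ ^ 2) ^ 2 : ℝ) : ℂ) =
      2 * ((deriv b₁ z * b₂ z - b₁ z * deriv b₂ z) * star (deriv b₁ z * b₂ z - b₁ z * deriv b₂ z)) /
      (b₁ z * star (b₁ z) + b₂ z * star (b₂ z)) ^ 2 := by
    rw [mul_star_add_mul_star, RCLike.star_def, Complex.mul_conj, Complex.normSq_eq_norm_sq]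
    push_cast; rfl
  rw [h1, sphDlog', sphDlog', ← mul_div_assoc, ← add_div]
  congr 1
  simp only [star_mul', star_sub, star_one, RCLike.star_def, Complex.conj_I]
  ring_nf
  simp only [Complex.I_sq]
  ring

theorem continuousOn_sphDlog' {b₁ b₂ : ℂ → ℂ} {U : Set ℂ} (c : ℂ) (h₁ : AnalyticOnNhd ℂ b₁ U)
    (h₂ : AnalyticOnNhd ℂ b₂ U) (h0 : ∀ z ∈ U, b₁ z ≠ 0 ∨ b₂ z ≠ 0) :
    ContinuousOn (sphDlog' b₁ b₂ c) U := by
  have e₁ := h₁.continuousOn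
  have e₂ := h₂.continuousOn
  have f₁ := h₁.deriv.continuousOn
  have f₂ := h₂.deriv.continuousOn
  have k₁ := h₁.deriv.deriv.continuousOn
  have k₂ := h₂.deriv.deriv.continuousOn
  refine ContinuousOn.div (by fun_prop) (by fun_prop) fun z hz => ?_
  exact pow_ne_zero _ (mul_star_add_mul_star_ne_zero (h0 z hz))

theorem continuousOn_sphDlog {b₁ b₂ : ℂ → ℂ} {U : Set ℂ} (h₁ : AnalyticOnNhd ℂ b₁ U)
    (h₂ : AnalyticOnNhd ℂ b₂ U) (h0 : ∀ z ∈ U, b₁ z ≠ 0 ∨ b₂ z ≠ 0) :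
    ContinuousOn (sphDlog b₁ b₂) U := by
  have e₁ := h₁.continuousOn
  have e₂ := h₂.continuousOn
  have f₁ := h₁.deriv.continuousOn
  have f₂ := h₂.deriv.continuousOn
  exact ContinuousOn.div (by fun_prop) (by fun_prop) fun z hz =>
    mul_star_add_mul_star_ne_zero (h0 z hz)

theorem continuousOn_log_norm_sq {b₁ b₂ : ℂ → ℂ} {U : Set ℂ} (h₁ : AnalyticOnNhd ℂ b₁ U)
    (h₂ : AnalyticOnNhd ℂ b₂ U) (h0 : ∀ z ∈ U, b₁ z ≠ 0 ∨ b₂ z ≠ 0) :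
    ContinuousOn (fun z => Real.log (‖b₁ z‖ ^ 2 + ‖b₂ z‖ ^ 2)) U := by
  have e₁ := h₁.continuousOn
  have e₂ := h₂.continuousOn
  exact ContinuousOn.log (by fun_prop) fun z hz => (norm_sq_add_norm_sq_pos (h0 z hz)).ne'

theorem antitoneOn_of_hasDerivAt_nonpos {f f' : ℝ → ℝ} {T : ℝ}
    (hf : ∀ t < T, HasDerivAt f (f' t) t) (hf' : ∀ t < T, f' t ≤ 0) : AntitoneOn f (Iio T) := by
  refine antitoneOn_of_deriv_nonpos (convex_Iio T)
    (fun t ht => (hf t ht).continuousAt.continuousWithinAt)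
    (fun t ht => ?_) fun t ht => ?_
  · rw [interior_Iio] at ht
    exact (hf t ht).differentiableAt.differentiableWithinAt
  · rw [interior_Iio] at ht
    rw [(hf t ht).deriv]; exact hf' t ht

theorem le_of_hasDerivAt_nonpos_of_tendsto {f f' : ℝ → ℝ} {T a : ℝ}
    (hf : ∀ t < T, HasDerivAt f (f' t) t) (hf' : ∀ t < T, f' t ≤ 0) (ha : Tendsto f atBot (𝓝 a))
    {t : ℝ} (ht : t < T) : f t ≤ a := by
  refine ge_of_tendsto ha ?_
  filter_upwards [Iic_mem_atBot t] with s hs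
  exact antitoneOn_of_hasDerivAt_nonpos hf hf' (lt_of_le_of_lt hs ht) ht hs

section SphericalMean

variable {b₁ b₂ : ℂ → ℂ} {T C : ℝ}

theorem hasDerivAt_add_ofReal (t : ℝ) (w : ℂ) : HasDerivAt (fun s : ℝ => (s : ℂ) + w) 1 t :=
  (Complex.ofRealCLM.hasDerivAt (x := t)).add_const w

theorem hasDerivAt_add_mul_I (t : ℝ) (w : ℂ) : HasDerivAt (fun s : ℝ => w + (s : ℂ) * I) I t := by
  simpa using ((Complex.ofRealCLM.hasDerivAt (x := t)).mul_const I).const_add w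

theorem hasDerivAt_integral_sphDlog (h₁ : AnalyticOnNhd ℂ b₁ {z | z.re < T})
    (h₂ : AnalyticOnNhd ℂ b₂ {z | z.re < T}) (h0 : ∀ z : ℂ, z.re < T → b₁ z ≠ 0 ∨ b₂ z ≠ 0)
    (hper₁ : ∀ z, b₁ (z + 2 * Real.pi * I) = b₁ z) (hper₂ : ∀ z, b₂ (z + 2 * Real.pi * I) = b₂ z)
    {t : ℝ} (ht : t < T) :
    HasDerivAt (fun s : ℝ => ∫ θ in (0 : ℝ)..2 * Real.pi, sphDlog b₁ b₂ ((s : ℂ) + θ * I))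
      ((∫ θ in (0 : ℝ)..2 * Real.pi, 2 * ‖deriv b₁ (t + θ * I) * b₂ (t + θ * I) -
        b₁ (t + θ * I) * deriv b₂ (t + θ * I)‖ ^ 2 /
        (‖b₁ (t + θ * I)‖ ^ 2 + ‖b₂ (t + θ * I)‖ ^ 2) ^ 2 : ℝ) : ℂ) t := by
  have hre : ∀ s θ : ℝ, ((s : ℂ) + θ * I).re = s := fun s θ => by simp
  have hD := hasDerivAt_intervalIntegral_of_continuousOn (a := 0) (b := 2 * Real.pi)
    (F := fun s θ => sphDlog b₁ b₂ ((s : ℂ) + θ * I))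
    (F' := fun s θ => sphDlog' b₁ b₂ 1 ((s : ℂ) + θ * I)) (T := T) (t := t) (fun s hs θ => by
      have hz : ((s : ℂ) + θ * I).re < T := by rw [hre]; exact hs
      exact hasDerivAt_sphDlog (hasDerivAt_add_ofReal s _) (h₁ _ hz) (h₂ _ hz) (h0 _ hz))
    (fun s hs => by
      rw [← continuousOn_univ]
      exact (continuousOn_sphDlog h₁ h₂ h0).comp (f := fun θ : ℝ => (s : ℂ) + θ * I)
        (by fun_prop) (fun θ _ => by simpa using hs))
    ((continuousOn_sphDlog' 1 h₁ h₂ h0).comp (f := fun p : ℝ × ℝ => (p.1 : ℂ) + p.2 * I)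
      (by fun_prop) (fun p hp => by simpa using hp.1)) ht
  refine hD.congr_deriv ?_
  have hcont : ∀ c, Continuous fun θ : ℝ => sphDlog' b₁ b₂ c ((t : ℂ) + θ * I) := fun c => by
    rw [← continuousOn_univ]
    exact (continuousOn_sphDlog' c h₁ h₂ h0).comp (f := fun θ : ℝ => (t : ℂ) + θ * I)
        (by fun_prop) (fun θ _ => by simpa using ht)
  have hI : ∫ θ in (0 : ℝ)..2 * Real.pi, sphDlog' b₁ b₂ I ((t : ℂ) + θ * I) = 0 := by
    rw [intervalIntegral.integral_eq_sub_of_hasDerivAt (f := fun θ : ℝ => sphDlog b₁ b₂ (t + θ * I))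
      (fun θ _ => by
        have hz : ((t : ℂ) + θ * I).re < T := by rw [hre]; exact ht
        exact hasDerivAt_sphDlog (hasDerivAt_add_mul_I θ _) (h₁ _ hz) (h₂ _ hz) (h0 _ hz))
      ((hcont I).intervalIntegrable _ _)]
    have hd : ∀ b : ℂ → ℂ, (∀ z, b (z + 2 * Real.pi * I) = b z) →
        deriv b (t + 2 * Real.pi * I) = deriv b t := by
      intro b hb
      rw [← deriv_comp_add_const]
      congr 1
      ext z
      exact hb z
    simp only [sphDlog]
    push_cast
    simp only [hd b₁ hper₁, hd b₂ hper₂, hper₁, hper₂, zero_mul, add_zero, sub_self]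
  rw [← intervalIntegral.integral_ofReal]
  calc _ = (∫ θ in (0 : ℝ)..2 * Real.pi, sphDlog' b₁ b₂ 1 ((t : ℂ) + θ * I)) +
        ∫ θ in (0 : ℝ)..2 * Real.pi, I * sphDlog' b₁ b₂ I ((t : ℂ) + θ * I) := by
          rw [intervalIntegral.integral_const_mul, hI, mul_zero, add_zero]
    _ = _ := by
      rw [← intervalIntegral.integral_add ((hcont 1).intervalIntegrable _ _)
        (((hcont I).const_mul I).intervalIntegrable _ _)]
      refine intervalIntegral.integral_congr fun θ _ => ?_
      exact sphDlog'_one_add (h0 _ (by rw [hre]; exact ht))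

theorem hasDerivAt_integral_log_norm_sq (h₁ : AnalyticOnNhd ℂ b₁ {z | z.re < T})
    (h₂ : AnalyticOnNhd ℂ b₂ {z | z.re < T}) (h0 : ∀ z : ℂ, z.re < T → b₁ z ≠ 0 ∨ b₂ z ≠ 0)
    {t : ℝ} (ht : t < T) :
    HasDerivAt (fun s : ℝ => ∫ θ in (0 : ℝ)..2 * Real.pi,
        Real.log (‖b₁ ((s : ℂ) + θ * I)‖ ^ 2 + ‖b₂ ((s : ℂ) + θ * I)‖ ^ 2))
      (2 * (∫ θ in (0 : ℝ)..2 * Real.pi, sphDlog b₁ b₂ ((t : ℂ) + θ * I)).re) t := by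
  have hre : ∀ s θ : ℝ, ((s : ℂ) + θ * I).re = s := fun s θ => by simp
  have hcont : Continuous fun θ : ℝ => sphDlog b₁ b₂ ((t : ℂ) + θ * I) := by
    rw [← continuousOn_univ]
    exact (continuousOn_sphDlog h₁ h₂ h0).comp (f := fun θ : ℝ => (t : ℂ) + θ * I)
        (by fun_prop) (fun θ _ => by simpa using ht)
  have hD := hasDerivAt_intervalIntegral_of_continuousOn (a := 0) (b := 2 * Real.pi)
    (F := fun s θ => Real.log (‖b₁ ((s : ℂ) + θ * I)‖ ^ 2 + ‖b₂ ((s : ℂ) + θ * I)‖ ^ 2))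
    (F' := fun s θ => 2 * (sphDlog b₁ b₂ ((s : ℂ) + θ * I)).re) (T := T) (t := t)
    (fun s hs θ => by
      have hz : ((s : ℂ) + θ * I).re < T := by rw [hre]; exact hs
      exact hasDerivAt_log_norm_sq (hasDerivAt_add_ofReal s _) (h₁ _ hz) (h₂ _ hz) (h0 _ hz))
    (fun s hs => by
      rw [← continuousOn_univ]
      exact (continuousOn_log_norm_sq h₁ h₂ h0).comp (f := fun θ : ℝ => (s : ℂ) + θ * I)
        (by fun_prop) (fun θ _ => by simpa using hs))
    (by
      have := (continuousOn_sphDlog h₁ h₂ h0).comp (f := fun p : ℝ × ℝ => (p.1 : ℂ) + p.2 * I)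
        (s := Iio T ×ˢ univ) (by fun_prop) (fun p hp => by simpa using hp.1)
      exact continuousOn_const.mul (Complex.continuous_re.comp_continuousOn this)) ht
  refine hD.congr_deriv ?_
  rw [intervalIntegral.integral_const_mul]
  congr 1
  exact Complex.reCLM.intervalIntegral_comp_comm (hcont.intervalIntegrable _ _)

end SphericalMean

theorem sphDlog_comp_exp {g₁ g₂ : ℂ → ℂ} {z : ℂ} (h₁ : DifferentiableAt ℂ g₁ (exp z))
    (h₂ : DifferentiableAt ℂ g₂ (exp z)) :
    sphDlog (fun z => g₁ (exp z)) (fun z => g₂ (exp z)) z = exp z * sphDlog g₁ g₂ (exp z) := by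
  have h : ∀ g : ℂ → ℂ, DifferentiableAt ℂ g (exp z) →
      deriv (fun z => g (exp z)) z = deriv g (exp z) * exp z := fun g hg =>
    (hg.hasDerivAt.comp z (Complex.hasDerivAt_exp z)).deriv
  simp only [sphDlog, h g₁ h₁, h g₂ h₂]
  ring

/-- A sub-mean value inequality for `log (‖g₁‖² + ‖g₂‖²)`, whose Laplacian is controlled by the
spherical derivative of `g₁ / g₂`. -/
theorem circleAverage_log_norm_sq_le {g₁ g₂ : ℂ → ℂ} {R R' C : ℝ} (hR : 0 < R) (hRR : R < R')
    (h₁ : AnalyticOnNhd ℂ g₁ (Metric.ball 0 R')) (h₂ : AnalyticOnNhd ℂ g₂ (Metric.ball 0 R'))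
    (h0 : ∀ z ∈ Metric.ball (0 : ℂ) R', g₁ z ≠ 0 ∨ g₂ z ≠ 0)
    (hC : ∀ z ∈ Metric.ball (0 : ℂ) R',
      ‖deriv g₁ z * g₂ z - g₁ z * deriv g₂ z‖ ≤ C * (‖g₁ z‖ ^ 2 + ‖g₂ z‖ ^ 2)) :
    Real.circleAverage (fun z => Real.log (‖g₁ z‖ ^ 2 + ‖g₂ z‖ ^ 2)) 0 R ≤
      Real.log (‖g₁ 0‖ ^ 2 + ‖g₂ 0‖ ^ 2) + C ^ 2 * R ^ 2 := by
  have hR' : 0 < R' := hR.trans hRR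
  set T := Real.log R' with hT
  have hmem : ∀ z : ℂ, z.re < T → exp z ∈ Metric.ball (0 : ℂ) R' := fun z hz => by
    rw [mem_ball_zero_iff, Complex.norm_exp]
    exact (Real.lt_log_iff_exp_lt hR').1 hz
  set b₁ := fun z => g₁ (exp z) with hb₁
  set b₂ := fun z => g₂ (exp z) with hb₂
  have a₁ : AnalyticOnNhd ℂ b₁ {z | z.re < T} := fun z hz =>
    (h₁ _ (hmem z hz)).comp analyticAt_cexp
  have a₂ : AnalyticOnNhd ℂ b₂ {z | z.re < T} := fun z hz =>
    (h₂ _ (hmem z hz)).comp analyticAt_cexp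
  have b0 : ∀ z : ℂ, z.re < T → b₁ z ≠ 0 ∨ b₂ z ≠ 0 := fun z hz => h0 _ (hmem z hz)
  have hper : ∀ g : ℂ → ℂ, ∀ z, (fun z => g (exp z)) (z + 2 * Real.pi * I) = g (exp z) := by
    intro g z
    simp only [Complex.exp_add, Complex.exp_two_pi_mul_I, mul_one]
  have hre : ∀ s θ : ℝ, ((s : ℂ) + θ * I).re = s := fun s θ => by simp
  set P : ℝ → ℂ := fun t => ∫ θ in (0 : ℝ)..2 * Real.pi, sphDlog b₁ b₂ ((t : ℂ) + θ * I) with hP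
  set A : ℝ → ℝ := fun t => ∫ θ in (0 : ℝ)..2 * Real.pi,
    Real.log (‖b₁ ((t : ℂ) + θ * I)‖ ^ 2 + ‖b₂ ((t : ℂ) + θ * I)‖ ^ 2) with hA
  set W : ℝ → ℝ := fun t => ∫ θ in (0 : ℝ)..2 * Real.pi, 2 * ‖deriv b₁ (t + θ * I) *
    b₂ (t + θ * I) - b₁ (t + θ * I) * deriv b₂ (t + θ * I)‖ ^ 2 /
    (‖b₁ (t + θ * I)‖ ^ 2 + ‖b₂ (t + θ * I)‖ ^ 2) ^ 2 with hW
  have hPd : ∀ t < T, HasDerivAt P (W t : ℂ) t := fun t ht =>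
    hasDerivAt_integral_sphDlog a₁ a₂ b0 (hper g₁) (hper g₂) ht
  have hAd : ∀ t < T, HasDerivAt A (2 * (P t).re) t := fun t ht =>
    hasDerivAt_integral_log_norm_sq a₁ a₂ b0 ht
  have hexp : ∀ t : ℝ, HasDerivAt (fun t => 2 * Real.pi * C ^ 2 * Real.exp (2 * t))
      (4 * Real.pi * C ^ 2 * Real.exp (2 * t)) t := fun t => by
    have : HasDerivAt (fun t : ℝ => 2 * t) 2 t := by simpa using (hasDerivAt_id t).const_mul 2
    refine (this.exp.const_mul (2 * Real.pi * C ^ 2)).congr_deriv ?_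
    ring
  have hexp0 : Tendsto (fun t => 2 * Real.pi * C ^ 2 * Real.exp (2 * t)) atBot (𝓝 0) := by
    have : Tendsto (fun t : ℝ => Real.exp (2 * t)) atBot (𝓝 0) :=
      Real.tendsto_exp_atBot.comp (tendsto_id.const_mul_atBot (by norm_num))
    simpa using this.const_mul (2 * Real.pi * C ^ 2)
  have hWle : ∀ t < T, W t ≤ 4 * Real.pi * C ^ 2 * Real.exp (2 * t) := by
    intro t ht
    have hpt : ∀ θ : ℝ, ‖2 * ‖deriv b₁ (t + θ * I) *
        b₂ (t + θ * I) - b₁ (t + θ * I) * deriv b₂ (t + θ * I)‖ ^ 2 /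
        (‖b₁ (t + θ * I)‖ ^ 2 + ‖b₂ (t + θ * I)‖ ^ 2) ^ 2‖ ≤ 2 * C ^ 2 * Real.exp (2 * t) := by
      intro θ
      have hz := hmem ((t : ℂ) + θ * I) (by rw [hre]; exact ht)
      have hd : ∀ g : ℂ → ℂ, AnalyticOnNhd ℂ g (Metric.ball 0 R') →
          deriv (fun z => g (exp z)) (t + θ * I) =
            deriv g (exp (t + θ * I)) * exp (t + θ * I) := fun g hg =>
        ((hg _ hz).differentiableAt.hasDerivAt.comp _ (Complex.hasDerivAt_exp _)).deriv
      rw [Real.norm_of_nonneg (by positivity)]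
      simp only [hb₁, hb₂, hd g₁ h₁, hd g₂ h₂]
      have hpos := norm_sq_add_norm_sq_pos (h0 _ hz)
      rw [div_le_iff₀ (by positivity)]
      set w := exp ((t : ℂ) + θ * I) with hw
      have hwn : ‖w‖ = Real.exp t := by rw [hw, Complex.norm_exp, hre]
      have e1 : deriv g₁ w * w * g₂ w - g₁ w * (deriv g₂ w * w) =
          (deriv g₁ w * g₂ w - g₁ w * deriv g₂ w) * w := by ring
      rw [e1, norm_mul, hwn, mul_pow, ← Real.exp_nat_mul, Nat.cast_ofNat]
      have h3 := pow_le_pow_left₀ (norm_nonneg _) (hC w hz) 2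
      have h4 := mul_le_mul_of_nonneg_right h3 (Real.exp_pos (2 * t)).le
      nlinarith
    have h5 := intervalIntegral.norm_integral_le_of_norm_le_const (a := 0) (b := 2 * Real.pi)
      fun θ _ => hpt θ
    refine (le_abs_self _).trans (h5.trans (le_of_eq ?_))
    rw [sub_zero, abs_of_pos Real.two_pi_pos]
    ring
  have hPre : ∀ t < T, HasDerivAt (fun t => (P t).re - 2 * Real.pi * C ^ 2 * Real.exp (2 * t))
      (W t - 4 * Real.pi * C ^ 2 * Real.exp (2 * t)) t := by
    intro t ht
    have h3 : HasDerivAt (fun t => (P t).re) (W t) t := by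
      have := (Complex.reCLM.hasFDerivAt (x := P t)).comp_hasDerivAt t (hPd t ht)
      simpa [Function.comp_def] using this
    exact h3.sub (hexp t)
  have hP0 : Tendsto P atBot (𝓝 0) := by
    have hc : ContinuousAt (sphDlog g₁ g₂) 0 :=
      (continuousOn_sphDlog h₁ h₂ h0).continuousAt (Metric.ball_mem_nhds _ hR')
    obtain ⟨r, hr, hr'⟩ := Metric.eventually_nhds_iff_ball.1
      (hc.norm.eventually (gt_mem_nhds (lt_add_one _)))
    set M := ‖sphDlog g₁ g₂ 0‖ + 1
    refine squeeze_zero_norm' (a := fun t => Real.exp t * M * (2 * Real.pi)) ?_ ?_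
    · filter_upwards [Iio_mem_atBot (Real.log r), Iio_mem_atBot T] with t ht ht2
      have : ∀ θ : ℝ, ‖sphDlog b₁ b₂ ((t : ℂ) + θ * I)‖ ≤ Real.exp t * M := by
        intro θ
        have hz := hmem ((t : ℂ) + θ * I) (by rw [hre]; exact ht2)
        rw [hb₁, hb₂, sphDlog_comp_exp (h₁ _ hz).differentiableAt (h₂ _ hz).differentiableAt,
          norm_mul, Complex.norm_exp, hre]
        gcongr
        refine (hr' _ ?_).le
        rw [mem_ball_zero_iff, Complex.norm_exp, hre]
        exact (Real.lt_log_iff_exp_lt hr).1 ht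
      have h5 := intervalIntegral.norm_integral_le_of_norm_le_const (a := 0) (b := 2 * Real.pi)
        fun θ _ => this θ
      rwa [sub_zero, abs_of_pos Real.two_pi_pos] at h5
    · have := (Real.tendsto_exp_atBot.mul_const M).mul_const (2 * Real.pi)
      simpa using this
  have hPle : ∀ t < T, (P t).re - 2 * Real.pi * C ^ 2 * Real.exp (2 * t) ≤ 0 := fun t ht => by
    refine le_of_hasDerivAt_nonpos_of_tendsto hPre (fun t ht => sub_nonpos.2 (hWle t ht)) ?_ ht
    have h3 : Tendsto (fun t => (P t).re) atBot (𝓝 0) := by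
      simpa [Function.comp_def] using (Complex.continuous_re.tendsto 0).comp hP0
    simpa using h3.sub hexp0
  have hAd' : ∀ t < T, HasDerivAt (fun t => A t - 2 * Real.pi * C ^ 2 * Real.exp (2 * t))
      (2 * (P t).re - 4 * Real.pi * C ^ 2 * Real.exp (2 * t)) t := fun t ht =>
    (hAd t ht).sub (hexp t)
  have hAc : ∀ t, A t = 2 * Real.pi *
      Real.circleAverage (fun z => Real.log (‖g₁ z‖ ^ 2 + ‖g₂ z‖ ^ 2)) 0 (Real.exp t) := by
    intro t
    rw [Real.circleAverage_def, smul_eq_mul, ← mul_assoc, mul_inv_cancel₀ Real.two_pi_pos.ne',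
      one_mul]
    refine intervalIntegral.integral_congr fun θ _ => ?_
    simp only [hb₁, hb₂, circleMap, zero_add, Complex.exp_add, Complex.ofReal_exp]
  have hA0 : Tendsto A atBot (𝓝 (2 * Real.pi * Real.log (‖g₁ 0‖ ^ 2 + ‖g₂ 0‖ ^ 2))) := by
    have hc := Real.ContinuousOn.circleAverage (c := (0 : ℂ)) (s := Ico 0 R')
      (f := fun z => Real.log (‖g₁ z‖ ^ 2 + ‖g₂ z‖ ^ 2))
      ((continuousOn_log_norm_sq h₁ h₂ h0).mono fun z hz => by
        simpa using hz.2) (fun r hr => hr.1)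
    have h3 := hc 0 ⟨le_rfl, hR'⟩
    have h4 : Tendsto Real.exp atBot (𝓝[Ico 0 R'] 0) := by
      refine tendsto_nhdsWithin_iff.2 ⟨Real.tendsto_exp_atBot, ?_⟩
      filter_upwards [Iio_mem_atBot T] with t ht
      exact ⟨(Real.exp_pos t).le, (Real.lt_log_iff_exp_lt hR').1 ht⟩
    have h5 := (h3.tendsto.comp h4).const_mul (2 * Real.pi)
    rw [Real.circleAverage_zero] at h5
    exact h5.congr fun t => (hAc t).symm
  have hlog : Real.log R < T := Real.log_lt_log hR hRR
  have hfin := le_of_hasDerivAt_nonpos_of_tendsto hAd' (fun t ht => by linarith [hPle t ht])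
    (hA0.sub hexp0) hlog
  rw [hAc, Real.exp_log hR, two_mul (Real.log R), Real.exp_add, Real.exp_log hR, sub_zero] at hfin
  have hpi := Real.two_pi_pos
  nlinarith

/-- The factor `R` in `(vᵉ)⁽ᵐ⁾ = vᵉ⁻ᵐ R`. -/
def powR (e : ℤ) (v : ℂ → ℂ) : ℕ → ℂ → ℂ
  | 0 => fun _ => 1
  | m + 1 => fun z => ((e : ℂ) - m) * deriv v z * powR e v m z + v z * deriv (powR e v m) z

theorem analyticAt_powR {e : ℤ} {v : ℂ → ℂ} {z : ℂ} (h : AnalyticAt ℂ v z) (m : ℕ) :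
    AnalyticAt ℂ (powR e v m) z := by
  induction m with
  | zero => exact analyticAt_const
  | succ m ih =>
    exact ((analyticAt_const.mul h.deriv).mul ih).add (h.mul ih.deriv)

theorem iteratedDeriv_pow_eq_powR {n : ℕ} {v : ℂ → ℂ} {z : ℂ} (h : AnalyticAt ℂ v z) {m : ℕ}
    (hm : m ≤ n) : iteratedDeriv m (v ^ n) z = v z ^ (n - m) * powR n v m z := by
  induction m generalizing z with
  | zero => simp [powR]
  | succ m ih =>
    have h1 : iteratedDeriv m (v ^ n) =ᶠ[𝓝 z] fun w => v w ^ (n - m) * powR n v m w := by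
      filter_upwards [h.eventually_analyticAt] with w hw
      exact ih hw (by omega)
    rw [iteratedDeriv_succ, h1.deriv_eq]
    have h2 := (h.differentiableAt.hasDerivAt.pow (n - m)).mul
      (analyticAt_powR (e := n) h m).differentiableAt.hasDerivAt
    rw [show (fun w => v w ^ (n - m) * powR n v m w) = v ^ (n - m) * powR n v m from rfl, h2.deriv]
    obtain ⟨d, rfl⟩ : ∃ d, n = m + 1 + d := ⟨n - (m + 1), by omega⟩
    have e1 : m + 1 + d - m = d + 1 := by omega
    have e2 : m + 1 + d - (m + 1) = d := by omega
    simp only [e1, e2, powR, Nat.add_sub_cancel, Pi.pow_apply]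
    push_cast
    ring

theorem iteratedDeriv_zpow_eq_powR {e : ℤ} {v : ℂ → ℂ} {z : ℂ} (h : AnalyticAt ℂ v z) (h0 : v z ≠ 0)
    (m : ℕ) : iteratedDeriv m (fun w => v w ^ e) z = v z ^ (e - m) * powR e v m z := by
  induction m generalizing z with
  | zero => simp [powR]
  | succ m ih =>
    have h1 : iteratedDeriv m (fun w => v w ^ e) =ᶠ[𝓝 z] fun w => v w ^ (e - m) * powR e v m w := by
      filter_upwards [h.eventually_analyticAt, h.continuousAt.eventually_ne h0] with w hw hw0
      exact ih hw hw0
    rw [iteratedDeriv_succ, h1.deriv_eq]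
    have h2 := ((hasDerivAt_zpow (e - m) (v z) (Or.inl h0)).comp z h.differentiableAt.hasDerivAt).mul
      (analyticAt_powR (e := e) h m).differentiableAt.hasDerivAt
    rw [show (fun w => v w ^ (e - m) * powR e v m w) =
      ((fun x => x ^ (e - (m : ℤ))) ∘ v) * powR e v m from rfl, h2.deriv]
    have e1 : e - (m : ℤ) = (e - ((m + 1 : ℕ) : ℤ)) + 1 := by push_cast; ring
    simp only [powR, Function.comp_apply]
    rw [show e - (m : ℤ) - 1 = e - ((m + 1 : ℕ) : ℤ) by push_cast; ring, e1, zpow_add_one₀ h0]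
    push_cast
    ring

theorem norm_deriv_le_of_ball {f : ℂ → ℂ} {z : ℂ} {r M : ℝ} (hr : 0 < r)
    (hf : ∀ w ∈ Metric.ball z r, AnalyticAt ℂ f w) (hM : ∀ w ∈ Metric.ball z r, ‖f w‖ ≤ M) :
    ‖deriv f z‖ ≤ M / (r / 2) := by
  have hsub : Metric.closedBall z (r / 2) ⊆ Metric.ball z r :=
    Metric.closedBall_subset_ball (by linarith)
  refine Complex.norm_deriv_le_of_forall_mem_sphere_norm_le (by positivity) ?_ fun w hw =>
    hM w (hsub (Metric.sphere_subset_closedBall hw))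
  refine DifferentiableOn.diffContOnCl fun w hw => ?_
  rw [closure_ball _ (by positivity)] at hw
  exact (hf w (hsub hw)).differentiableAt.differentiableWithinAt

theorem exists_norm_powR_le (e : ℤ) (m : ℕ) {r M : ℝ} (hr : 0 < r) (hM : 0 ≤ M) :
    ∃ K ≥ 0, ∀ (v : ℂ → ℂ) (z : ℂ), (∀ w ∈ Metric.ball z r, AnalyticAt ℂ v w ∧ ‖v w‖ ≤ M) →
      ‖powR e v m z‖ ≤ K := by
  induction m generalizing r with
  | zero => exact ⟨1, zero_le_one, fun v z _ => by simp [powR]⟩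
  | succ m ih =>
    obtain ⟨K, hK, h⟩ := ih (half_pos hr)
    refine ⟨‖(e : ℂ) - m‖ * (M / (r / 2)) * K + M * (K / (r / 2 / 2)), by positivity,
      fun v z hv => ?_⟩
    have h1 : ∀ w ∈ Metric.ball z (r / 2), ‖powR e v m w‖ ≤ K := fun w hw => by
      refine h v w fun x hx => hv x ?_
      have := dist_triangle x w z
      rw [Metric.mem_ball] at *
      linarith
    have hz : z ∈ Metric.ball z r := Metric.mem_ball_self hr
    have h2 := norm_deriv_le_of_ball (f := powR e v m) (half_pos hr) (fun w hw =>
      analyticAt_powR (hv w (Metric.ball_subset_ball (by linarith) hw)).1 m) h1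
    have h3 := norm_deriv_le_of_ball hr (fun w hw => (hv w hw).1) (fun w hw => (hv w hw).2)
    have h4 := (hv z hz).2
    have h5 := h1 z (Metric.mem_ball_self (half_pos hr))
    simp only [powR]
    refine (norm_add_le _ _).trans ?_
    rw [norm_mul, norm_mul, norm_mul]
    gcongr

theorem SphDerivLE.analyticAt_inv_of_one_lt {g : ℂ → ℂ} {C : ℝ} {z : ℂ} (h : SphDerivLE g C z)
    (h1 : 1 < ‖g z‖) : AnalyticAt ℂ g⁻¹ z ∧ ‖g⁻¹ z‖ ≤ 1 :=
  _root_.analyticAt_inv_of_one_lt h.analyticAt_or fun h' => absurd h'.2 (not_le.2 h1)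

theorem exists_radius {C : ℝ} (hC : 0 ≤ C) : ∃ r > 0, 10 * C * r ≤ 1 := by
  refine ⟨1 / (10 * (C + 1)), by positivity, ?_⟩
  rw [mul_one_div, div_le_one (by positivity)]
  linarith

theorem SphDerivLE.nonneg {g : ℂ → ℂ} {C : ℝ} {z : ℂ} (h : SphDerivLE g C z) : 0 ≤ C := by
  have : ∀ a x : ℝ, 0 ≤ a → a ≤ C * (1 + x ^ 2) → 0 ≤ C := fun a x ha hx => by
    by_contra hc
    push Not at hc
    nlinarith [sq_nonneg x]
  rcases h with h | h
  · exact this _ _ (norm_nonneg _) h.2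
  · exact this _ _ (norm_nonneg _) h.2

theorem IsLimitFun.exists_norm_powR_le {n k : ℕ} {C : ℝ} {g : ℂ → ℂ} (h : IsLimitFun n k C g)
    (e : ℤ) (m : ℕ) : ∃ K ≥ 0, ∀ z, AnalyticAt ℂ g z → ‖g z‖ ≤ 1 → ‖powR e g m z‖ ≤ K := by
  have hC := (h.sph 0).nonneg
  obtain ⟨r, hr, hr1⟩ := exists_radius hC
  obtain ⟨K, hK, hK'⟩ := _root_.exists_norm_powR_le e m hr (zero_le_two)
  exact ⟨K, hK, fun z hz hz1 => hK' g z (analyticAt_and_norm_le_two hC hr1 (fun w _ => h.sph w)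
    hz hz1)⟩

theorem IsLimitFun.exists_norm_powR_inv_le {n k : ℕ} {C : ℝ} {g : ℂ → ℂ} (h : IsLimitFun n k C g)
    (e : ℤ) (m : ℕ) : ∃ K ≥ 0, ∀ z, 1 < ‖g z‖ → ‖powR e g⁻¹ m z‖ ≤ K := by
  have hC := (h.sph 0).nonneg
  obtain ⟨r, hr, hr1⟩ := exists_radius hC
  obtain ⟨K, hK, hK'⟩ := _root_.exists_norm_powR_le e m hr (zero_le_two)
  refine ⟨K, hK, fun z hz1 => ?_⟩
  obtain ⟨h1, h2⟩ := (h.sph z).analyticAt_inv_of_one_lt hz1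
  exact hK' g⁻¹ z (analyticAt_and_norm_le_two hC hr1 (fun w _ => (h.sph w).inv) h1 h2)

/-- The growth of `(gⁿ)⁽ᵏ⁾` in terms of `g`. -/
theorem IsLimitFun.exists_norm_iteratedDeriv_sub_one_le {n k : ℕ} (hkn : k ≤ n) {C : ℝ} {g : ℂ → ℂ}
    (h : IsLimitFun n k C g) : ∃ K > 0, ∀ z, AnalyticAt ℂ g z →
      ‖iteratedDeriv k (g ^ n) z - 1‖ ^ 2 ≤ K * (1 + ‖g z‖ ^ 2) ^ (n + k) := by
  obtain ⟨K₁, hK₁, h₁⟩ := h.exists_norm_powR_le n k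
  obtain ⟨K₂, hK₂, h₂⟩ := h.exists_norm_powR_inv_le (-n) k
  refine ⟨(K₁ + K₂ + 1) ^ 2, by positivity, fun z hz => ?_⟩
  have hX : 1 ≤ (1 + ‖g z‖ ^ 2) ^ (n + k) := one_le_pow₀ (by nlinarith [sq_nonneg ‖g z‖])
  rcases le_or_gt ‖g z‖ 1 with h1 | h1
  · have h3 := h₁ z hz h1
    have h4 : ‖iteratedDeriv k (g ^ n) z - 1‖ ≤ K₁ + K₂ + 1 := by
      refine (norm_sub_le _ _).trans ?_
      rw [iteratedDeriv_pow_eq_powR hz hkn, norm_mul, norm_pow, norm_one]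
      have : ‖g z‖ ^ (n - k) ≤ 1 := pow_le_one₀ (norm_nonneg _) h1
      nlinarith [norm_nonneg (powR n g k z)]
    calc _ ≤ (K₁ + K₂ + 1) ^ 2 := by gcongr
      _ ≤ _ := le_mul_of_one_le_right (by positivity) hX
  · obtain ⟨h3, h3'⟩ := (h.sph z).analyticAt_inv_of_one_lt h1
    have h4 : g ^ n = fun w => (g⁻¹ w) ^ (-n : ℤ) := by
      ext w; simp
    have hg0 : g z ≠ 0 := fun h0 => by rw [h0, norm_zero] at h1; linarith
    have h5 : ‖iteratedDeriv k (g ^ n) z‖ ≤ ‖g z‖ ^ (n + k) * K₂ := by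
      rw [h4, iteratedDeriv_zpow_eq_powR h3 (by simpa using hg0), norm_mul, norm_zpow]
      have : ‖g⁻¹ z‖ ^ (-(n : ℤ) - k) = ‖g z‖ ^ (n + k) := by
        rw [Pi.inv_apply, norm_inv, inv_zpow', ← zpow_natCast]
        congr 1; push_cast; ring
      rw [this]
      gcongr
      exact h₂ z h1
    have h6 : 1 ≤ ‖g z‖ ^ (n + k) := one_le_pow₀ h1.le
    have h7 : ‖iteratedDeriv k (g ^ n) z - 1‖ ≤ (K₁ + K₂ + 1) * ‖g z‖ ^ (n + k) := by
      refine (norm_sub_le _ _).trans ?_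
      rw [norm_one]
      nlinarith
    calc _ ≤ ((K₁ + K₂ + 1) * ‖g z‖ ^ (n + k)) ^ 2 := by gcongr
      _ = (K₁ + K₂ + 1) ^ 2 * (‖g z‖ ^ 2) ^ (n + k) := by ring
      _ ≤ _ := by gcongr; linarith

theorem SphDerivLE.comp_const_add {g : ℂ → ℂ} {C : ℝ} {p q : ℂ} (h : SphDerivLE g C (p + q)) :
    SphDerivLE (fun ζ => g (p + ζ)) C q := by
  have := SphDerivLE.comp_affine (g := g) (C := C) (a := 1) (b := 1) (p := p) (q := q) one_pos
    zero_le_one h.nonneg (by simpa using h)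
  simpa using this

theorem iteratedDeriv_pow_comp_const_add (k n : ℕ) (g : ℂ → ℂ) (p q : ℂ) :
    iteratedDeriv k ((fun ζ => g (p + ζ)) ^ n) q = iteratedDeriv k (g ^ n) (p + q) := by
  simpa using iteratedDeriv_pow_comp_affine k n g 1 p 1 q

theorem analyticAt_comp_const_add_iff {g : ℂ → ℂ} {p q : ℂ} :
    AnalyticAt ℂ (fun ζ => g (p + ζ)) q ↔ AnalyticAt ℂ g (p + q) := by
  constructor
  · intro h
    have h1 : AnalyticAt ℂ (fun w => (fun ζ => g (p + ζ)) (w - p)) (p + q) :=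
      AnalyticAt.fun_comp (g := fun ζ => g (p + ζ)) (f := fun w => w - p) (by simpa using h)
        (by fun_prop)
    simpa using h1
  · intro h
    exact AnalyticAt.fun_comp (g := g) (f := fun w => p + w) h (by fun_prop)

theorem IsLimitFun.comp_const_add {n k : ℕ} {C : ℝ} {g : ℂ → ℂ} (h : IsLimitFun n k C g) (p : ℂ) :
    IsLimitFun n k C (fun ζ => g (p + ζ)) := by
  refine ⟨fun z => (h.sph _).comp_const_add, fun z hz => ?_⟩
  rw [iteratedDeriv_pow_comp_const_add]
  exact h.ne_one _ (analyticAt_comp_const_add_iff.1 hz)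

theorem IsLimitFun.exists_le_norm_sub_one {n k : ℕ} (hk : 1 ≤ k) (hkn : k < n) {C : ℝ} {g : ℂ → ℂ}
    (h : IsLimitFun n k C g) : ∃ δ > 0, ∀ z, AnalyticAt ℂ g z → ‖g z‖ ≤ 1 →
      δ ≤ ‖iteratedDeriv k (g ^ n) z - 1‖ := by
  by_contra! hcon
  have hC := (h.sph 0).nonneg
  choose z hz1 hz2 hz3 using fun j : ℕ => hcon (1 / ((j : ℝ) + 1)) (by positivity)
  set f : ℕ → ℂ → ℂ := fun j ζ => g (z j + ζ) with hf
  have hlim : ∀ j, IsLimitFun n k C (f j) := fun j => h.comp_const_add (z j)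
  set l : Ultrafilter ℕ := hyperfilter ℕ
  have hl : (l : Filter ℕ) ≤ atTop := by
    rw [← Nat.cofinite_eq_atTop]; exact hyperfilter_le_cofinite
  have hf0 : ∀ j, AnalyticAt ℂ (f j) 0 := fun j =>
    analyticAt_comp_const_add_iff.2 (by simpa using hz1 j)
  obtain ⟨r, hr, hr1⟩ := exists_radius hC
  have hball : ∀ j, ∀ w ∈ Metric.ball 0 r, AnalyticAt ℂ (f j) w ∧ ‖f j w‖ ≤ 2 := fun j =>
    analyticAt_and_norm_le_two hC hr1 (fun w _ => (hlim j).sph w) (hf0 j)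
      (by simpa [hf] using hz2 j)
  have hconv0 : ConvNear l f (filterLim l f) 0 := by
    refine ⟨r, hr, Eventually.of_forall fun j w hw => (hball j w hw).1, ?_⟩
    refine (tendstoUniformlyOn_filterLim (M := C * (1 + 2 ^ 2)) (by positivity)
      (Eventually.of_forall fun j w hw => ⟨(hball j w hw).1, (hball j w hw).2, ?_⟩)).2
    refine (((hlim j).sph w).norm_deriv_le (hball j w hw).1).trans ?_
    have := (hball j w hw).2
    gcongr
  have hconv : ∀ w, ConvSphNear l f (filterLim l f) w := by
    rcases inftyNear_or_convNear (l := l) (g := f) isOpen_univ isPreconnected_univ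
      (fun w _ => ⟨1, one_pos, C, hC, Eventually.of_forall fun j x _ => (hlim j).sph x⟩) with h1 | h1
    · exact absurd hconv0 (h1 0 (mem_univ 0)).not_convNear
    · exact fun w => h1 w (mem_univ w)
  have hL : IsLimitFun n k C (filterLim l f) := isLimitFun_of_convSphNear hk hkn hconv
    (fun w => Eventually.of_forall fun j => (hlim j).sph w)
    (fun w => ⟨1, one_pos, Eventually.of_forall fun j x _ => (hlim j).ne_one x⟩)
  refine hL.ne_one 0 hconv0.analyticAt ?_
  have ht := ((hconv0.pow n).iteratedDeriv k).tendsto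
  refine tendsto_nhds_unique ht ?_
  rw [tendsto_iff_norm_sub_tendsto_zero]
  have hz : Tendsto (fun j : ℕ => 1 / ((j : ℝ) + 1)) l (𝓝 0) :=
    tendsto_one_div_add_atTop_nhds_zero_nat.mono_left hl
  refine squeeze_zero (fun _ => norm_nonneg _) (fun j => ?_) hz
  rw [hf, iteratedDeriv_pow_comp_const_add, add_zero]
  exact (hz3 j).le

/-- The pointwise normal form of a function, filling in removable singularities. -/
def nfExt (f : ℂ → ℂ) (z : ℂ) : ℂ := toMeromorphicNFAt f z z

theorem nfExt_eq {f : ℂ → ℂ} {z : ℂ} (h : AnalyticAt ℂ f z) : nfExt f z = f z :=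
  congrFun (toMeromorphicNFAt_eq_self.2 h.meromorphicNFAt) z

theorem nfExt_eventuallyEq_nhdsNE {f : ℂ → ℂ} {z : ℂ} (h : MeromorphicAt f z) :
    nfExt f =ᶠ[𝓝[≠] z] f := by
  filter_upwards [h.eventually_analyticAt] with w hw
  exact nfExt_eq hw

theorem analyticAt_nfExt {f : ℂ → ℂ} {z : ℂ} (h : MeromorphicAt f z)
    (h0 : 0 ≤ meromorphicOrderAt f z) : AnalyticAt ℂ (nfExt f) z := by
  have h1 := h.meromorphicOrderAt_nonneg_iff_analyticAt_toMeromorphicNFAt.1 h0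
  refine h1.congr ?_
  have h2 : toMeromorphicNFAt f z =ᶠ[𝓝[≠] z] nfExt f :=
    h.eq_nhdsNE_toMeromorphicNFAt.symm.trans (nfExt_eventuallyEq_nhdsNE h).symm
  exact eventually_nhdsWithin_iff.1 h2 |>.mono fun w hw => by
    by_cases hwz : w = z
    · subst hwz; rfl
    · exact hw hwz

theorem meromorphicOrderAt_nfExt {f : ℂ → ℂ} {z : ℂ} (h : MeromorphicAt f z) :
    meromorphicOrderAt (nfExt f) z = meromorphicOrderAt f z :=
  meromorphicOrderAt_congr (nfExt_eventuallyEq_nhdsNE h)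

theorem ne_zero_of_meromorphicOrderAt_eq_zero {f : ℂ → ℂ} {z : ℂ} (h : AnalyticAt ℂ f z)
    (h0 : meromorphicOrderAt f z = 0) : f z ≠ 0 :=
  h.meromorphicNFAt.meromorphicOrderAt_eq_zero_iff.1 h0

theorem eventually_analyticAt_of_or {g : ℂ → ℂ} {z : ℂ}
    (h : AnalyticAt ℂ g z ∨ AnalyticAt ℂ g⁻¹ z) : ∀ᶠ w in 𝓝[≠] z, AnalyticAt ℂ g w :=
  (meromorphicAt_of_analyticAt_or h).eventually_analyticAt

/-- The entire functions `E = 1 / ((gⁿ)⁽ᵏ⁾ - 1)` and `H = -E' / (E g)` attached to `g`. -/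
structure IsAux (n k : ℕ) (g E H : ℂ → ℂ) (K : ℝ) : Prop where
  diffE : Differentiable ℂ E
  diffH : Differentiable ℂ H
  mul_eq : ∀ z, AnalyticAt ℂ g z → E z * (iteratedDeriv k (g ^ n) z - 1) = 1
  eq_zero : ∀ z, ¬ AnalyticAt ℂ g z → E z = 0
  pole : ∀ z, ¬ AnalyticAt ℂ g z → ∃ m : ℕ, 1 ≤ m ∧
    meromorphicOrderAt g z = ((-(m : ℤ) : ℤ) : WithTop ℤ) ∧
    meromorphicOrderAt E z = (((n * m + k : ℕ) : ℤ) : WithTop ℤ) ∧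
    meromorphicOrderAt H z = (((m : ℤ) - 1 : ℤ) : WithTop ℤ)
  deriv_eq : ∀ z, AnalyticAt ℂ g z → deriv E z = -H z * g z * E z
  pos : 0 < K
  norm_E_le : ∀ z, AnalyticAt ℂ g z → ‖g z‖ ≤ 1 → ‖E z‖ ≤ K
  norm_H_le : ∀ z, AnalyticAt ℂ g z → ‖g z‖ ≤ 1 → ‖H z‖ ≤ K
  one_le : ∀ z, AnalyticAt ℂ g z → 1 ≤ K * ‖E z‖ ^ 2 * (1 + ‖g z‖ ^ 2) ^ (n + k)

theorem IsAux.ne_zero {n k : ℕ} {g E H : ℂ → ℂ} {K : ℝ} (h : IsAux n k g E H K) {z : ℂ}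
    (hz : AnalyticAt ℂ g z) : E z ≠ 0 := fun h0 => by
  have := h.mul_eq z hz
  rw [h0, zero_mul] at this
  exact zero_ne_one this

theorem IsAux.ne_zero_iff {n k : ℕ} {g E H : ℂ → ℂ} {K : ℝ} (h : IsAux n k g E H K) {z : ℂ} :
    E z ≠ 0 ↔ AnalyticAt ℂ g z :=
  ⟨fun h0 => by_contra fun hz => h0 (h.eq_zero z hz), h.ne_zero⟩

theorem IsLimitFun.exists_isAux {n k : ℕ} (hk : 1 ≤ k) (hkn : k + 2 ≤ n) {C : ℝ} {g : ℂ → ℂ}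
    (h : IsLimitFun n k C g) : ∃ E H : ℂ → ℂ, ∃ K : ℝ, IsAux n k g E H K := by
  obtain ⟨δ, hδ, hδ'⟩ := h.exists_le_norm_sub_one hk (by omega)
  obtain ⟨K₁, hK₁, hK₁'⟩ := h.exists_norm_powR_le n (k + 1)
  obtain ⟨K₂, hK₂, hK₂'⟩ := h.exists_norm_iteratedDeriv_sub_one_le (by omega)
  set G : ℂ → ℂ := fun z => iteratedDeriv k (g ^ n) z - 1 with hG
  set E : ℂ → ℂ := fun z => if AnalyticAt ℂ g z then (G z)⁻¹ else 0 with hE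
  have hor := fun z => (h.sph z).analyticAt_or
  have hGan : ∀ z, AnalyticAt ℂ g z → AnalyticAt ℂ G z := fun z hz =>
    ((hz.pow n).iteratedDeriv' k).sub analyticAt_const
  have hG0 : ∀ z, AnalyticAt ℂ g z → G z ≠ 0 := fun z hz => sub_ne_zero.2 (h.ne_one z hz)
  have hEG : ∀ z, AnalyticAt ℂ g z → E =ᶠ[𝓝 z] G⁻¹ := fun z hz => by
    filter_upwards [hz.eventually_analyticAt] with w hw
    simp [hE, hw]
  have hEG' : ∀ z, E =ᶠ[𝓝[≠] z] G⁻¹ := fun z => by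
    filter_upwards [eventually_analyticAt_of_or (hor z)] with w hw
    simp [hE, hw]
  have hgp : ∀ z, ¬ AnalyticAt ℂ g z → AnalyticAt ℂ g⁻¹ z := fun z hz => (hor z).resolve_left hz
  have hpole : ∀ z, ¬ AnalyticAt ℂ g z → ∃ m : ℕ, 1 ≤ m ∧
      meromorphicOrderAt g z = ((-(m : ℤ) : ℤ) : WithTop ℤ) ∧
      meromorphicOrderAt E z = (((n * m + k : ℕ) : ℤ) : WithTop ℤ) := fun z hz => by
    obtain ⟨m, hm, h1, -⟩ := exists_pole_order hz (hgp z hz)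
    refine ⟨m, hm, h1, ?_⟩
    rw [meromorphicOrderAt_congr (hEG' z), meromorphicOrderAt_inv,
      meromorphicOrderAt_iteratedDeriv_pow_sub_one hm (by omega) h1]
    rw [← WithTop.LinearOrderedAddCommGroup.coe_neg]
    simp
  have hEan : ∀ z, AnalyticAt ℂ E z := fun z => by
    by_cases hz : AnalyticAt ℂ g z
    · exact ((hGan z hz).inv (hG0 z hz)).congr (hEG z hz).symm
    · obtain ⟨m, hm, h1, h2⟩ := hpole z hz
      have hmer : MeromorphicAt E z := meromorphicAt_of_meromorphicOrderAt_ne_zero (by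
        rw [h2]; norm_cast; omega)
      refine hmer.analyticAt ?_
      rw [continuousAt_iff_punctured_nhds]
      have : E z = 0 := by simp [hE, hz]
      rw [this, tendsto_zero_iff_meromorphicOrderAt_pos hmer, h2]
      norm_cast
      omega
  have hEn : ∀ z, AnalyticAt ℂ g z → E z = (G z)⁻¹ := fun z hz => by simp [hE, hz]
  have hE0 : ∀ z, AnalyticAt ℂ g z → E z ≠ 0 := fun z hz => by
    rw [hEn z hz]; exact inv_ne_zero (hG0 z hz)
  set f : ℂ → ℂ := fun z => g z ^ (n - k - 2) * powR n g (k + 1) z * E z with hf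
  have hfan : ∀ z, AnalyticAt ℂ g z → AnalyticAt ℂ f z := fun z hz =>
    ((hz.pow _).mul (analyticAt_powR hz _)).mul (hEan z)
  have hderiv : ∀ z, AnalyticAt ℂ g z → deriv E z = -f z * g z * E z := fun z hz => by
    rw [(hEG z hz).deriv_eq]
    have h1 : deriv G z = g z ^ (n - (k + 1)) * powR n g (k + 1) z := by
      rw [← iteratedDeriv_pow_eq_powR hz (by omega), iteratedDeriv_succ]
      simp [hG]
    have h2 : deriv G⁻¹ z = -deriv G z / G z ^ 2 := by
      simpa using ((hGan z hz).differentiableAt.hasDerivAt.inv (hG0 z hz)).deriv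
    rw [h2, h1, hf]
    simp only
    rw [hEn z hz, show n - (k + 1) = n - k - 2 + 1 by omega, pow_succ]
    field_simp [hG0 z hz]
  have hford : ∀ z, ¬ AnalyticAt ℂ g z → MeromorphicAt f z ∧ ∃ m : ℕ, 1 ≤ m ∧
      meromorphicOrderAt g z = ((-(m : ℤ) : ℤ) : WithTop ℤ) ∧
      meromorphicOrderAt E z = (((n * m + k : ℕ) : ℤ) : WithTop ℤ) ∧
      meromorphicOrderAt f z = (((m : ℤ) - 1 : ℤ) : WithTop ℤ) := fun z hz => by
    obtain ⟨m, hm, h1, h2⟩ := hpole z hz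
    have hg : MeromorphicAt g z := meromorphicAt_of_analyticAt_or (hor z)
    have heq : f =ᶠ[𝓝[≠] z] -(deriv E * (g * E)⁻¹) := by
      filter_upwards [eventually_analyticAt_of_or (hor z),
        (inv_eq_zero_of_not_analyticAt hz (hgp z hz)).2] with w hw hw0
      have hw0' : g w ≠ 0 := by simpa using hw0
      have := hE0 w hw
      simp only [Pi.neg_apply, Pi.mul_apply, Pi.inv_apply]
      rw [hderiv w hw]
      field_simp
    have hm1 : MeromorphicAt (-(deriv E * (g * E)⁻¹)) z :=
      ((hEan z).deriv.meromorphicAt.mul (hg.mul (hEan z).meromorphicAt).inv).neg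
    refine ⟨hm1.congr heq.symm, m, hm, h1, h2, ?_⟩
    rw [meromorphicOrderAt_congr heq, ← meromorphicOrderAt_neg,
      meromorphicOrderAt_mul (hEan z).deriv.meromorphicAt (hg.mul (hEan z).meromorphicAt).inv,
      meromorphicOrderAt_inv, meromorphicOrderAt_mul hg (hEan z).meromorphicAt, h1, h2,
      meromorphicOrderAt_deriv_eq_sub_one (n := ((n * m + k : ℕ) : ℤ)) _ h2]
    · rw [← WithTop.coe_add, ← WithTop.LinearOrderedAddCommGroup.coe_neg, ← WithTop.coe_add]
      congr 1
      ring
    · norm_cast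
      omega
  have hHan : ∀ z, AnalyticAt ℂ (nfExt f) z := fun z => by
    by_cases hz : AnalyticAt ℂ g z
    · exact analyticAt_nfExt (hfan z hz).meromorphicAt (hfan z hz).meromorphicOrderAt_nonneg
    · obtain ⟨h0, m, hm, -, -, h3⟩ := hford z hz
      refine analyticAt_nfExt h0 ?_
      rw [h3]
      norm_cast
      omega
  have hHn : ∀ z, AnalyticAt ℂ g z → nfExt f z = f z := fun z hz => nfExt_eq (hfan z hz)
  have hEb : ∀ z, AnalyticAt ℂ g z → ‖g z‖ ≤ 1 → ‖E z‖ ≤ δ⁻¹ := fun z hz h1 => by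
    rw [hEn z hz, norm_inv]
    exact inv_anti₀ hδ (hδ' z hz h1)
  refine ⟨E, nfExt f, δ⁻¹ + K₁ * δ⁻¹ + K₂, fun z => (hEan z).differentiableAt,
    fun z => (hHan z).differentiableAt, fun z hz => ?_, fun z hz => ?_, fun z hz => ?_,
    fun z hz => ?_, by positivity, fun z hz h1 => (hEb z hz h1).trans ?_, fun z hz h1 => ?_,
    fun z hz => ?_⟩
  · rw [hEn z hz]
    exact inv_mul_cancel₀ (hG0 z hz)
  · simp [hE, hz]
  · obtain ⟨h0, m, hm, h1, h2, h3⟩ := hford z hz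
    exact ⟨m, hm, h1, h2, by rw [meromorphicOrderAt_nfExt h0, h3]⟩
  · rw [hHn z hz, hderiv z hz]
  · have : 0 ≤ K₁ * δ⁻¹ := by positivity
    linarith
  · rw [hHn z hz, hf]
    simp only [norm_mul, norm_pow]
    have h2 : ‖g z‖ ^ (n - k - 2) ≤ 1 := pow_le_one₀ (norm_nonneg _) h1
    calc ‖g z‖ ^ (n - k - 2) * ‖powR n g (k + 1) z‖ * ‖E z‖ ≤ 1 * K₁ * δ⁻¹ := by
          gcongr
          · exact hK₁' z hz h1
          · exact hEb z hz h1
      _ ≤ _ := by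
        have : 0 < δ⁻¹ := by positivity
        linarith
  · have h1 : 1 = ‖E z‖ ^ 2 * ‖G z‖ ^ 2 := by
      rw [← mul_pow, ← norm_mul, hEn z hz, inv_mul_cancel₀ (hG0 z hz)]; simp
    have h2 := hK₂' z hz
    calc (1 : ℝ) = ‖E z‖ ^ 2 * ‖G z‖ ^ 2 := h1
      _ ≤ ‖E z‖ ^ 2 * (K₂ * (1 + ‖g z‖ ^ 2) ^ (n + k)) := by gcongr
      _ = K₂ * (‖E z‖ ^ 2 * (1 + ‖g z‖ ^ 2) ^ (n + k)) := by ring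
      _ ≤ (δ⁻¹ + K₁ * δ⁻¹ + K₂) * (‖E z‖ ^ 2 * (1 + ‖g z‖ ^ 2) ^ (n + k)) := by
          have : 0 ≤ K₁ * δ⁻¹ := by positivity
          have : 0 < δ⁻¹ := by positivity
          gcongr
          linarith
      _ = _ := by ring

/-- The polynomial function with zeros of order `m a` at the points `a ∈ S`. -/
def zeroProd (S : Finset ℂ) (m : ℂ → ℕ) (z : ℂ) : ℂ := ∏ a ∈ S, (z - a) ^ m a

theorem differentiable_zeroProd (S : Finset ℂ) (m : ℂ → ℕ) : Differentiable ℂ (zeroProd S m) := by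
  unfold zeroProd
  fun_prop

theorem analyticAt_zeroProd (S : Finset ℂ) (m : ℂ → ℕ) (z : ℂ) :
    AnalyticAt ℂ (zeroProd S m) z :=
  (differentiable_zeroProd S m).analyticAt z

theorem zeroProd_ne_zero {S : Finset ℂ} {m : ℂ → ℕ} {z : ℂ} (hz : z ∉ S) : zeroProd S m z ≠ 0 :=
  Finset.prod_ne_zero_iff.2 fun _ ha => pow_ne_zero _ (sub_ne_zero.2 fun h => hz (h ▸ ha))

theorem meromorphicOrderAt_zeroProd {S : Finset ℂ} {m : ℂ → ℕ} {z : ℂ} (hz : z ∈ S) :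
    meromorphicOrderAt (zeroProd S m) z = ((m z : ℤ) : WithTop ℤ) := by
  rw [meromorphicOrderAt_eq_int_iff (analyticAt_zeroProd S m z).meromorphicAt]
  refine ⟨zeroProd (S.erase z) m, analyticAt_zeroProd _ _ _, zeroProd_ne_zero (by simp),
    Eventually.of_forall fun w => ?_⟩
  rw [zeroProd, ← Finset.mul_prod_erase S _ hz, zpow_natCast, smul_eq_mul]
  rfl

theorem finite_not_analyticAt {g : ℂ → ℂ} (h : ∀ z, AnalyticAt ℂ g z ∨ AnalyticAt ℂ g⁻¹ z)
    {s : Set ℂ} (hs : IsCompact s) : {z ∈ s | ¬ AnalyticAt ℂ g z}.Finite := by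
  by_contra hinf
  obtain ⟨x, -, hx⟩ := Set.Infinite.exists_accPt_of_subset_isCompact hinf hs fun z hz => hz.1
  rw [accPt_iff_frequently_nhdsNE] at hx
  refine hx ?_
  filter_upwards [eventually_analyticAt_of_or (h x)] with w hw hw'
  exact hw'.2 hw

theorem log_norm_le_circleAverage {f : ℂ → ℂ} {R : ℝ} (hR : 0 < R)
    (hf : AnalyticOnNhd ℂ f (Metric.closedBall 0 R)) (h0 : f 0 ≠ 0) :
    Real.log ‖f 0‖ ≤ Real.circleAverage (fun z => Real.log ‖f z‖) 0 R := by
  rw [← abs_of_pos hR] at hf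
  rw [AnalyticOnNhd.circleAverage_log_norm hR.ne' hf h0]
  have : 0 ≤ ∑ᶠ u, (MeromorphicOn.divisor f (Metric.closedBall 0 |R|) u : ℝ) *
      Real.log (R * ‖0 - u‖⁻¹) := by
    refine finsum_nonneg fun u => ?_
    by_cases hu : u ∈ Metric.closedBall (0 : ℂ) |R|
    · refine mul_nonneg ?_ ?_
      · have := (MeromorphicOn.AnalyticOnNhd.divisor_nonneg hf) u
        exact_mod_cast this
      · rcases eq_or_ne u 0 with rfl | hu0
        · simp
        · refine Real.log_nonneg ?_
          rw [zero_sub, norm_neg, ← div_eq_mul_inv, one_le_div (norm_pos_iff.2 hu0)]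
          simpa [abs_of_pos hR] using hu
    · rw [Function.locallyFinsuppWithin.apply_eq_zero_of_notMem _ hu]
      simp
  linarith

/-- A meromorphic function with bounded spherical derivative is, on a disc, a quotient of analytic
functions without common zeros, the denominator being a polynomial. -/
theorem exists_quotient {g : ℂ → ℂ} {C : ℝ} (hsph : ∀ z, SphDerivLE g C z) (R : ℝ) :
    ∃ (S : Finset ℂ) (m : ℂ → ℕ) (g₁ : ℂ → ℂ), (∀ z ∈ S, ¬ AnalyticAt ℂ g z) ∧
      (∀ z ∈ S, meromorphicOrderAt g z = ((-(m z : ℤ) : ℤ) : WithTop ℤ)) ∧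
      (∀ z ∈ Metric.ball 0 R, ¬ AnalyticAt ℂ g z → z ∈ S) ∧
      AnalyticOnNhd ℂ g₁ (Metric.ball 0 R) ∧
      (∀ z, AnalyticAt ℂ g z → g₁ z = g z * zeroProd S m z) ∧
      (∀ z ∈ Metric.ball 0 R, g₁ z ≠ 0 ∨ zeroProd S m z ≠ 0) ∧
      ∀ z ∈ Metric.ball 0 R, ‖deriv g₁ z * zeroProd S m z - g₁ z * deriv (zeroProd S m) z‖ ≤
        C * (‖g₁ z‖ ^ 2 + ‖zeroProd S m z‖ ^ 2) := by
  have hor := fun z => (hsph z).analyticAt_or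
  have hfin := finite_not_analyticAt hor (isCompact_closedBall (0 : ℂ) R)
  have hex : ∀ z, ∃ m : ℕ, ¬ AnalyticAt ℂ g z →
      meromorphicOrderAt g z = ((-(m : ℤ) : ℤ) : WithTop ℤ) := fun z => by
    by_cases hz : AnalyticAt ℂ g z
    · exact ⟨0, fun h => absurd hz h⟩
    · obtain ⟨m, -, h, -⟩ := exists_pole_order hz ((hor z).resolve_left hz)
      exact ⟨m, fun _ => h⟩
  choose m hm using hex
  set S := hfin.toFinset with hS
  have hSn : ∀ z ∈ S, ¬ AnalyticAt ℂ g z := fun z hz => by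
    rw [hS, Set.Finite.mem_toFinset] at hz
    exact hz.2
  have hSm : ∀ z ∈ Metric.ball 0 R, ¬ AnalyticAt ℂ g z → z ∈ S := fun z hz h => by
    rw [hS, Set.Finite.mem_toFinset]
    exact ⟨Metric.ball_subset_closedBall hz, h⟩
  set g₂ := zeroProd S m with hg₂
  have hg₂an : ∀ z, AnalyticAt ℂ g₂ z := analyticAt_zeroProd S m
  have hmer : ∀ z, MeromorphicAt (g * g₂) z := fun z =>
    (meromorphicAt_of_analyticAt_or (hor z)).mul (hg₂an z).meromorphicAt
  have hord : ∀ z ∈ S, meromorphicOrderAt (g * g₂) z = 0 := fun z hz => by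
    rw [meromorphicOrderAt_mul (meromorphicAt_of_analyticAt_or (hor z)) (hg₂an z).meromorphicAt,
      hm z (hSn z hz), meromorphicOrderAt_zeroProd hz, ← WithTop.coe_add]
    simp
  have han : AnalyticOnNhd ℂ (nfExt (g * g₂)) (Metric.ball 0 R) := fun z hz => by
    by_cases h : AnalyticAt ℂ g z
    · exact analyticAt_nfExt (hmer z) (h.mul (hg₂an z)).meromorphicOrderAt_nonneg
    · exact analyticAt_nfExt (hmer z) (hord z (hSm z hz h)).ge
  have heq : ∀ z, AnalyticAt ℂ g z → nfExt (g * g₂) z = g z * g₂ z := fun z hz =>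
    nfExt_eq (hz.mul (hg₂an z))
  have hineq : ∀ z, AnalyticAt ℂ g z →
      ‖deriv (nfExt (g * g₂)) z * g₂ z - nfExt (g * g₂) z * deriv g₂ z‖ ≤
        C * (‖nfExt (g * g₂) z‖ ^ 2 + ‖g₂ z‖ ^ 2) := fun z hz => by
    have h1 : nfExt (g * g₂) =ᶠ[𝓝 z] fun w => g w * g₂ w := by
      filter_upwards [hz.eventually_analyticAt] with w hw using heq w hw
    rw [h1.deriv_eq, heq z hz,
      deriv_fun_mul hz.differentiableAt (hg₂an z).differentiableAt]
    have h2 := (hsph z).norm_deriv_le hz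
    calc ‖(deriv g z * g₂ z + g z * deriv g₂ z) * g₂ z - g z * g₂ z * deriv g₂ z‖
        = ‖deriv g z‖ * ‖g₂ z‖ ^ 2 := by
          rw [← norm_pow, ← norm_mul]; congr 1; ring
      _ ≤ C * (1 + ‖g z‖ ^ 2) * ‖g₂ z‖ ^ 2 := by gcongr
      _ = C * (‖g z * g₂ z‖ ^ 2 + ‖g₂ z‖ ^ 2) := by rw [norm_mul]; ring
  refine ⟨S, m, nfExt (g * g₂), hSn, fun z hz => hm z (hSn z hz), hSm, han, heq,
    fun z hz => ?_, fun z hz => ?_⟩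
  · by_cases h : z ∈ S
    · left
      refine ne_zero_of_meromorphicOrderAt_eq_zero (han z hz) ?_
      rw [meromorphicOrderAt_nfExt (hmer z), hord z h]
    · exact Or.inr (zeroProd_ne_zero h)
  · have hc1 := (han z hz).continuousAt
    have hc2 := (han z hz).deriv.continuousAt
    have hc3 := (hg₂an z).continuousAt
    have hc4 := (hg₂an z).deriv.continuousAt
    have t1 : ContinuousAt (fun w => ‖deriv (nfExt (g * g₂)) w * g₂ w -
        nfExt (g * g₂) w * deriv g₂ w‖) z := ((hc2.mul hc3).sub (hc1.mul hc4)).norm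
    have t2 : ContinuousAt (fun w => C * (‖nfExt (g * g₂) w‖ ^ 2 + ‖g₂ w‖ ^ 2)) z :=
      continuousAt_const.mul ((hc1.norm.pow 2).add (hc3.norm.pow 2))
    refine le_of_tendsto_of_tendsto (t1.tendsto.mono_left (nhdsWithin_le_nhds (s := {z}ᶜ)))
      (t2.tendsto.mono_left nhdsWithin_le_nhds) ?_
    filter_upwards [eventually_analyticAt_of_or (hor z)] with w hw using hineq w hw

theorem IsAux.exists_circleAverage_posLog_le {n k : ℕ} {C : ℝ} {g E H : ℂ → ℂ} {K : ℝ}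
    (h : IsLimitFun n k C g) (hn : 1 ≤ n) (hA : IsAux n k g E H K) (h0 : AnalyticAt ℂ g 0) :
    ∃ A ≥ 0, ∀ R > 0, Real.circleAverage (fun z => Real.posLog ‖E z‖) 0 R ≤ A * (1 + R ^ 2) := by
  have hor := fun z => (h.sph z).analyticAt_or
  set C₀ : ℝ := max 0 (Real.log K / 2) with hC₀
  set w₀ : ℝ := Real.log ‖E 0‖ + ((n + k : ℕ) : ℝ) / 2 * Real.log (1 + ‖g 0‖ ^ 2) with hw₀
  refine ⟨max 0 (w₀ + C₀) + ((n + k : ℕ) : ℝ) / 2 * C ^ 2, by positivity, fun R hR => ?_⟩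
  obtain ⟨S, m, g₁, hSn, hSo, hSm, hg₁, heq, hcom, hW⟩ := exists_quotient h.sph (R + 1)
  set g₂ := zeroProd S m with hg₂
  have hg₂an : ∀ z, AnalyticAt ℂ g₂ z := analyticAt_zeroProd S m
  have hEan : ∀ z, AnalyticAt ℂ E z := fun z => hA.diffE.analyticAt z
  have hnS : ∀ z, AnalyticAt ℂ g z → g₂ z ≠ 0 := fun z hz => zeroProd_ne_zero fun hs => hSn z hs hz
  set N := n + k with hN
  have hymer : ∀ z, MeromorphicAt (g₂ ^ N * E⁻¹) z := fun z =>
    ((hg₂an z).pow N).meromorphicAt.mul (hEan z).meromorphicAt.inv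
  have hyan0 : ∀ z, AnalyticAt ℂ g z → AnalyticAt ℂ (g₂ ^ N * E⁻¹) z := fun z hz =>
    ((hg₂an z).pow N).mul ((hEan z).inv (hA.ne_zero hz))
  set y := nfExt (g₂ ^ N * E⁻¹) with hy
  have hyan : ∀ z ∈ Metric.ball 0 (R + 1), AnalyticAt ℂ y z := fun z hz => by
    refine analyticAt_nfExt (hymer z) ?_
    by_cases hgz : AnalyticAt ℂ g z
    · exact (hyan0 z hgz).meromorphicOrderAt_nonneg
    · have hzS := hSm z hz hgz
      obtain ⟨m', hm', h1, h2, -⟩ := hA.pole z hgz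
      have hmm : m z = m' := by
        have := (hSo z hzS).symm.trans h1
        have := WithTop.coe_injective this
        omega
      rw [meromorphicOrderAt_mul ((hg₂an z).pow N).meromorphicAt (hEan z).meromorphicAt.inv,
        meromorphicOrderAt_inv, meromorphicOrderAt_pow (hg₂an z).meromorphicAt,
        meromorphicOrderAt_zeroProd hzS, h2, hmm,
        ← WithTop.LinearOrderedAddCommGroup.coe_neg, ← WithTop.coe_natCast, ← WithTop.coe_mul,
        ← WithTop.coe_add]
      norm_cast
      push_cast [hN]
      nlinarith
  have hyeq : ∀ z, AnalyticAt ℂ g z → y z = g₂ z ^ N * (E z)⁻¹ := fun z hz => nfExt_eq (hyan0 z hz)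
  have hsub : Metric.closedBall (0 : ℂ) R ⊆ Metric.ball 0 (R + 1) :=
    Metric.closedBall_subset_ball (by linarith)
  set q : ℂ → ℝ := fun z => Real.log (‖g₁ z‖ ^ 2 + ‖g₂ z‖ ^ 2) with hq
  have hkey : ∀ z, AnalyticAt ℂ g z → (N : ℝ) / 2 * q z - Real.log ‖y z‖ =
      Real.log ‖E z‖ + (N : ℝ) / 2 * Real.log (1 + ‖g z‖ ^ 2) := fun z hz => by
    have h2 : 0 < ‖g₂ z‖ := norm_pos_iff.2 (hnS z hz)
    have h3 : 0 < ‖E z‖ := norm_pos_iff.2 (hA.ne_zero hz)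
    have h4 : ‖g₁ z‖ ^ 2 + ‖g₂ z‖ ^ 2 = ‖g₂ z‖ ^ 2 * (1 + ‖g z‖ ^ 2) := by
      rw [heq z hz, norm_mul]; ring
    rw [hq]
    simp only
    rw [h4, Real.log_mul (by positivity) (by positivity), hyeq z hz, norm_mul, norm_pow, norm_inv,
      Real.log_mul (by positivity) (by positivity), Real.log_pow, Real.log_pow, Real.log_inv]
    push_cast
    ring
  have hlow : ∀ z, AnalyticAt ℂ g z → Real.posLog ‖E z‖ ≤
      (N : ℝ) / 2 * q z - Real.log ‖y z‖ + C₀ := fun z hz => by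
    rw [hkey z hz]
    have h3 : 0 < ‖E z‖ := norm_pos_iff.2 (hA.ne_zero hz)
    have h4 : 0 ≤ Real.log (1 + ‖g z‖ ^ 2) := Real.log_nonneg (by nlinarith [sq_nonneg ‖g z‖])
    refine max_le ?_ ?_
    · have h5 := Real.log_nonneg (hA.one_le z hz)
      have hK := hA.pos
      rw [Real.log_mul (by positivity) (by positivity), Real.log_mul (by positivity) (by positivity),
        Real.log_pow, Real.log_pow, ← hN] at h5
      have := le_max_right 0 (Real.log K / 2)
      push_cast at h5 ⊢
      linarith
    · have := le_max_left 0 (Real.log K / 2)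
      have : 0 ≤ (N : ℝ) / 2 * Real.log (1 + ‖g z‖ ^ 2) := by positivity
      linarith
  have hpos : ∀ z ∈ Metric.ball 0 (R + 1), ‖g₁ z‖ ^ 2 + ‖g₂ z‖ ^ 2 ≠ 0 := fun z hz => by
    rcases hcom z hz with h | h
    · have := norm_pos_iff.2 h
      positivity
    · have := norm_pos_iff.2 h
      positivity
  have hsph : Metric.sphere (0 : ℂ) |R| ⊆ Metric.ball 0 (R + 1) := by
    rw [abs_of_pos hR]
    exact Metric.sphere_subset_closedBall.trans hsub
  have hqint : CircleIntegrable q 0 R := by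
    refine ContinuousOn.circleIntegrable hR.le fun z hz => ContinuousAt.continuousWithinAt ?_
    have hz' : z ∈ Metric.ball 0 (R + 1) := hsub (Metric.sphere_subset_closedBall hz)
    exact ((((hg₁ z hz').continuousAt.norm.pow 2).add
      ((hg₂an z).continuousAt.norm.pow 2)).log (hpos z hz'))
  have hyint : CircleIntegrable (fun z => Real.log ‖y z‖) 0 R :=
    MeromorphicOn.circleIntegrable_log_norm fun z hz => (hyan z (hsph hz)).meromorphicAt
  have hEint : CircleIntegrable (fun z => Real.posLog ‖E z‖) 0 R :=
    (Real.continuous_posLog.comp hA.diffE.continuous.norm).continuousOn.circleIntegrable hR.le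
  have hqint' : CircleIntegrable (fun z => (N : ℝ) / 2 * q z) 0 R := hqint.const_mul _
  have hqy : CircleIntegrable ((fun z => (N : ℝ) / 2 * q z) - fun z => Real.log ‖y z‖) 0 R :=
    hqint'.sub hyint
  set F₁ : ℂ → ℝ := fun z => (N : ℝ) / 2 * q z - Real.log ‖y z‖ + C₀ with hF₁
  set F₂ : ℂ → ℝ := fun z => if AnalyticAt ℂ g z then F₁ z else 0 with hF₂
  have hcong : F₁ =ᶠ[codiscreteWithin (Metric.sphere 0 |R|)] F₂ := by
    have : {z : ℂ | AnalyticAt ℂ g z} ∈ codiscreteWithin (Metric.sphere (0 : ℂ) |R|) := by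
      rw [mem_codiscreteWithin_iff_forall_mem_nhdsNE]
      intro z _
      filter_upwards [eventually_analyticAt_of_or (hor z)] with w hw using Or.inl hw
    filter_upwards [this] with z hz
    have hz : AnalyticAt ℂ g z := hz
    simp [hF₂, hz]
  have hF₁int : CircleIntegrable F₁ 0 R :=
    hqy.add (circleIntegrable_const C₀ 0 R)
  have h1 : Real.circleAverage (fun z => Real.posLog ‖E z‖) 0 R ≤ Real.circleAverage F₂ 0 R := by
    refine Real.circleAverage_mono hEint (hF₁int.congr_codiscreteWithin hcong) fun z _ => ?_
    by_cases hz : AnalyticAt ℂ g z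
    · simpa [hF₂, hz] using hlow z hz
    · simp [hF₂, hz, hA.eq_zero z hz]
  rw [← Real.circleAverage_congr_codiscreteWithin hcong hR.ne'] at h1
  have h2 : Real.circleAverage F₁ 0 R = (N : ℝ) / 2 * Real.circleAverage q 0 R -
      Real.circleAverage (fun z => Real.log ‖y z‖) 0 R + C₀ := by
    have e1 : F₁ = ((fun z => (N : ℝ) / 2 * q z) - fun z => Real.log ‖y z‖) + fun _ => C₀ := rfl
    rw [e1, Real.circleAverage_add hqy (circleIntegrable_const C₀ 0 R),
      Real.circleAverage_sub hqint' hyint, Real.circleAverage_const]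
    congr 2
    exact Real.circleAverage_fun_smul (a := (N : ℝ) / 2) (f := q)
  have h3 := circleAverage_log_norm_sq_le hR (by linarith : R < R + 1) hg₁
    (fun z _ => hg₂an z) hcom hW
  have h4 := log_norm_le_circleAverage hR (fun z hz => hyan z (hsub hz)) (by
    rw [hyeq 0 h0]
    exact mul_ne_zero (pow_ne_zero _ (hnS 0 h0)) (inv_ne_zero (hA.ne_zero h0)))
  have h5 := hkey 0 h0
  have h6 : (N : ℝ) / 2 * Real.circleAverage q 0 R ≤ (N : ℝ) / 2 * (q 0 + C ^ 2 * R ^ 2) := by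
    gcongr
  have h7 : Real.circleAverage (fun z => Real.posLog ‖E z‖) 0 R ≤
      w₀ + C₀ + (N : ℝ) / 2 * C ^ 2 * R ^ 2 := by
    rw [hw₀]
    linarith
  have h8 := le_max_right 0 (w₀ + C₀)
  have h9 : 0 ≤ max 0 (w₀ + C₀) := le_max_left _ _
  have h10 : 0 ≤ (N : ℝ) / 2 * C ^ 2 := by positivity
  nlinarith [sq_nonneg R, mul_nonneg h9 (sq_nonneg R)]

theorem norm_circleAverage_le {f : ℂ → ℂ} {c : ℂ} {R : ℝ} :
    ‖Real.circleAverage f c R‖ ≤ Real.circleAverage (fun z => ‖f z‖) c R := by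
  rw [Real.circleAverage_def, Real.circleAverage_def, norm_smul, Real.norm_of_nonneg (by positivity),
    smul_eq_mul]
  gcongr
  exact intervalIntegral.norm_integral_le_integral_norm (by positivity)

/-- The logarithmic derivative of a zero-free function on a disc is controlled by the mean of the
absolute value of the logarithm of its modulus on the boundary. -/
theorem norm_deriv_le_circleAverage_abs_log {F : ℂ → ℂ} {R : ℝ}
    (hF : AnalyticOnNhd ℂ F (Metric.closedBall 0 R)) (h0 : ∀ z ∈ Metric.closedBall 0 R, F z ≠ 0)
    {w : ℂ} (hR : 0 < R) (hw : ‖w‖ ≤ R / 2) :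
    ‖deriv F w‖ ≤ 8 / R * Real.circleAverage (fun z => |Real.log ‖F z‖|) 0 R * ‖F w‖ := by
  set u : ℂ → ℝ := fun z => Real.log ‖F z‖ with hu
  have hharm : InnerProductSpace.HarmonicOnNhd u (Metric.closedBall 0 R) := fun z hz =>
    (hF z hz).harmonicAt_log_norm (h0 z hz)
  have hucont : ContinuousOn u (Metric.sphere 0 |R|) := fun z hz => by
    have hz' : z ∈ Metric.closedBall (0 : ℂ) R := by
      rw [abs_of_pos hR] at hz
      exact Metric.sphere_subset_closedBall hz
    exact ((hF z hz').continuousAt.norm.log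
      (norm_ne_zero_iff.2 (h0 z hz'))).continuousWithinAt
  have huint : CircleIntegrable u 0 R := by
    exact hucont.circleIntegrable'
  have huint' : CircleIntegrable (fun ζ => (u ζ : ℂ)) 0 R := by
    exact (continuous_ofReal.comp_continuousOn hucont).circleIntegrable'
  set h : ℂ → ℂ := fun w => Real.circleAverage (fun ζ => herglotzRieszKernel 0 w ζ • (u ζ : ℂ)) 0 R
    with hh
  have hre : ∀ w ∈ Metric.ball (0 : ℂ) R, (h w).re = Real.log ‖F w‖ := fun w hw => by
    rw [hh, ← show u w = Real.log ‖F w‖ from rfl,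
      ← hharm.circleAverage_re_herglotzRieszKernel_smul hw]
    exact re_circleAverage_herglotzRieszKernel_smul huint hw
  have hder : ∀ w ∈ Metric.ball (0 : ℂ) R, HasDerivAt h
      (Real.circleAverage (fun ζ => (2 * ζ / (ζ - w) ^ 2) • (u ζ : ℂ)) 0 R) w := fun w hw =>
    hasDerivAt_circleAverage_herglotzRieszKernel_smul huint' hw
  have hwb : w ∈ Metric.ball (0 : ℂ) R := by
    rw [mem_ball_zero_iff]; linarith
  have hFd : ∀ w ∈ Metric.ball (0 : ℂ) R, HasDerivAt F (deriv F w) w := fun w hw =>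
    (hF w (Metric.ball_subset_closedBall hw)).differentiableAt.hasDerivAt
  set q : ℂ → ℂ := fun w => F w * Complex.exp (-h w) with hq
  have hqd : ∀ w ∈ Metric.ball (0 : ℂ) R, HasDerivAt q _ w := fun w hw =>
    (hFd w hw).mul (hder w hw).neg.cexp
  have hqn : ∀ w ∈ Metric.ball (0 : ℂ) R, ‖q w‖ = 1 := fun w hw => by
    have := norm_pos_iff.2 (h0 w (Metric.ball_subset_closedBall hw))
    rw [hq, norm_mul, Complex.norm_exp, neg_re, hre w hw, Real.exp_neg, Real.exp_log this,
      mul_inv_cancel₀ this.ne']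
  have hconst : EqOn q (Function.const ℂ (q w)) (Metric.ball 0 R) :=
    Complex.eqOn_of_isPreconnected_of_isMaxOn_norm (convex_ball 0 R).isPreconnected
      Metric.isOpen_ball (fun z hz => (hqd z hz).differentiableAt.differentiableWithinAt) hwb
      fun z hz => by simp [hqn z hz, hqn w hwb]
  have hq0 : deriv q w = 0 := by
    have : q =ᶠ[𝓝 w] fun _ => q w := by
      filter_upwards [Metric.isOpen_ball.mem_nhds hwb] with z hz using hconst hz
    rw [this.deriv_eq, deriv_const]
  rw [(hqd w hwb).deriv] at hq0
  set d := Real.circleAverage (fun ζ => (2 * ζ / (ζ - w) ^ 2) • (u ζ : ℂ)) 0 R with hd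
  have hFw : deriv F w = d * F w := by
    have h1 := Complex.exp_ne_zero (-h w)
    have h2 : (deriv F w - d * F w) * Complex.exp (-h w) = 0 := by
      linear_combination hq0
    exact sub_eq_zero.1 ((mul_eq_zero.1 h2).resolve_right h1)
  rw [hFw, norm_mul]
  gcongr
  refine norm_circleAverage_le.trans ?_
  rw [← smul_eq_mul, ← Real.circleAverage_fun_smul]
  have hmem : ∀ ζ ∈ Metric.sphere (0 : ℂ) |R|, ‖ζ‖ = R ∧ R / 2 ≤ ‖ζ - w‖ := fun ζ hζ => by
    have h1 : ‖ζ‖ = R := by simpa [abs_of_pos hR] using hζ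
    have := norm_sub_norm_le ζ w
    exact ⟨h1, by linarith⟩
  refine Real.circleAverage_mono ?_ ?_ fun ζ hζ => ?_
  · refine ContinuousOn.circleIntegrable' ?_
    refine ContinuousOn.norm (ContinuousOn.smul (ContinuousOn.div
      (f := fun ζ => 2 * ζ) (g := fun ζ => (ζ - w) ^ 2) (by fun_prop) (by fun_prop) ?_)
      (continuous_ofReal.comp_continuousOn hucont))
    intro ζ hζ
    refine pow_ne_zero _ (norm_ne_zero_iff.1 ?_)
    have := (hmem ζ hζ).2
    linarith
  · refine ContinuousOn.circleIntegrable' ?_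
    exact (hucont.abs).const_smul (8 / R)
  · obtain ⟨h1, h2⟩ := hmem ζ hζ
    rw [smul_eq_mul, smul_eq_mul, norm_mul, norm_div, norm_mul, norm_pow, h1, Complex.norm_real,
      Real.norm_eq_abs]
    refine mul_le_mul_of_nonneg_right ?_ (abs_nonneg _)
    have h3 : 0 < ‖ζ - w‖ := by linarith
    rw [div_le_div_iff₀ (by positivity) hR]
    simp only [Complex.norm_ofNat]
    nlinarith [mul_self_le_mul_self (by positivity) h2]

theorem finite_zeros {E : ℂ → ℂ} (hE : Differentiable ℂ E) (h0 : E 0 ≠ 0) {s : Set ℂ}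
    (hs : IsCompact s) : {z ∈ s | E z = 0}.Finite := by
  by_contra hinf
  obtain ⟨x, -, hx⟩ := Set.Infinite.exists_accPt_of_subset_isCompact hinf hs fun z hz => hz.1
  rw [accPt_iff_frequently_nhdsNE] at hx
  have han : AnalyticOnNhd ℂ E univ := fun z _ => hE.analyticAt z
  have := han.eqOn_zero_of_preconnected_of_frequently_eq_zero isPreconnected_univ (mem_univ x)
    (hx.mono fun z hz => hz.2)
  exact h0 (this (mem_univ 0))

/-- An entire function is the product of a polynomial and a function without zeros on a disc. -/
theorem exists_eq_zeroProd_mul {E : ℂ → ℂ} (hE : Differentiable ℂ E) (h0 : E 0 ≠ 0) (R : ℝ) :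
    ∃ (S : Finset ℂ) (m : ℂ → ℕ) (E₁ : ℂ → ℂ),
      (∀ a ∈ S, a ∈ Metric.closedBall (0 : ℂ) R ∧ E a = 0 ∧ 1 ≤ m a) ∧
      Differentiable ℂ E₁ ∧ (∀ z ∈ Metric.closedBall (0 : ℂ) R, E₁ z ≠ 0) ∧
      ∀ z, E z = zeroProd S m z * E₁ z := by
  have hfin := finite_zeros hE h0 (isCompact_closedBall (0 : ℂ) R)
  set S := hfin.toFinset with hS
  have hmemS : ∀ z, z ∈ S ↔ z ∈ Metric.closedBall (0 : ℂ) R ∧ E z = 0 := fun z => by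
    rw [hS, Set.Finite.mem_toFinset]; rfl
  have hEan := fun z => hE.analyticAt z
  have han : AnalyticOnNhd ℂ E univ := fun z _ => hEan z
  have htop : ∀ z, analyticOrderAt E z ≠ ⊤ := fun z hz => by
    rw [analyticOrderAt_eq_top] at hz
    have := han.eqOn_zero_of_preconnected_of_eventuallyEq_zero isPreconnected_univ (mem_univ z) hz
    exact h0 (this (mem_univ 0))
  set m : ℂ → ℕ := fun z => analyticOrderNatAt E z with hm
  have hord : ∀ z, meromorphicOrderAt E z = ((m z : ℤ) : WithTop ℤ) := fun z => by
    rw [(hEan z).meromorphicOrderAt_eq, ← Nat.cast_analyticOrderNatAt (htop z)]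
    rfl
  have hP := analyticAt_zeroProd S m
  have hmer : ∀ z, MeromorphicAt (E * (zeroProd S m)⁻¹) z := fun z =>
    (hEan z).meromorphicAt.mul (hP z).meromorphicAt.inv
  have hoS : ∀ z ∈ S, meromorphicOrderAt (E * (zeroProd S m)⁻¹) z = 0 := fun z hz => by
    rw [meromorphicOrderAt_mul (hEan z).meromorphicAt (hP z).meromorphicAt.inv,
      meromorphicOrderAt_inv, hord z, meromorphicOrderAt_zeroProd hz,
      ← WithTop.LinearOrderedAddCommGroup.coe_neg, ← WithTop.coe_add, add_neg_cancel]
    rfl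
  have hnS : ∀ z, z ∉ S → AnalyticAt ℂ (E * (zeroProd S m)⁻¹) z := fun z hz =>
    (hEan z).mul ((hP z).inv (zeroProd_ne_zero hz))
  set E₁ := nfExt (E * (zeroProd S m)⁻¹) with hE₁
  have hE₁an : ∀ z, AnalyticAt ℂ E₁ z := fun z => by
    by_cases hz : z ∈ S
    · exact analyticAt_nfExt (hmer z) (hoS z hz).ge
    · exact analyticAt_nfExt (hmer z) (hnS z hz).meromorphicOrderAt_nonneg
  have heq : ∀ z, z ∉ S → E z = zeroProd S m z * E₁ z := fun z hz => by
    have := zeroProd_ne_zero (m := m) hz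
    rw [hE₁, nfExt_eq (hnS z hz), Pi.mul_apply, Pi.inv_apply]
    field_simp
  have hne : ∀ z ∈ S, E₁ z ≠ 0 := fun z hz => by
    refine ne_zero_of_meromorphicOrderAt_eq_zero (hE₁an z) ?_
    rw [hE₁, meromorphicOrderAt_nfExt (hmer z), hoS z hz]
  refine ⟨S, m, E₁, fun a ha => ⟨((hmemS a).1 ha).1, ((hmemS a).1 ha).2, ?_⟩,
    fun z => (hE₁an z).differentiableAt, fun z hz => ?_, fun z => ?_⟩
  · rw [Nat.one_le_iff_ne_zero]
    intro h
    have h1 := (Nat.cast_analyticOrderNatAt (htop a)).symm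
    rw [show analyticOrderNatAt E a = 0 from h, Nat.cast_zero,
      (hEan a).analyticOrderAt_eq_zero] at h1
    exact h1 ((hmemS a).1 ha).2
  · by_cases h : z ∈ S
    · exact hne z h
    · intro h1
      have h2 := heq z h
      rw [h1, mul_zero] at h2
      exact h ((hmemS z).2 ⟨hz, h2⟩)
  · have hc : Continuous fun z => E z - zeroProd S m z * E₁ z :=
      hE.continuous.sub ((differentiable_zeroProd S m).continuous.mul
        (continuous_iff_continuousAt.2 fun z => (hE₁an z).continuousAt))
    have hd : Dense (((S : Set ℂ))ᶜ) := S.finite_toSet.countable.dense_compl ℂ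
    have := Continuous.ext_on hd hc continuous_const fun z hz => by
      show _ = (0 : ℂ)
      rw [heq z (by simpa using hz), sub_self]
    exact sub_eq_zero.1 (congrFun this z)

/-- The product of the factors of `zeroProd` reflected in the circle of radius `R`. -/
def reflProd (R : ℝ) (S : Finset ℂ) (m : ℂ → ℕ) (z : ℂ) : ℂ :=
  ∏ a ∈ S, (((R : ℂ) ^ 2 - (starRingEnd ℂ) a * z) / R) ^ m a

theorem differentiable_reflProd (R : ℝ) (S : Finset ℂ) (m : ℂ → ℕ) :
    Differentiable ℂ (reflProd R S m) := by
  unfold reflProd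
  fun_prop

theorem norm_mul_sub_le {R : ℝ} {a z : ℂ} (ha : ‖a‖ ≤ R) :
    R ^ 2 - R * ‖z‖ ≤ ‖(R : ℂ) ^ 2 - (starRingEnd ℂ) a * z‖ := by
  have h1 := norm_sub_norm_le ((R : ℂ) ^ 2) ((starRingEnd ℂ) a * z)
  rw [norm_mul, RCLike.norm_conj, norm_pow, Complex.norm_real, Real.norm_eq_abs, sq_abs] at h1
  have h2 : ‖a‖ * ‖z‖ ≤ R * ‖z‖ := by gcongr
  linarith

theorem sq_sub_conj_mul_ne_zero {R : ℝ} {a z : ℂ} (ha : ‖a‖ < R) (hz : ‖z‖ ≤ R) :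
    (R : ℂ) ^ 2 - (starRingEnd ℂ) a * z ≠ 0 := by
  intro h
  have h1 : ‖(R : ℂ) ^ 2‖ = ‖(starRingEnd ℂ) a * z‖ := by rw [sub_eq_zero.1 h]
  rw [norm_mul, RCLike.norm_conj, norm_pow, Complex.norm_real, Real.norm_eq_abs, sq_abs] at h1
  have := norm_nonneg a
  have := norm_nonneg z
  nlinarith

theorem reflProd_ne_zero {R : ℝ} {S : Finset ℂ} {m : ℂ → ℕ} {z : ℂ} (hR : 0 < R)
    (hS : ∀ a ∈ S, ‖a‖ < R) (hz : ‖z‖ ≤ R) : reflProd R S m z ≠ 0 :=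
  Finset.prod_ne_zero_iff.2 fun a ha => pow_ne_zero _
    (div_ne_zero (sq_sub_conj_mul_ne_zero (hS a ha) hz) (by exact_mod_cast hR.ne'))

theorem norm_reflProd {R : ℝ} {S : Finset ℂ} {m : ℂ → ℕ} {z : ℂ} (hR : 0 < R)
    (hz : ‖z‖ = R) : ‖reflProd R S m z‖ = ‖zeroProd S m z‖ := by
  rw [reflProd, zeroProd, norm_prod, norm_prod]
  refine Finset.prod_congr rfl fun a _ => ?_
  rw [norm_pow, norm_pow]
  congr 1
  have h1 : (R : ℂ) ^ 2 - (starRingEnd ℂ) a * z = z * (starRingEnd ℂ) (z - a) := by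
    rw [map_sub, mul_sub, Complex.mul_conj, Complex.normSq_eq_norm_sq, hz]
    push_cast
    ring
  rw [h1, norm_div, norm_mul, RCLike.norm_conj, hz, Complex.norm_real, Real.norm_of_nonneg hR.le]
  field_simp

theorem exists_forall_le_abs_sub (T : Finset ℝ) {r : ℝ} (hr : 0 < r) :
    ∃ t, r ≤ t ∧ t ≤ 2 * r ∧ ∀ x ∈ T, r / (2 * (T.card + 1)) ≤ |t - x| := by
  by_contra! h
  set d : ℝ := r / (T.card + 1) with hd
  have hd0 : 0 < d := by positivity
  have hdT : d * (T.card + 1) = r := by rw [hd]; field_simp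
  have hd2 : r / (2 * (T.card + 1)) = d / 2 := by rw [hd]; field_simp
  rw [hd2] at h
  have h' : ∀ i ∈ Finset.range (T.card + 1), ∃ x ∈ T, |r + d * i - x| < d / 2 := fun i hi => by
    rw [Finset.mem_range] at hi
    have hi' : (i : ℝ) ≤ T.card + 1 := by exact_mod_cast hi.le
    refine h (r + d * i) (by have := mul_nonneg hd0.le i.cast_nonneg; linarith) ?_
    have : d * i ≤ d * (T.card + 1) := by gcongr
    linarith
  choose! x hxT hx using h'
  obtain ⟨i, hi, j, hj, hij, he⟩ := Finset.exists_ne_map_eq_of_card_lt_of_maps_to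
    (s := Finset.range (T.card + 1)) (t := T) (by simp) hxT
  have h1 := hx i hi
  have h2 := hx j hj
  rw [he] at h1
  rw [abs_lt] at h1 h2
  have h3 : d * |(i : ℝ) - j| < d := by
    rw [← abs_of_pos hd0, ← abs_mul, abs_of_pos hd0, abs_lt]
    constructor <;> linarith
  have h4 : (1 : ℝ) ≤ |(i : ℝ) - j| := by
    have : (1 : ℤ) ≤ |(i : ℤ) - j| := Int.one_le_abs (sub_ne_zero.2 (by exact_mod_cast hij))
    exact_mod_cast this
  nlinarith

theorem abs_log_eq (x : ℝ) : |Real.log x| = 2 * Real.posLog x - Real.log x := by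
  rw [Real.posLog]
  rcases le_total 0 (Real.log x) with h | h
  · rw [abs_of_nonneg h, max_eq_right h]; ring
  · rw [abs_of_nonpos h, max_eq_left h]; ring

theorem circleIntegrable_log_norm {E : ℂ → ℂ} (hE : Differentiable ℂ E) (R : ℝ) :
    CircleIntegrable (fun z => Real.log ‖E z‖) 0 R :=
  MeromorphicOn.circleIntegrable_log_norm fun z _ => (hE.analyticAt z).meromorphicAt

theorem circleIntegrable_posLog_norm {E : ℂ → ℂ} (hE : Differentiable ℂ E) (R : ℝ) :
    CircleIntegrable (fun z => Real.posLog ‖E z‖) 0 R :=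
  ContinuousOn.circleIntegrable' (Real.continuous_posLog.comp hE.continuous.norm).continuousOn

/-- The number of zeros of an entire function is controlled by its growth. -/
theorem sum_mul_log_two_le {E E₁ : ℂ → ℂ} {S : Finset ℂ} {m : ℂ → ℕ} {R : ℝ} (hR : 0 < R)
    (hE : Differentiable ℂ E) (hE₁ : Differentiable ℂ E₁) (h0 : E 0 ≠ 0) (hS : ∀ a ∈ S, ‖a‖ ≤ R)
    (heq : ∀ z, E z = zeroProd S m z * E₁ z) :
    (∑ a ∈ S, (m a : ℝ)) * Real.log 2 ≤
      Real.circleAverage (fun z => Real.posLog ‖E z‖) 0 (2 * R) - Real.log ‖E 0‖ := by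
  have h2R : 0 < 2 * R := by positivity
  set F : ℂ → ℂ := fun z => reflProd (2 * R) S m z * E₁ z with hF
  have hFd : Differentiable ℂ F := (differentiable_reflProd (2 * R) S m).mul hE₁
  have hE₁0 : E₁ 0 ≠ 0 := fun h => h0 (by rw [heq, h, mul_zero])
  have hF0 : F 0 ≠ 0 := mul_ne_zero (reflProd_ne_zero h2R (fun a ha => by
    have := hS a ha; linarith) (by simp; positivity)) hE₁0
  have hlow : 2 ^ (∑ a ∈ S, m a) * ‖E 0‖ ≤ ‖F 0‖ := by
    rw [heq, norm_mul, hF, norm_mul, ← mul_assoc]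
    gcongr
    rw [zeroProd, reflProd, norm_prod, norm_prod, ← Finset.prod_pow_eq_pow_sum,
      ← Finset.prod_mul_distrib]
    refine Finset.prod_le_prod (fun a _ => by positivity) fun a ha => ?_
    rw [norm_pow, norm_pow, ← mul_pow]
    refine pow_le_pow_left₀ (by positivity) ?_ _
    have h1 : (((2 * R : ℝ) : ℂ) ^ 2 - (starRingEnd ℂ) a * 0) / ((2 * R : ℝ) : ℂ) =
        ((2 * R : ℝ) : ℂ) := by
      have : ((2 * R : ℝ) : ℂ) ≠ 0 := by exact_mod_cast h2R.ne'
      field_simp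
      ring
    rw [h1, Complex.norm_real, Real.norm_of_nonneg h2R.le, zero_sub, norm_neg]
    have := hS a ha
    linarith
  have h1 := log_norm_le_circleAverage h2R (fun z _ => hFd.analyticAt z) hF0
  have h2 : Real.circleAverage (fun z => Real.log ‖F z‖) 0 (2 * R) ≤
      Real.circleAverage (fun z => Real.posLog ‖E z‖) 0 (2 * R) := by
    refine Real.circleAverage_mono (circleIntegrable_log_norm hFd _)
      (circleIntegrable_posLog_norm hE _) fun z hz => ?_
    have hz' : ‖z‖ = 2 * R := by simpa [abs_of_pos hR] using hz
    rw [hF, norm_mul, norm_reflProd h2R hz', ← norm_mul, ← heq]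
    exact le_max_right _ _
  have h3 := Real.log_le_log (by have := norm_pos_iff.2 h0; positivity) hlow
  rw [Real.log_mul (by positivity) (norm_ne_zero_iff.2 h0), Real.log_pow] at h3
  push_cast at h3
  linarith

/-- The logarithmic derivative of an entire function of finite order has polynomial growth on
suitable large circles. -/
theorem exists_circle_norm_deriv_le {E : ℂ → ℂ} {A : ℝ} (hE : Differentiable ℂ E) (h0 : E 0 ≠ 0)
    (hA0 : 0 ≤ A)
    (hA : ∀ R > 0, Real.circleAverage (fun z => Real.posLog ‖E z‖) 0 R ≤ A * (1 + R ^ 2)) :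
    ∃ B ≥ 0, ∀ r ≥ 1, ∃ t ≥ r, ∀ z ∈ Metric.sphere (0 : ℂ) t,
      E z ≠ 0 ∧ ‖deriv E z‖ ≤ B * t ^ 4 * ‖E z‖ := by
  set L := |Real.log ‖E 0‖| with hL
  have hL0 : 0 ≤ L := abs_nonneg _
  have hL1 : -L ≤ Real.log ‖E 0‖ := neg_abs_le _
  set D := A + L with hD
  have hD0 : 0 ≤ D := by positivity
  refine ⟨514 * D + 2 * (2050 * D) ^ 2 + 3 * (2050 * D), by positivity, fun r hr => ?_⟩
  have hr0 : 0 < r := by linarith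
  obtain ⟨R, ⟨hR8, hR16⟩, hRz⟩ : ∃ R ∈ Icc (8 * r) (16 * r), ∀ z, ‖z‖ = R → E z ≠ 0 := by
    have hinf : (Icc (8 * r) (16 * r)).Infinite := Set.Icc_infinite (by linarith)
    have hfin := (finite_zeros hE h0 (isCompact_closedBall (0 : ℂ) (16 * r))).image norm
    obtain ⟨R, hR, hRn⟩ := hinf.exists_notMem_finite hfin
    refine ⟨R, hR, fun z hz h => hRn ⟨z, ⟨?_, h⟩, hz⟩⟩
    rw [mem_closedBall_zero_iff, hz]
    exact hR.2
  have hR0 : 0 < R := by linarith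
  obtain ⟨S, m, E₁, hS, hE₁, hE₁n, heq⟩ := exists_eq_zeroProd_mul hE h0 R
  have hSR : ∀ a ∈ S, ‖a‖ < R := fun a ha => by
    obtain ⟨h1, h2, -⟩ := hS a ha
    exact lt_of_le_of_ne (mem_closedBall_zero_iff.1 h1) fun h => hRz a h h2
  have hr2 : 1 ≤ r ^ 2 := one_le_pow₀ hr
  set M : ℝ := ∑ a ∈ S, (m a : ℝ) with hM
  have hM0 : 0 ≤ M := Finset.sum_nonneg fun a _ => Nat.cast_nonneg _
  have hMle : M ≤ 2050 * D * r ^ 2 := by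
    have h1 := sum_mul_log_two_le hR0 hE hE₁ h0 (fun a ha => (hSR a ha).le) heq
    have h2 := hA (2 * R) (by positivity)
    have h3 : (1 / 2 : ℝ) ≤ Real.log 2 := by have := Real.log_two_gt_d9; linarith
    have h4 : M * (1 / 2) ≤ M * Real.log 2 := by gcongr
    have h5 : R ^ 2 ≤ (16 * r) ^ 2 := by gcongr
    have h6 : A * R ^ 2 ≤ A * (16 * r) ^ 2 := by gcongr
    have h7 : A ≤ A * r ^ 2 := le_mul_of_one_le_right hA0 hr2
    have h8 : L ≤ L * r ^ 2 := le_mul_of_one_le_right hL0 hr2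
    have h9 : 0 ≤ A * r ^ 2 := by positivity
    have h10 : 0 ≤ L * r ^ 2 := by positivity
    rw [hD]
    nlinarith
  have hcard : (S.card : ℝ) ≤ M := by
    rw [hM, Finset.card_eq_sum_ones]
    push_cast
    exact Finset.sum_le_sum fun a ha => by exact_mod_cast (hS a ha).2.2
  obtain ⟨t, ht1, ht2, ht⟩ := exists_forall_le_abs_sub (S.image norm) hr0
  have hd : ∀ a ∈ S, r / (2 * (M + 1)) ≤ |t - ‖a‖| := fun a ha => by
    refine le_trans ?_ (ht ‖a‖ (Finset.mem_image_of_mem _ ha))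
    have : ((S.image norm).card : ℝ) ≤ M := le_trans (by exact_mod_cast Finset.card_image_le) hcard
    gcongr
  have hdpos : 0 < r / (2 * (M + 1)) := by positivity
  refine ⟨t, ht1, fun z hz => ?_⟩
  have hzt : ‖z‖ = t := by simpa using hz
  have hzR : ‖z‖ ≤ R / 4 := by linarith
  have hza : ∀ a ∈ S, r / (2 * (M + 1)) ≤ ‖z - a‖ := fun a ha => by
    refine (hd a ha).trans ?_
    rw [← hzt]
    exact abs_norm_sub_norm_le z a
  have hza0 : ∀ a ∈ S, z - a ≠ 0 := fun a ha => norm_pos_iff.1 (hdpos.trans_le (hza a ha))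
  have hq0 : ∀ a ∈ S, ((R : ℂ) ^ 2 - (starRingEnd ℂ) a * z) / R ≠ 0 := fun a ha =>
    div_ne_zero (sq_sub_conj_mul_ne_zero (hSR a ha) (by linarith)) (by exact_mod_cast hR0.ne')
  have hE₁z : E₁ z ≠ 0 := hE₁n z (by rw [mem_closedBall_zero_iff]; linarith)
  have hPz : zeroProd S m z ≠ 0 :=
    Finset.prod_ne_zero_iff.2 fun a ha => pow_ne_zero _ (hza0 a ha)
  have hEz : E z ≠ 0 := by rw [heq]; exact mul_ne_zero hPz hE₁z
  refine ⟨hEz, ?_⟩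
  set F : ℂ → ℂ := fun z => reflProd R S m z * E₁ z with hF
  have hFd : Differentiable ℂ F := (differentiable_reflProd R S m).mul hE₁
  have hFn : ∀ z ∈ Metric.closedBall (0 : ℂ) R, F z ≠ 0 := fun z hz =>
    mul_ne_zero (reflProd_ne_zero hR0 hSR (by simpa using hz)) (hE₁n z hz)
  have hFz : F z ≠ 0 := hFn z (by rw [mem_closedBall_zero_iff]; linarith)
  have hFlog := norm_deriv_le_circleAverage_abs_log (w := z) (fun z _ => hFd.analyticAt z) hFn hR0
    (by linarith)
  have hBR : Real.circleAverage (fun z => |Real.log ‖F z‖|) 0 R ≤ 514 * D * r ^ 2 := by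
    have h1 : Real.circleAverage (fun z => |Real.log ‖F z‖|) 0 R =
        Real.circleAverage (fun z => 2 * Real.posLog ‖E z‖ - Real.log ‖E z‖) 0 R := by
      refine Real.circleAverage_congr_sphere fun z hz => ?_
      have hz' : ‖z‖ = R := by simpa [abs_of_pos hR0] using hz
      rw [hF, norm_mul, norm_reflProd hR0 hz', ← norm_mul, ← heq, abs_log_eq]
    have hi1 : CircleIntegrable (fun z => 2 * Real.posLog ‖E z‖) 0 R :=
      (circleIntegrable_posLog_norm hE R).const_fun_smul (a := (2 : ℝ))
    have h2 : Real.circleAverage (fun z => 2 * Real.posLog ‖E z‖) 0 R =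
        2 * Real.circleAverage (fun z => Real.posLog ‖E z‖) 0 R :=
      Real.circleAverage_fun_smul (a := (2 : ℝ))
    rw [h1, Real.circleAverage_fun_sub hi1 (circleIntegrable_log_norm hE R), h2]
    have h3 := log_norm_le_circleAverage hR0 (fun z _ => hE.analyticAt z) h0
    have h4 := hA R hR0
    have h5 : R ^ 2 ≤ (16 * r) ^ 2 := by gcongr
    have h6 : A * R ^ 2 ≤ A * (16 * r) ^ 2 := by gcongr
    have h7 : A ≤ A * r ^ 2 := le_mul_of_one_le_right hA0 hr2
    have h8 : L ≤ L * r ^ 2 := le_mul_of_one_le_right hL0 hr2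
    have h10 : 0 ≤ L * r ^ 2 := by positivity
    rw [hD]
    nlinarith
  have hlogF : ‖logDeriv F z‖ ≤ 514 * D * r ^ 2 := by
    rw [logDeriv_apply, norm_div, div_le_iff₀ (norm_pos_iff.2 hFz)]
    refine hFlog.trans ?_
    refine mul_le_mul_of_nonneg_right ?_ (norm_nonneg _)
    have : 8 / R ≤ 1 := by rw [div_le_one hR0]; linarith
    have h0' : 0 ≤ Real.circleAverage (fun z => |Real.log ‖F z‖|) 0 R :=
      Real.circleAverage_nonneg_of_nonneg fun z _ => abs_nonneg _
    calc 8 / R * _ ≤ 1 * Real.circleAverage (fun z => |Real.log ‖F z‖|) 0 R := by gcongr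
      _ ≤ _ := by rw [one_mul]; exact hBR
  have hlP : logDeriv (zeroProd S m) z = ∑ a ∈ S, (m a : ℂ) * (1 / (z - a)) := by
    unfold zeroProd
    rw [logDeriv_prod (f := fun a (z : ℂ) => (z - a) ^ m a)
      (fun a ha => pow_ne_zero _ (hza0 a ha)) fun a _ => by fun_prop]
    refine Finset.sum_congr rfl fun a _ => ?_
    rw [logDeriv_fun_pow (by fun_prop), logDeriv_apply]
    simp
  have hlQ : logDeriv (reflProd R S m) z =
      ∑ a ∈ S, (m a : ℂ) * (-(starRingEnd ℂ) a / ((R : ℂ) ^ 2 - (starRingEnd ℂ) a * z)) := by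
    unfold reflProd
    rw [logDeriv_prod
      (f := fun a (z : ℂ) => (((R : ℂ) ^ 2 - (starRingEnd ℂ) a * z) / R) ^ m a)
      (fun a ha => pow_ne_zero _ (hq0 a ha)) fun a _ => by fun_prop]
    refine Finset.sum_congr rfl fun a ha => ?_
    have hd : HasDerivAt (fun w : ℂ => ((R : ℂ) ^ 2 - (starRingEnd ℂ) a * w) / R)
        ((-((starRingEnd ℂ) a * 1)) / R) z :=
      (((hasDerivAt_id z).const_mul ((starRingEnd ℂ) a)).const_sub ((R : ℂ) ^ 2)).div_const _
    rw [logDeriv_fun_pow hd.differentiableAt, logDeriv_apply, hd.deriv]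
    have h1 : (R : ℂ) ≠ 0 := by exact_mod_cast hR0.ne'
    rw [mul_one, div_div_div_cancel_right₀ h1]
  have hlE : logDeriv E z = logDeriv (zeroProd S m) z + logDeriv E₁ z := by
    rw [show E = fun z => zeroProd S m z * E₁ z from funext heq]
    exact logDeriv_mul z hPz hE₁z (differentiable_zeroProd S m z) (hE₁ z)
  have hlF : logDeriv F z = logDeriv (reflProd R S m) z + logDeriv E₁ z :=
    logDeriv_mul z (reflProd_ne_zero hR0 hSR (by linarith)) hE₁z (differentiable_reflProd R S m z)
      (hE₁ z)
  have hPn : ‖logDeriv (zeroProd S m) z‖ ≤ M * (2 * (M + 1)) := by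
    rw [hlP]
    refine (norm_sum_le _ _).trans ?_
    rw [hM, Finset.sum_mul, ← hM]
    refine Finset.sum_le_sum fun a ha => ?_
    rw [norm_mul, Complex.norm_natCast, norm_div, norm_one]
    gcongr
    rw [div_le_iff₀ (norm_pos_iff.2 (hza0 a ha))]
    have h1 := hza a ha
    rw [div_le_iff₀ (by positivity)] at h1
    linarith
  have hQn : ‖logDeriv (reflProd R S m) z‖ ≤ M * 1 := by
    rw [hlQ]
    refine (norm_sum_le _ _).trans ?_
    rw [hM, Finset.sum_mul]
    refine Finset.sum_le_sum fun a ha => ?_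
    rw [norm_mul, Complex.norm_natCast, norm_div, norm_neg, RCLike.norm_conj]
    gcongr
    have h1 := norm_mul_sub_le (z := z) (hSR a ha).le
    rw [div_le_one (norm_pos_iff.2 (sq_sub_conj_mul_ne_zero (hSR a ha) (by linarith)))]
    have h2 := hSR a ha
    have h3 : R * ‖z‖ ≤ R * (R / 4) := by gcongr
    nlinarith
  have hfin : ‖logDeriv E z‖ ≤ 514 * D * r ^ 2 + M * (2 * (M + 1)) + M * 1 := by
    rw [show logDeriv E z = logDeriv F z + logDeriv (zeroProd S m) z -
      logDeriv (reflProd R S m) z by rw [hlE, hlF]; ring]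
    refine (norm_sub_le _ _).trans ?_
    have := norm_add_le (logDeriv F z) (logDeriv (zeroProd S m) z)
    linarith
  rw [← div_le_iff₀ (norm_pos_iff.2 hEz), ← norm_div, ← logDeriv_apply]
  refine hfin.trans ?_
  have hr4 : r ^ 2 ≤ r ^ 4 := pow_le_pow_right₀ hr (by norm_num)
  have hMM : M * M ≤ (2050 * D * r ^ 2) * (2050 * D * r ^ 2) := by gcongr
  have e1 : D * r ^ 2 ≤ D * r ^ 4 := by gcongr
  calc 514 * D * r ^ 2 + M * (2 * (M + 1)) + M * 1
      ≤ (514 * D + 2 * (2050 * D) ^ 2 + 3 * (2050 * D)) * r ^ 4 := by nlinarith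
    _ ≤ _ := by gcongr

theorem eq_const_or_tendsto_of_iteratedDeriv_eq_zero {H : ℂ → ℂ} (hH : Differentiable ℂ H) {d : ℕ}
    (hder : ∀ m, d < m → iteratedDeriv m H 0 = 0) :
    (∃ c, ∀ z, H z = c) ∨ Tendsto (fun z => ‖H z‖) (Bornology.cobounded ℂ) atTop := by
  set p : Polynomial ℂ := ∑ i ∈ Finset.range (d + 1),
    Polynomial.C ((i.factorial : ℂ)⁻¹ * iteratedDeriv i H 0) * Polynomial.X ^ i with hp
  have hev : ∀ z, H z = p.eval z := fun z => by
    have h1 := Complex.hasSum_taylorSeries_of_entire hH 0 z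
    have h2 := hasSum_sum_of_ne_finset_zero (s := Finset.range (d + 1)) (L := SummationFilter.unconditional ℕ)
      (f := fun n => ((n.factorial : ℂ)⁻¹ • (z - 0) ^ n • iteratedDeriv n H 0)) fun m hm => by
        rw [hder m (by simpa using hm)]
        simp
    rw [h1.unique h2, hp, Polynomial.eval_finsetSum]
    refine Finset.sum_congr rfl fun i _ => ?_
    simp only [smul_eq_mul, sub_zero, Polynomial.eval_mul, Polynomial.eval_C, Polynomial.eval_pow,
      Polynomial.eval_X]
    ring
  rcases lt_or_ge 0 p.degree with hdeg | hdeg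
  · right
    have := Polynomial.tendsto_norm_atTop p hdeg (tendsto_norm_cobounded_atTop (E := ℂ))
    simpa [hev] using this
  · left
    refine ⟨p.coeff 0, fun z => ?_⟩
    rw [hev, Polynomial.eq_C_of_degree_le_zero hdeg]
    simp

/-- An entire function of polynomial growth on large circles is constant or proper. -/
theorem eq_const_or_tendsto_of_circles {H : ℂ → ℂ} (hH : Differentiable ℂ H) {d : ℕ} {C : ℝ}
    (h : ∀ r ≥ (1 : ℝ), ∃ t ≥ r, ∀ z ∈ Metric.sphere (0 : ℂ) t, ‖H z‖ ≤ C * t ^ d) :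
    (∃ c, ∀ z, H z = c) ∨ Tendsto (fun z => ‖H z‖) (Bornology.cobounded ℂ) atTop := by
  have hC : 0 ≤ C := by
    obtain ⟨t, ht, h1⟩ := h 1 le_rfl
    have h2 := (norm_nonneg _).trans (h1 (t : ℂ) (by
      rw [mem_sphere_zero_iff_norm, Complex.norm_real, Real.norm_of_nonneg (by linarith)]))
    exact nonneg_of_mul_nonneg_left h2 (by have : 0 < t := by linarith
                                           positivity)
  refine eq_const_or_tendsto_of_iteratedDeriv_eq_zero hH (d := d) fun m hm => ?_
  have hlim : Tendsto (fun r : ℝ => m.factorial * C / r) atTop (𝓝 0) :=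
    tendsto_const_nhds.div_atTop tendsto_id
  rw [← norm_le_zero_iff]
  refine ge_of_tendsto hlim ?_
  filter_upwards [eventually_ge_atTop 1] with r hr
  obtain ⟨t, ht, h1⟩ := h r hr
  have ht0 : 0 < t := by linarith
  have h2 := Complex.norm_iteratedDeriv_le_of_forall_mem_sphere_norm_le m ht0 hH.diffContOnCl h1
  refine h2.trans ?_
  rw [div_le_div_iff₀ (by positivity) (by linarith)]
  have h3 : t ^ d * r ≤ t ^ m := by
    calc t ^ d * r ≤ t ^ d * t := by gcongr
      _ = t ^ (d + 1) := by ring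
      _ ≤ t ^ m := pow_le_pow_right₀ (by linarith) hm
  calc m.factorial * (C * t ^ d) * r = m.factorial * C * (t ^ d * r) := by ring
    _ ≤ m.factorial * C * t ^ m := by gcongr

theorem IsAux.exists_circle {n k : ℕ} {g E H : ℂ → ℂ} {C K : ℝ} (h : IsLimitFun n k C g)
    (hn : 1 ≤ n) (hA : IsAux n k g E H K) (h0 : AnalyticAt ℂ g 0) :
    ∃ B ≥ 0, ∀ r ≥ (1 : ℝ), ∃ t ≥ r, ∀ z ∈ Metric.sphere (0 : ℂ) t,
      AnalyticAt ℂ g z ∧ ‖H z * g z‖ ≤ B * t ^ 4 := by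
  obtain ⟨A, hA0, hA1⟩ := hA.exists_circleAverage_posLog_le h hn h0
  obtain ⟨B, hB0, hB⟩ := exists_circle_norm_deriv_le hA.diffE (hA.ne_zero h0) hA0 hA1
  refine ⟨B, hB0, fun r hr => ?_⟩
  obtain ⟨t, ht, h1⟩ := hB r hr
  refine ⟨t, ht, fun z hz => ?_⟩
  obtain ⟨h2, h3⟩ := h1 z hz
  have h4 : AnalyticAt ℂ g z := by
    by_contra h5
    exact h2 (hA.eq_zero z h5)
  refine ⟨h4, ?_⟩
  rw [hA.deriv_eq z h4, norm_mul, show -H z * g z = -(H z * g z) by ring, norm_neg] at h3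
  exact le_of_mul_le_mul_right h3 (norm_pos_iff.2 h2)

theorem IsAux.eq_const_or_tendsto {n k : ℕ} {g E H : ℂ → ℂ} {C K : ℝ} (h : IsLimitFun n k C g)
    (hn : 1 ≤ n) (hA : IsAux n k g E H K) (h0 : AnalyticAt ℂ g 0) :
    (∃ c, ∀ z, H z = c) ∨ Tendsto (fun z => ‖H z‖) (Bornology.cobounded ℂ) atTop := by
  obtain ⟨B, hB0, hB⟩ := hA.exists_circle h hn h0
  refine eq_const_or_tendsto_of_circles hA.diffH (d := 4) (C := B + K) fun r hr => ?_
  obtain ⟨t, ht, h1⟩ := hB r hr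
  refine ⟨t, ht, fun z hz => ?_⟩
  obtain ⟨h2, h3⟩ := h1 z hz
  have hK := hA.pos
  have ht1 : 1 ≤ t ^ 4 := one_le_pow₀ (by linarith)
  rcases le_or_gt ‖g z‖ 1 with hg | hg
  · have := hA.norm_H_le z h2 hg
    nlinarith
  · rw [norm_mul] at h3
    have := norm_nonneg (H z)
    nlinarith

theorem IsAux.eq_const_of_forall_eq {n k : ℕ} {g E H : ℂ → ℂ} {C K : ℝ} (h : IsLimitFun n k C g)
    (hkn : k < n) (hA : IsAux n k g E H K) (hE : ∀ z, E z = E 0) (z : ℂ) : g z = g 0 := by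
  have hE0 : E 0 ≠ 0 := by
    obtain ⟨w, hw⟩ := (eventually_analyticAt_of_or (h.sph 0).analyticAt_or).exists
    rw [← hE w]
    exact hA.ne_zero hw
  have han : ∀ z, AnalyticAt ℂ g z := fun z => hA.ne_zero_iff.1 (by rw [hE]; exact hE0)
  refine eq_const_of_norm_iteratedDeriv_pow_le (fun z => (han z).differentiableAt) hkn
    (M := ‖(E 0)⁻¹ + 1‖) (fun w => ?_) z
  have := hA.mul_eq w (han w)
  rw [hE] at this
  rw [show iteratedDeriv k (g ^ n) w = (E 0)⁻¹ + 1 by field_simp; linear_combination this]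

theorem eventually_eventually_nhds_of_cobounded {P : ℂ → Prop}
    (h : ∀ᶠ z in Bornology.cobounded ℂ, P z) :
    ∀ᶠ z in Bornology.cobounded ℂ, ∀ᶠ w in 𝓝 z, P w := by
  rw [← comap_norm_atTop, Filter.eventually_comap, Filter.eventually_atTop] at h
  obtain ⟨r, hr⟩ := h
  rw [← comap_norm_atTop, Filter.eventually_comap, Filter.eventually_atTop]
  refine ⟨r + 1, fun b hb z hz => ?_⟩
  have : ∀ᶠ w in 𝓝 z, r < ‖w‖ := continuousAt_id.norm.eventually_const_lt (by
    simp only [id]; linarith)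
  filter_upwards [this] with w hw using hr _ hw.le w rfl

/-- Derivatives of a function which is meromorphic at infinity. -/
theorem iteratedDeriv_zpow_mul_comp_inv {F φ : ℂ → ℂ} {p : ℤ} (hφ : AnalyticAt ℂ φ 0)
    (hF : ∀ᶠ z in Bornology.cobounded ℂ, F z = z ^ p * φ z⁻¹) (i : ℕ) :
    ∃ Ψ : ℂ → ℂ, AnalyticAt ℂ Ψ 0 ∧ Ψ 0 = (∏ j ∈ Finset.range i, ((p : ℂ) - j)) * φ 0 ∧
      ∀ᶠ z in Bornology.cobounded ℂ, iteratedDeriv i F z = z ^ (p - i) * Ψ z⁻¹ := by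
  induction i with
  | zero => exact ⟨φ, hφ, by simp, by simpa using hF⟩
  | succ i ih =>
    obtain ⟨Ψ, h1, h2, h3⟩ := ih
    refine ⟨fun ζ => ((p : ℂ) - i) * Ψ ζ - ζ * deriv Ψ ζ,
      (analyticAt_const.mul h1).sub (analyticAt_id.mul h1.deriv), ?_, ?_⟩
    · simp only [h2, Finset.prod_range_succ]
      ring
    · have h4 : ∀ᶠ z in Bornology.cobounded ℂ, AnalyticAt ℂ Ψ z⁻¹ :=
        (tendsto_inv₀_cobounded (α := ℂ)).eventually h1.eventually_analyticAt
      filter_upwards [eventually_eventually_nhds_of_cobounded h3, h4,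
        (Bornology.eventually_ne_cobounded (0 : ℂ))] with z hz hz1 hz0
      have h5 : HasDerivAt (fun w : ℂ => w ^ (p - i) * Ψ w⁻¹) _ z :=
        (hasDerivAt_zpow (p - i) z (Or.inl hz0)).mul
          (HasDerivAt.comp z hz1.differentiableAt.hasDerivAt (hasDerivAt_inv hz0))
      rw [iteratedDeriv_succ, Filter.EventuallyEq.deriv_eq hz, h5.deriv]
      have e1 : z ^ (p - i) = z * z ^ (p - i - 1) := by
        rw [← zpow_one_add₀ hz0]; ring_nf
      rw [e1, show p - ((i + 1 : ℕ) : ℤ) = p - i - 1 by push_cast; ring]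
      push_cast
      field_simp
      ring

/-- A function with bounded values near infinity has a limit there. -/
theorem exists_analyticAt_comp_inv {u : ℂ → ℂ}
    (hu : ∀ᶠ z in Bornology.cobounded ℂ, AnalyticAt ℂ u z ∧ ‖u z‖ ≤ 1) :
    ∃ v : ℂ → ℂ, AnalyticAt ℂ v 0 ∧ ∀ᶠ z in Bornology.cobounded ℂ, u z = v z⁻¹ := by
  rw [← comap_norm_atTop, Filter.eventually_comap, Filter.eventually_atTop] at hu
  obtain ⟨r, hr⟩ := hu
  set s := max r 1 with hs
  have hs0 : 0 < s := lt_max_of_lt_right one_pos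
  set b := Metric.ball (0 : ℂ) s⁻¹ with hb
  have hbn : b ∈ 𝓝 (0 : ℂ) := Metric.ball_mem_nhds _ (by positivity)
  have hmem : ∀ ζ ∈ b \ {0}, ζ ≠ 0 ∧ AnalyticAt ℂ u ζ⁻¹ ∧ ‖u ζ⁻¹‖ ≤ 1 := fun ζ hζ => by
    have h0 : ζ ≠ 0 := hζ.2
    have h1 : ‖ζ‖ < s⁻¹ := by simpa [hb] using hζ.1
    have h2 : s < ‖ζ⁻¹‖ := by
      rw [norm_inv]
      exact (lt_inv_comm₀ (norm_pos_iff.2 h0) hs0).1 h1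
    exact ⟨h0, hr _ ((le_max_left _ _).trans h2.le) _ rfl⟩
  have hd : DifferentiableOn ℂ (fun ζ => u ζ⁻¹) (b \ {0}) := fun ζ hζ =>
    (DifferentiableAt.comp ζ (hmem ζ hζ).2.1.differentiableAt
      (hasDerivAt_inv (hmem ζ hζ).1).differentiableAt).differentiableWithinAt
  have hbd : BddAbove (norm ∘ (fun ζ => u ζ⁻¹) '' (b \ {0})) :=
    ⟨1, by rintro _ ⟨ζ, hζ, rfl⟩; exact (hmem ζ hζ).2.2⟩
  have := Complex.differentiableOn_update_limUnder_of_bddAbove hbn hd hbd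
  refine ⟨_, this.analyticAt hbn, ?_⟩
  filter_upwards [Bornology.eventually_ne_cobounded (0 : ℂ)] with z hz
  rw [Function.update_of_ne (inv_ne_zero hz), inv_inv]

/-- A limit function which is large near infinity is constant. -/
theorem IsLimitFun.eq_const_of_one_lt {n k : ℕ} {g : ℂ → ℂ} {C : ℝ} (h : IsLimitFun n k C g)
    (hk : 1 ≤ k) (hkn : k + 2 ≤ n)
    (hg : ∀ᶠ z in Bornology.cobounded ℂ, AnalyticAt ℂ g z → 1 < ‖g z‖) (z : ℂ) : g z = g 0 := by
  obtain ⟨E, H, K, hA⟩ := h.exists_isAux hk hkn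
  have hu : ∀ᶠ z in Bornology.cobounded ℂ, AnalyticAt ℂ g⁻¹ z ∧ ‖g⁻¹ z‖ ≤ 1 := by
    filter_upwards [hg] with z hz
    exact analyticAt_inv_of_one_lt (h.sph z).analyticAt_or fun h' => (hz h'.1).not_ge h'.2
  obtain ⟨v, hv, huv⟩ := exists_analyticAt_comp_inv hu
  have hv0 : ¬ ∀ᶠ ζ in 𝓝 (0 : ℂ), v ζ = 0 := fun h0 => by
    have h1 : ∀ᶠ z in Bornology.cobounded ℂ, g z = 0 := by
      filter_upwards [huv, (tendsto_inv₀_cobounded (α := ℂ)).eventually h0] with z h2 h3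
      rw [h3] at h2
      simpa using h2
    obtain ⟨w, hw, hw'⟩ := ((eventually_eventually_nhds_of_cobounded h1).and hg).exists
    have h2 : AnalyticAt ℂ g w := analyticAt_const.congr (Filter.EventuallyEq.symm hw)
    have h3 := hw' h2
    rw [hw.self_of_nhds, norm_zero] at h3
    linarith
  obtain ⟨m, v₁, hv₁, hv₁0, hvv₁⟩ := hv.exists_eventuallyEq_pow_smul_nonzero_iff.2 hv0
  set φ : ℂ → ℂ := fun ζ => (v₁ ζ)⁻¹ ^ n with hφ
  have hφan : AnalyticAt ℂ φ 0 := (hv₁.inv hv₁0).pow n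
  have hF : ∀ᶠ z in Bornology.cobounded ℂ, (g ^ n) z = z ^ ((m * n : ℕ) : ℤ) * φ z⁻¹ := by
    filter_upwards [huv, (tendsto_inv₀_cobounded (α := ℂ)).eventually hvv₁] with z h1 h2
    rw [h2, sub_zero, Pi.inv_apply, smul_eq_mul] at h1
    rw [Pi.pow_apply, ← inv_inv (g z), h1, hφ, zpow_natCast, pow_mul, ← mul_pow, mul_inv, inv_pow,
      inv_inv]
  obtain ⟨Ψ, hΨ, hΨ0, hG⟩ := iteratedDeriv_zpow_mul_comp_inv hφan hF k
  have hΨt : Tendsto (fun z : ℂ => Ψ z⁻¹) (Bornology.cobounded ℂ) (𝓝 (Ψ 0)) :=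
    hΨ.continuousAt.tendsto.comp tendsto_inv₀_cobounded
  have hlarge : ∀ᶠ z in Bornology.cobounded ℂ, 1 / 2 ≤ ‖iteratedDeriv k (g ^ n) z - 1‖ := by
    rcases Nat.eq_zero_or_pos m with rfl | hm
    · have h1 : Tendsto (fun z : ℂ => (z⁻¹) ^ k * Ψ z⁻¹) (Bornology.cobounded ℂ)
          (𝓝 (0 ^ k * Ψ 0)) := (tendsto_inv₀_cobounded.pow k).mul hΨt
      rw [zero_pow (by omega), zero_mul] at h1
      have h2 := (h1.sub_const 1).norm
      rw [zero_sub, norm_neg, norm_one] at h2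
      filter_upwards [hG, h2.eventually_const_le (show (1 / 2 : ℝ) < 1 by norm_num)] with z h3 h4
      rw [h3]
      simpa using h4
    · have hmn : k + 1 ≤ m * n := by nlinarith
      have hΨ1 : Ψ 0 ≠ 0 := by
        rw [hΨ0]
        refine mul_ne_zero (Finset.prod_ne_zero_iff.2 fun j hj => ?_)
          (pow_ne_zero _ (inv_ne_zero hv₁0))
        rw [Finset.mem_range] at hj
        rw [sub_ne_zero]
        norm_cast
        omega
      have h1 : Tendsto (fun z : ℂ => ‖z‖ * ‖Ψ z⁻¹‖) (Bornology.cobounded ℂ) atTop :=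
        tendsto_norm_cobounded_atTop.atTop_mul_pos (norm_pos_iff.2 hΨ1) hΨt.norm
      filter_upwards [hG, h1.eventually_ge_atTop 2,
        tendsto_norm_cobounded_atTop.eventually_ge_atTop 1] with z h3 h4 h5
      have h6 : 2 ≤ ‖iteratedDeriv k (g ^ n) z‖ := by
        rw [h3, norm_mul, show ((m * n : ℕ) : ℤ) - k = ((m * n - k : ℕ) : ℤ) by omega,
          zpow_natCast, norm_pow]
        refine h4.trans ?_
        gcongr
        exact le_self_pow₀ h5 (by omega)
      have h7 := norm_sub_norm_le (iteratedDeriv k (g ^ n) z) 1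
      rw [norm_one] at h7
      linarith
  have hEb : ∀ᶠ z in Bornology.cobounded ℂ, ‖E z‖ ≤ 2 := by
    filter_upwards [hlarge] with z hz
    by_cases hz' : AnalyticAt ℂ g z
    · have h1 := congrArg norm (hA.mul_eq z hz')
      rw [norm_mul, norm_one] at h1
      have := norm_nonneg (E z)
      nlinarith
    · rw [hA.eq_zero z hz']
      simp
  have hbd : Bornology.IsBounded (range E) := by
    rw [← comap_norm_atTop, Filter.eventually_comap, Filter.eventually_atTop] at hEb
    obtain ⟨r, hr⟩ := hEb
    obtain ⟨M, hM⟩ := (isCompact_closedBall (0 : ℂ) r).exists_bound_of_continuousOn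
      hA.diffE.continuous.continuousOn
    refine (Metric.isBounded_closedBall (x := (0 : ℂ)) (r := max M 2)).subset ?_
    rintro _ ⟨z, rfl⟩
    rw [mem_closedBall_zero_iff]
    rcases le_total ‖z‖ r with h1 | h1
    · exact (hM z (by simpa using h1)).trans (le_max_left _ _)
    · exact (hr _ h1 z rfl).trans (le_max_right _ _)
  exact hA.eq_const_of_forall_eq h (by omega)
    (fun w => hA.diffE.apply_eq_apply_of_bounded hbd w 0) z

theorem eventually_iteratedDeriv_sub_mul_deriv {Ψ : ℂ → ℂ} {w : ℂ} (h : AnalyticAt ℂ Ψ w) (a : ℂ)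
    (s : ℕ) : ∀ᶠ z in 𝓝 w, iteratedDeriv s (fun z => a * Ψ z + (z - w) * deriv Ψ z) z =
      (a + s) * iteratedDeriv s Ψ z + (z - w) * iteratedDeriv (s + 1) Ψ z := by
  induction s with
  | zero => exact Eventually.of_forall fun z => by simp [iteratedDeriv_one]
  | succ s ih =>
    filter_upwards [ih.eventually_nhds, h.eventually_analyticAt] with z hz hz1
    have h1 : HasDerivAt (fun z => (a + s) * iteratedDeriv s Ψ z +
        (z - w) * iteratedDeriv (s + 1) Ψ z) _ z :=
      ((hz1.iteratedDeriv' s).differentiableAt.hasDerivAt.const_mul (a + s)).add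
        (((hasDerivAt_id z).sub_const w).mul
          (hz1.iteratedDeriv' (s + 1)).differentiableAt.hasDerivAt)
    rw [iteratedDeriv_succ, Filter.EventuallyEq.deriv_eq hz, h1.deriv, iteratedDeriv_succ (n := s + 1),
      iteratedDeriv_succ (n := s)]
    push_cast
    simp only [id]
    ring

/-- Taylor coefficients of the regular part of the derivatives of `(z - w) ^ p * f z`. -/
theorem exists_iteratedDeriv_zpow_mul {F f : ℂ → ℂ} {p : ℤ} {w : ℂ} (hf : AnalyticAt ℂ f w)
    (hF : ∀ᶠ z in 𝓝[≠] w, F z = (z - w) ^ p * f z) (i : ℕ) :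
    ∃ Ψ : ℂ → ℂ, AnalyticAt ℂ Ψ w ∧
      (∀ᶠ z in 𝓝[≠] w, iteratedDeriv i F z = (z - w) ^ (p - i) * Ψ z) ∧
      ∀ s : ℕ, iteratedDeriv s Ψ w =
        (∏ j ∈ Finset.range i, ((p : ℂ) + s - j)) * iteratedDeriv s f w := by
  induction i with
  | zero => exact ⟨f, hf, by simpa using hF, by simp⟩
  | succ i ih =>
    obtain ⟨Ψ, h1, h2, h3⟩ := ih
    refine ⟨fun z => ((p : ℂ) - i) * Ψ z + (z - w) * deriv Ψ z,
      (analyticAt_const.mul h1).add ((analyticAt_id.sub analyticAt_const).mul h1.deriv), ?_, ?_⟩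
    · filter_upwards [eventually_nhdsNE_eventually_nhds_iff.2 h2,
        h1.eventually_analyticAt.filter_mono nhdsWithin_le_nhds, self_mem_nhdsWithin]
        with z hz hz1 hz0
      have hz0 : z - w ≠ 0 := sub_ne_zero.2 hz0
      have h4 : HasDerivAt (fun z : ℂ => (z - w) ^ (p - i))
          (((p - i : ℤ) : ℂ) * (z - w) ^ (p - i - 1) * 1) z :=
        HasDerivAt.comp (h₂ := fun x : ℂ => x ^ (p - i)) z
          (hasDerivAt_zpow (p - i) (z - w) (Or.inl hz0)) ((hasDerivAt_id z).sub_const w)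
      have h5 := h4.fun_mul hz1.differentiableAt.hasDerivAt
      rw [iteratedDeriv_succ, Filter.EventuallyEq.deriv_eq hz, h5.deriv]
      have e1 : (z - w) ^ (p - i) = (z - w) * (z - w) ^ (p - i - 1) := by
        rw [← zpow_one_add₀ hz0]; ring_nf
      rw [e1, show p - ((i + 1 : ℕ) : ℤ) = p - i - 1 by push_cast; ring]
      push_cast
      ring
    · intro s
      rw [(eventually_iteratedDeriv_sub_mul_deriv h1 _ s).self_of_nhds, h3, Finset.prod_range_succ]
      ring

theorem AnalyticAt.eventually_deriv_mul {f g : ℂ → ℂ} {w : ℂ} (hf : AnalyticAt ℂ f w)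
    (hg : AnalyticAt ℂ g w) :
    ∀ᶠ z in 𝓝 w, deriv (fun z => f z * g z) z = deriv f z * g z + f z * deriv g z := by
  filter_upwards [hf.eventually_analyticAt, hg.eventually_analyticAt] with z h1 h2
  exact (h1.differentiableAt.hasDerivAt.mul h2.differentiableAt.hasDerivAt).deriv

theorem AnalyticAt.deriv_deriv_mul {f g : ℂ → ℂ} {w : ℂ} (hf : AnalyticAt ℂ f w)
    (hg : AnalyticAt ℂ g w) : deriv (deriv fun z => f z * g z) w =
      deriv (deriv f) w * g w + 2 * deriv f w * deriv g w + f w * deriv (deriv g) w := by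
  rw [Filter.EventuallyEq.deriv_eq (hf.eventually_deriv_mul hg)]
  have h := (hf.deriv.differentiableAt.hasDerivAt.mul hg.differentiableAt.hasDerivAt).add
    (hf.differentiableAt.hasDerivAt.mul hg.deriv.differentiableAt.hasDerivAt)
  refine h.deriv.trans ?_
  ring

theorem AnalyticAt.eventually_deriv_pow {f : ℂ → ℂ} {w : ℂ} (hf : AnalyticAt ℂ f w) (n : ℕ) :
    ∀ᶠ z in 𝓝 w, deriv (fun z => f z ^ n) z = n * f z ^ (n - 1) * deriv f z := by
  filter_upwards [hf.eventually_analyticAt] with z h1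
  exact (h1.differentiableAt.hasDerivAt.fun_pow n).deriv

theorem AnalyticAt.deriv_deriv_pow_of_deriv_eq_zero {f : ℂ → ℂ} {w : ℂ} (hf : AnalyticAt ℂ f w)
    (n : ℕ) (h0 : deriv f w = 0) :
    deriv (deriv fun z => f z ^ n) w = n * f w ^ (n - 1) * deriv (deriv f) w := by
  rw [Filter.EventuallyEq.deriv_eq (hf.eventually_deriv_pow n)]
  have h := (((hf.differentiableAt.hasDerivAt.fun_pow (n - 1)).const_mul (n : ℂ)).mul
    hf.deriv.differentiableAt.hasDerivAt)
  refine h.deriv.trans ?_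
  rw [h0]
  ring

theorem prod_range_neg_add_sub (n k s : ℕ) (hs : s < n) : ∃ q : ℕ, 0 < q ∧
    ∏ j ∈ Finset.range k, (((-n : ℤ) : ℂ) + s - j) = (-1) ^ k * q := by
  refine ⟨∏ j ∈ Finset.range k, (n + j - s), Finset.prod_pos fun j _ => by omega, ?_⟩
  rw [← Finset.card_range k, ← Finset.prod_const, Finset.card_range]
  push_cast
  rw [← Finset.prod_mul_distrib]
  refine Finset.prod_congr rfl fun j _ => ?_
  rw [Nat.cast_sub (by omega)]
  push_cast
  ring

/-- The leading coefficients at a simple pole of a solution of `G' = c g (G - 1)` with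
`G = (gⁿ)⁽ᵏ⁾`. -/
theorem simple_pole_coeff {g φ : ℂ → ℂ} {c w : ℂ} {n k : ℕ} (hn : 3 ≤ n)
    (hφ : AnalyticAt ℂ φ w) (hφ0 : φ w ≠ 0) (hg : ∀ᶠ z in 𝓝[≠] w, g z = (z - w)⁻¹ * φ z)
    (hG : ∀ᶠ z in 𝓝[≠] w, iteratedDeriv (k + 1) (g ^ n) z =
      c * g z * (iteratedDeriv k (g ^ n) z - 1)) :
    c * φ w = -((n + k : ℕ) : ℂ) ∧ deriv φ w = 0 ∧ deriv (deriv φ) w = 0 := by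
  have hF : ∀ᶠ z in 𝓝[≠] w, (g ^ n) z = (z - w) ^ (-n : ℤ) * (fun z => φ z ^ n) z := by
    filter_upwards [hg] with z hz
    simp only [Pi.pow_apply, hz, mul_pow, zpow_neg, zpow_natCast, inv_pow]
  have hφn : AnalyticAt ℂ (fun z => φ z ^ n) w := hφ.fun_pow n
  obtain ⟨Ψ, a1, a2, a3⟩ := exists_iteratedDeriv_zpow_mul hφn hF k
  obtain ⟨Θ, b1, b2, b3⟩ := exists_iteratedDeriv_zpow_mul hφn hF (k + 1)
  set q : ℂ → ℂ := fun z => (z - w) ^ (n + k) with hq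
  have hqa : AnalyticAt ℂ q w := (analyticAt_id.sub analyticAt_const).pow _
  have hq1 : deriv q = fun z => ((n + k : ℕ) : ℂ) * (z - w) ^ (n + k - 1) := funext fun z =>
    (((hasDerivAt_id z).sub_const w).fun_pow (n + k)).deriv.trans (by simp)
  have hq2 : deriv (deriv q) w = 0 := by
    rw [hq1]
    have := ((((hasDerivAt_id w).sub_const w).fun_pow (n + k - 1)).const_mul
      ((n + k : ℕ) : ℂ)).deriv
    refine this.trans ?_
    simp [show n + k - 1 - 1 ≠ 0 by omega]
  have hq1w : deriv q w = 0 := by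
    rw [hq1]
    simp [show n + k - 1 ≠ 0 by omega]
  have hq0 : q w = 0 := by
    simp only [hq, sub_self, zero_pow (show n + k ≠ 0 by omega)]
  have hXa : AnalyticAt ℂ (fun z => Ψ z - q z) w := a1.sub hqa
  have hX1 : ∀ᶠ z in 𝓝 w, deriv (fun z => Ψ z - q z) z = deriv Ψ z - deriv q z := by
    filter_upwards [a1.eventually_analyticAt, hqa.eventually_analyticAt] with z h1 h2
    exact (h1.differentiableAt.hasDerivAt.sub h2.differentiableAt.hasDerivAt).deriv
  have hX2 : deriv (deriv fun z => Ψ z - q z) w = deriv (deriv Ψ) w := by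
    rw [Filter.EventuallyEq.deriv_eq hX1]
    refine (a1.deriv.differentiableAt.hasDerivAt.sub
      hqa.deriv.differentiableAt.hasDerivAt).deriv.trans ?_
    rw [hq2, sub_zero]
  have hYa : AnalyticAt ℂ (fun z => c * φ z) w := analyticAt_const.mul hφ
  have hY1 : deriv (fun z => c * φ z) = fun z => c * deriv φ z := funext fun z =>
    deriv_const_mul_field c
  have hY2 : deriv (deriv fun z => c * φ z) w = c * deriv (deriv φ) w := by
    rw [hY1]
    exact deriv_const_mul_field c
  have key : ∀ᶠ z in 𝓝[≠] w, Θ z = (c * φ z) * (Ψ z - q z) := by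
    filter_upwards [hG, a2, b2, hg, self_mem_nhdsWithin] with z h1 h2 h3 h4 hz0
    have hz0 : z - w ≠ 0 := sub_ne_zero.2 hz0
    rw [h2, h3, h4] at h1
    rw [show (-n : ℤ) - k = -((n + k : ℕ) : ℤ) by push_cast; ring,
      show (-n : ℤ) - ((k + 1 : ℕ) : ℤ) = -((n + k + 1 : ℕ) : ℤ) by push_cast; ring, zpow_neg,
      zpow_neg, zpow_natCast, zpow_natCast, pow_succ] at h1
    simp only [hq]
    field_simp at h1
    linear_combination h1
  have key' : Θ =ᶠ[𝓝 w] fun z => (c * φ z) * (Ψ z - q z) :=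
    (b1.frequently_eq_iff_eventually_eq (hYa.mul hXa)).1 key.frequently
  have k0 := key'.self_of_nhds
  have k1 := key'.deriv_eq
  have k2 := key'.deriv.deriv_eq
  rw [(hYa.eventually_deriv_mul hXa).self_of_nhds, hX1.self_of_nhds, hY1, hq1w] at k1
  rw [hYa.deriv_deriv_mul hXa, hX2, hY2, hY1, hX1.self_of_nhds, hq1w] at k2
  dsimp only at k0 k1 k2
  have a30 := a3 0
  have a31 := a3 1
  have a32 := a3 2
  have b30 := b3 0
  have b31 := b3 1
  have b32 := b3 2
  simp only [iteratedDeriv_zero, iteratedDeriv_one, iteratedDeriv_succ (n := 1),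
    Finset.prod_range_succ _ k] at a30 a31 a32 b30 b31 b32
  obtain ⟨q0, hq0p, e0⟩ := prod_range_neg_add_sub n k 0 (by omega)
  obtain ⟨q1, hq1p, e1⟩ := prod_range_neg_add_sub n k 1 (by omega)
  obtain ⟨q2, hq2p, e2⟩ := prod_range_neg_add_sub n k 2 (by omega)
  rw [e0] at a30 b30
  rw [e1] at a31 b31
  rw [e2] at a32 b32
  have hs : ((-1 : ℂ)) ^ k ≠ 0 := pow_ne_zero _ (by norm_num)
  set σ : ℂ := (-1) ^ k
  have hp : φ w ^ n = φ w * φ w ^ (n - 1) := by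
    rw [← pow_succ', Nat.sub_add_cancel (by omega)]
  have hP : φ w ^ (n - 1) ≠ 0 := pow_ne_zero _ hφ0
  have hq0c : (q0 : ℂ) ≠ 0 := Nat.cast_ne_zero.2 hq0p.ne'
  have c0 : c * φ w = -((n + k : ℕ) : ℂ) := by
    rw [a30, b30, hq0, hp] at k0
    have : σ * q0 * (φ w * φ w ^ (n - 1)) * (c * φ w + ((n + k : ℕ) : ℂ)) = 0 := by
      push_cast at k0 ⊢
      linear_combination -k0
    rcases mul_eq_zero.1 this with h | h
    · exact absurd h (mul_ne_zero (mul_ne_zero hs hq0c) (mul_ne_zero hφ0 hP))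
    · linear_combination h
  have c1 : deriv φ w = 0 := by
    rw [(hφ.eventually_deriv_pow n).self_of_nhds] at a31 b31
    rw [a30, a31, b31, hq0, hp] at k1
    have : σ * φ w ^ (n - 1) * ((n * q1 + (n + k) * q0 : ℕ) : ℂ) * deriv φ w = 0 := by
      push_cast at k1 c0 ⊢
      linear_combination k1 + (σ * q0 * φ w ^ (n - 1) * deriv φ w +
        σ * q1 * n * φ w ^ (n - 1) * deriv φ w) * c0
    refine (mul_eq_zero.1 this).resolve_left (mul_ne_zero (mul_ne_zero hs hP)
      (Nat.cast_ne_zero.2 ?_))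
    positivity
  refine ⟨c0, c1, ?_⟩
  rw [hφ.deriv_deriv_pow_of_deriv_eq_zero n c1] at a32 b32
  rw [c1, a30, a32, b32, hq0, hp] at k2
  have : σ * φ w ^ (n - 1) * ((2 * n * q2 + (n + k) * q0 : ℕ) : ℂ) * deriv (deriv φ) w = 0 := by
    push_cast at k2 c0 ⊢
    linear_combination k2 + (σ * q0 * φ w ^ (n - 1) * deriv (deriv φ) w +
      σ * q2 * n * φ w ^ (n - 1) * deriv (deriv φ) w) * c0
  refine (mul_eq_zero.1 this).resolve_left (mul_ne_zero (mul_ne_zero hs hP)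
    (Nat.cast_ne_zero.2 ?_))
  positivity

theorem exists_eventually_eq_add_pow_three {φ : ℂ → ℂ} {w : ℂ} (hφ : AnalyticAt ℂ φ w)
    (h1 : deriv φ w = 0) (h2 : deriv (deriv φ) w = 0) :
    ∃ ψ : ℂ → ℂ, AnalyticAt ℂ ψ w ∧ ∀ᶠ z in 𝓝 w, φ z = φ w + (z - w) ^ 3 * ψ z := by
  have hf : AnalyticAt ℂ (fun z => φ z - φ w) w := hφ.sub analyticAt_const
  have h3 : ((3 : ℕ) : ℕ∞) ≤ analyticOrderAt (fun z => φ z - φ w) w := by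
    rw [natCast_le_analyticOrderAt_iff_iteratedDeriv_eq_zero hf]
    intro i hi
    interval_cases i
    · simp
    · simpa [iteratedDeriv_one] using h1
    · rw [iteratedDeriv_succ, iteratedDeriv_one]
      simpa using h2
  obtain ⟨ψ, hψ, h⟩ := (natCast_le_analyticOrderAt hf).1 h3
  refine ⟨ψ, hψ, h.mono fun z hz => ?_⟩
  rw [smul_eq_mul] at hz
  linear_combination hz

theorem IsAux.iteratedDeriv_succ_eq {n k : ℕ} {g E H : ℂ → ℂ} {K : ℝ} (hA : IsAux n k g E H K)
    {z : ℂ} (hz : AnalyticAt ℂ g z) : iteratedDeriv (k + 1) (g ^ n) z =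
      H z * g z * (iteratedDeriv k (g ^ n) z - 1) := by
  have h1 : (fun z => E z * (iteratedDeriv k (g ^ n) z - 1)) =ᶠ[𝓝 z] fun _ => 1 :=
    hz.eventually_analyticAt.mono fun w hw => hA.mul_eq w hw
  have h2 := h1.deriv_eq
  have h3 := (hA.diffE z).hasDerivAt.fun_mul
    (((hz.pow n).iteratedDeriv' k).differentiableAt.hasDerivAt.sub_const 1)
  rw [h3.deriv, deriv_const, hA.deriv_eq z hz, ← iteratedDeriv_succ] at h2
  refine mul_left_cancel₀ (hA.ne_zero hz) ?_
  linear_combination h2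

/-- If `H` is a nonzero constant then `g' - (c / (n + k)) g²` vanishes at all poles of `g`. -/
theorem IsAux.exists_riccati {n k : ℕ} {g E H : ℂ → ℂ} {K : ℝ} (hA : IsAux n k g E H K)
    (hn : 3 ≤ n) {c : ℂ} (hc : c ≠ 0) (hH : ∀ z, H z = c) {w : ℂ} (hw : ¬ AnalyticAt ℂ g w)
    (hg : ∀ᶠ z in 𝓝[≠] w, AnalyticAt ℂ g z) :
    ∃ X : ℂ → ℂ, AnalyticAt ℂ X w ∧ X w = 0 ∧
      ∀ᶠ z in 𝓝[≠] w, deriv g z - c / (n + k : ℕ) * g z ^ 2 = X z := by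
  obtain ⟨m, -, ho, -, hoH⟩ := hA.pole w hw
  have hm : m = 1 := by
    rw [show H = fun _ => c from funext hH, meromorphicOrderAt_const, if_neg hc] at hoH
    have : ((m : ℤ) - 1) = 0 := by exact_mod_cast hoH.symm
    omega
  subst hm
  have hmer : MeromorphicAt g w := by
    by_contra hcon
    rw [meromorphicOrderAt_of_not_meromorphicAt hcon] at ho
    exact absurd ho (by decide)
  obtain ⟨φ, hφ, hφ0, hφg⟩ := (meromorphicOrderAt_eq_int_iff hmer).1 ho
  have hg1 : ∀ᶠ z in 𝓝[≠] w, g z = (z - w)⁻¹ * φ z := by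
    filter_upwards [hφg] with z hz
    rw [hz, smul_eq_mul]
    simp
  obtain ⟨e0, e1, e2⟩ := simple_pole_coeff (k := k) (c := c) hn hφ hφ0 hg1
    (hg.mono fun z hz => by rw [← hH z]; exact hA.iteratedDeriv_succ_eq hz)
  obtain ⟨ψ, hψ, hφψ⟩ := exists_eventually_eq_add_pow_three hφ e1 e2
  have hζ : AnalyticAt ℂ (fun z => z - w) w := analyticAt_id.sub analyticAt_const
  refine ⟨fun z => 4 * (z - w) * ψ z + (z - w) ^ 2 * deriv ψ z + (z - w) ^ 4 * ψ z ^ 2 * (φ w)⁻¹,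
    ?_, by simp, ?_⟩
  · exact (((analyticAt_const.mul hζ).mul hψ).add ((hζ.pow 2).mul hψ.deriv)).add
      (((hζ.pow 4).mul (hψ.pow 2)).mul analyticAt_const)
  have hN : ((n + k : ℕ) : ℂ) ≠ 0 := Nat.cast_ne_zero.2 (by omega)
  have hcN : c / (n + k : ℕ) = - (φ w)⁻¹ := by
    field_simp
    linear_combination e0
  have hgψ : ∀ᶠ z in 𝓝[≠] w, g z = (z - w)⁻¹ * (φ w + (z - w) ^ 3 * ψ z) := by
    filter_upwards [hg1, hφψ.filter_mono nhdsWithin_le_nhds] with z h1 h2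
    rw [h1, h2]
  filter_upwards [eventually_nhdsNE_eventually_nhds_iff.2 hgψ,
    hψ.eventually_analyticAt.filter_mono nhdsWithin_le_nhds, self_mem_nhdsWithin]
    with z hz hz1 hz0
  have hz0 : z - w ≠ 0 := sub_ne_zero.2 hz0
  have hd := (((hasDerivAt_id z).sub_const w).fun_inv hz0).fun_mul
    (((((hasDerivAt_id z).sub_const w).fun_pow 3).fun_mul
      hz1.differentiableAt.hasDerivAt).const_add (φ w))
  simp only [id] at hd
  rw [Filter.EventuallyEq.deriv_eq hz, hd.deriv, hz.self_of_nhds, hcN]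
  field_simp
  ring

theorem IsLimitFun.eq_const_of_tendsto {n k : ℕ} {g X : ℂ → ℂ} {C M : ℝ} (h : IsLimitFun n k C g)
    (hk : 1 ≤ k) (hkn : k + 2 ≤ n)
    (hX : Tendsto (fun z => ‖X z‖) (Bornology.cobounded ℂ) atTop)
    (hM : ∀ z, AnalyticAt ℂ g z → ‖g z‖ ≤ 1 → ‖X z‖ ≤ M) (z : ℂ) : g z = g 0 := by
  refine h.eq_const_of_one_lt hk hkn ?_ z
  filter_upwards [hX.eventually_gt_atTop M] with z hz hz1
  by_contra! hlt
  exact absurd (hM z hz1 hlt) hz.not_ge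

/-- If `g' = b g²` with `b = c / N` and `E' = - c g E`, then the derivatives of `E` of order
exceeding `N` vanish. -/
theorem iteratedDeriv_eq_zero_of_riccati {g E : ℂ → ℂ} {b : ℂ} {N : ℕ} {U : Set ℂ} (hU : IsOpen U)
    (hg : ∀ z ∈ U, AnalyticAt ℂ g z) (hE : Differentiable ℂ E)
    (hric : ∀ z ∈ U, deriv g z = b * g z ^ 2)
    (hderiv : ∀ z ∈ U, deriv E z = -(b * N) * g z * E z) (m : ℕ) (hm : N < m) :
    ∀ z ∈ U, iteratedDeriv m E z = 0 := by
  have key : ∀ j : ℕ, ∃ a : ℂ, (N < j → a = 0) ∧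
      ∀ z ∈ U, iteratedDeriv j E z = a * (g z ^ j * E z) := by
    intro j
    induction j with
    | zero => exact ⟨1, by simp, by simp⟩
    | succ j ih =>
      obtain ⟨a, ha, h⟩ := ih
      refine ⟨a * (b * (j - N)), fun hj => ?_, fun z hz => ?_⟩
      · rcases (Nat.lt_succ_iff.1 hj).eq_or_lt with rfl | h1
        · simp
        · simp [ha h1]
      · have h1 : iteratedDeriv j E =ᶠ[𝓝 z] fun z => a * (g z ^ j * E z) :=
          Filter.Eventually.mono (hU.mem_nhds hz) h
        have h2 := ((((hg z hz).differentiableAt.hasDerivAt.fun_pow j).fun_mul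
          (hE z).hasDerivAt).const_mul a)
        rw [iteratedDeriv_succ, h1.deriv_eq, h2.deriv, hric z hz, hderiv z hz]
        rcases j with _ | j
        · simp
          ring
        · push_cast
          ring
  obtain ⟨a, ha, h⟩ := key m
  intro z hz
  rw [h z hz, ha hm, zero_mul]

theorem differentiable_of_pole_extension {g X : ℂ → ℂ}
    (hX : ∀ z, AnalyticAt ℂ g z → AnalyticAt ℂ X z)
    (hX' : ∀ w, ¬ AnalyticAt ℂ g w → (∀ᶠ z in 𝓝[≠] w, AnalyticAt ℂ g z) ∧
      ∃ Y : ℂ → ℂ, AnalyticAt ℂ Y w ∧ Y w = 0 ∧ ∀ᶠ z in 𝓝[≠] w, X z = Y z) :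
    Differentiable ℂ fun z => if AnalyticAt ℂ g z then X z else 0 := by
  intro w
  by_cases hw : AnalyticAt ℂ g w
  · refine ((hX w hw).congr ?_).differentiableAt
    filter_upwards [hw.eventually_analyticAt] with z hz
    rw [if_pos hz]
  · obtain ⟨hg, Y, hY, hY0, hXY⟩ := hX' w hw
    refine (hY.congr ?_).differentiableAt
    have h1 : ∀ᶠ z in 𝓝[≠] w, Y z = if AnalyticAt ℂ g z then X z else 0 := by
      filter_upwards [hg, hXY] with z h1 h2
      rw [if_pos h1, h2]
    rw [eventually_nhdsWithin_iff] at h1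
    filter_upwards [h1] with z hz
    by_cases hzw : z = w
    · rw [hzw, if_neg hw, hY0]
    · exact hz hzw

theorem IsLimitFun.eq_const_of_analyticAt {n k : ℕ} {g : ℂ → ℂ} {C : ℝ} (h : IsLimitFun n k C g)
    (hk : 1 ≤ k) (hkn : k + 2 ≤ n) (h0 : AnalyticAt ℂ g 0) (z : ℂ) : g z = g 0 := by
  obtain ⟨E, H, K, hA⟩ := h.exists_isAux hk hkn
  rcases hA.eq_const_or_tendsto h (by omega) h0 with ⟨c, hc⟩ | ht
  swap
  · exact h.eq_const_of_tendsto hk hkn ht hA.norm_H_le z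
  by_cases hc0 : c = 0
  · have hE : ∀ z, deriv E z = 0 := fun w => by
      by_cases hw : AnalyticAt ℂ g w
      · rw [hA.deriv_eq w hw, hc, hc0]; ring
      · obtain ⟨m, -, -, -, ho⟩ := hA.pole w hw
        rw [show H = fun _ => (0 : ℂ) from funext fun z => (hc z).trans hc0,
          meromorphicOrderAt_const, if_pos rfl] at ho
        exact absurd ho (WithTop.coe_ne_top).symm
    exact hA.eq_const_of_forall_eq h (by omega)
      (fun w => is_const_of_deriv_eq_zero hA.diffE hE w 0) z
  have hev : ∀ w, ∀ᶠ z in 𝓝[≠] w, AnalyticAt ℂ g z := fun w =>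
    eventually_analyticAt_of_or (h.sph w).analyticAt_or
  set b : ℂ := c / (n + k : ℕ) with hb
  set V : ℂ → ℂ := fun z => if AnalyticAt ℂ g z then deriv g z - b * g z ^ 2 else 0 with hV
  have hVd : Differentiable ℂ V := differentiable_of_pole_extension
    (fun w hw => hw.deriv.sub (analyticAt_const.mul (hw.pow 2)))
    (fun w hw => ⟨hev w, hA.exists_riccati (by omega) hc0 hc hw (hev w)⟩)
  have hVle : ∀ z, AnalyticAt ℂ g z → ‖V z‖ ≤ C * (1 + ‖g z‖ ^ 2) + ‖b‖ * ‖g z‖ ^ 2 := by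
    intro z hz
    simp only [hV, if_pos hz]
    refine (norm_sub_le _ _).trans ?_
    rw [norm_mul, norm_pow]
    exact add_le_add_left ((h.sph z).norm_deriv_le hz) _
  have hC : 0 ≤ C := (h.sph 0).nonneg
  obtain ⟨B, hB, hcirc⟩ := hA.exists_circle h (by omega) h0
  have hcpos : 0 < ‖c‖ := norm_pos_iff.2 hc0
  have hcirc' : ∀ r ≥ (1 : ℝ), ∃ t ≥ r, ∀ z ∈ Metric.sphere (0 : ℂ) t,
      AnalyticAt ℂ g z ∧ ‖g z‖ ≤ (B / ‖c‖) * t ^ 4 := fun r hr => by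
    obtain ⟨t, ht, h1⟩ := hcirc r hr
    refine ⟨t, ht, fun z hz => ⟨(h1 z hz).1, ?_⟩⟩
    have := (h1 z hz).2
    rw [hc, norm_mul] at this
    rw [div_mul_eq_mul_div, le_div_iff₀ hcpos]
    linarith
  have hVdich := eq_const_or_tendsto_of_circles hVd (d := 8)
    (C := C * (1 + (B / ‖c‖) ^ 2) + ‖b‖ * (B / ‖c‖) ^ 2) fun r hr => by
    obtain ⟨t, ht, h1⟩ := hcirc' r hr
    refine ⟨t, ht, fun z hz => (hVle z (h1 z hz).1).trans ?_⟩
    have h2 := pow_le_pow_left₀ (norm_nonneg _) (h1 z hz).2 2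
    have h3 : (1 : ℝ) ≤ t ^ 8 := one_le_pow₀ (hr.trans ht)
    have e : (C * (1 + (B / ‖c‖) ^ 2) + ‖b‖ * (B / ‖c‖) ^ 2) * t ^ 8 =
      C * (t ^ 8 + (B / ‖c‖ * t ^ 4) ^ 2) + ‖b‖ * (B / ‖c‖ * t ^ 4) ^ 2 := by ring
    rw [e]
    gcongr
  rcases hVdich with ⟨v, hv⟩ | ht
  swap
  · refine h.eq_const_of_tendsto hk hkn ht (M := C * (1 + 1) + ‖b‖ * 1) (fun z hz hz1 => ?_) z
    refine (hVle z hz).trans ?_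
    have : ‖g z‖ ^ 2 ≤ 1 := pow_le_one₀ (norm_nonneg _) hz1
    gcongr
  by_cases hp : ∀ z, AnalyticAt ℂ g z
  · rcases eq_const_or_tendsto_of_circles (fun z => (hp z).differentiableAt) (d := 4)
      (C := B / ‖c‖) (fun r hr => by
        obtain ⟨t, ht, h1⟩ := hcirc' r hr
        exact ⟨t, ht, fun z hz => (h1 z hz).2⟩) with ⟨a, ha⟩ | ht
    · rw [ha, ha]
    · exact h.eq_const_of_tendsto hk hkn ht (fun z _ hz1 => hz1) z
  push Not at hp
  obtain ⟨w, hw⟩ := hp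
  have hv0 : v = 0 := by rw [← hv w]; simp [hV, hw]
  have hder : ∀ m, n + k < m → iteratedDeriv m E 0 = 0 := fun m hm => by
    refine iteratedDeriv_eq_zero_of_riccati (U := {z | AnalyticAt ℂ g z}) (b := b)
      (isOpen_analyticAt ℂ g) (fun z hz => hz) hA.diffE (fun z hz => ?_) (fun z hz => ?_) m hm 0 h0
    · have h1 := hv z
      simp only [hV] at h1
      have hz : AnalyticAt ℂ g z := hz
      rw [if_pos hz, hv0] at h1
      linear_combination h1
    · have hN : ((n + k : ℕ) : ℂ) ≠ 0 := Nat.cast_ne_zero.2 (by omega)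
      rw [hA.deriv_eq z hz, hc, hb, div_mul_cancel₀ _ hN]
  rcases eq_const_or_tendsto_of_iteratedDeriv_eq_zero hA.diffE hder with ⟨e, he⟩ | ht
  · exact hA.eq_const_of_forall_eq h (by omega) (fun w => by rw [he, he]) z
  · exact h.eq_const_of_tendsto hk hkn ht hA.norm_E_le z

/-- Limit functions are constant. -/
theorem IsLimitFun.eq_const {n k : ℕ} {g : ℂ → ℂ} {C : ℝ} (h : IsLimitFun n k C g)
    (hk : 1 ≤ k) (hkn : k + 2 ≤ n) (z : ℂ) : g z = g 0 := by
  obtain ⟨p, hp⟩ := (eventually_analyticAt_of_or (h.sph 0).analyticAt_or).exists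
  have h1 := (h.comp_const_add p).eq_const_of_analyticAt hk hkn
    (by rw [analyticAt_comp_const_add_iff, add_zero]; exact hp)
  have h2 : ∀ w, g w = g p := fun w => by simpa using h1 (w - p)
  rw [h2, h2 0]

/-- The rescaled function `ρ ^ (-α) * f (z + ρ ζ)`. -/
def pangRescale (f : ℂ → ℂ) (α : ℝ) (z : ℂ) (ρ : ℝ) : ℂ → ℂ := fun ζ =>
  ((ρ ^ (-α) : ℝ) : ℂ) * f (z + ρ * ζ)

theorem SphDerivLE.pangRescale_four {f : ℂ → ℂ} {α : ℝ} {z ζ : ℂ} {ρ : ℝ} (hα : 0 < α) (hα1 : α < 1)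
    (hρ : 0 < ρ) (h : SphDerivLE (pangRescale f α (z + ρ * ζ) (ρ / 2)) 1 0) :
    SphDerivLE (pangRescale f α z ρ) 4 ζ := by
  have h1 : SphDerivLE (fun x => (((2 : ℝ) ^ (-α) : ℝ) : ℂ) *
      pangRescale f α (z + ρ * ζ) (ρ / 2) (-2 * ζ + (2 : ℝ) * x))
      (1 * 2 * max ((2 : ℝ) ^ (-α)) ((2 : ℝ) ^ (-α))⁻¹) ζ :=
    SphDerivLE.comp_affine (by positivity) (by norm_num) zero_le_one
      (by convert h using 1; push_cast; ring)
  have h2 : (fun x => (((2 : ℝ) ^ (-α) : ℝ) : ℂ) *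
      pangRescale f α (z + ρ * ζ) (ρ / 2) (-2 * ζ + (2 : ℝ) * x)) = pangRescale f α z ρ := by
    funext x
    simp only [pangRescale]
    rw [← mul_assoc, ← Complex.ofReal_mul, ← Real.mul_rpow (by norm_num) (by positivity),
      mul_div_cancel₀ _ (two_ne_zero)]
    congr 2
    push_cast
    ring
  rw [h2] at h1
  refine h1.mono ?_
  have h3 : max ((2 : ℝ) ^ (-α)) ((2 : ℝ) ^ (-α))⁻¹ ≤ 2 := by
    refine max_le ?_ ?_
    · exact (Real.rpow_le_rpow_of_exponent_le one_le_two (by linarith : -α ≤ 1)).trans_eq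
        (Real.rpow_one 2)
    · rw [Real.rpow_neg zero_le_two, inv_inv]
      exact (Real.rpow_le_rpow_of_exponent_le one_le_two hα1.le).trans_eq (Real.rpow_one 2)
  linarith

theorem SphDerivLE.of_pangRescale {f : ℂ → ℂ} {α : ℝ} {z : ℂ} {ρ : ℝ} (hα : 0 < α)
    (hρ : 0 < ρ) (hρ1 : ρ ≤ 1) (h : SphDerivLE (pangRescale f α z ρ) 1 0) :
    SphDerivLE f (ρ⁻¹ * ρ ^ (-α)) z := by
  have h1 : SphDerivLE (fun x => ((ρ ^ α : ℝ) : ℂ) *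
      pangRescale f α z ρ (-(ρ : ℂ)⁻¹ * z + (ρ⁻¹ : ℝ) * x)) (1 * ρ⁻¹ * max (ρ ^ α) (ρ ^ α)⁻¹) z :=
    SphDerivLE.comp_affine (by positivity) (by positivity) zero_le_one
      (by convert h using 1; push_cast; ring)
  have hρc : (ρ : ℂ) ≠ 0 := Complex.ofReal_ne_zero.2 hρ.ne'
  have h2 : (fun x => ((ρ ^ α : ℝ) : ℂ) *
      pangRescale f α z ρ (-(ρ : ℂ)⁻¹ * z + (ρ⁻¹ : ℝ) * x)) = f := by
    funext x
    simp only [pangRescale]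
    rw [← mul_assoc, ← Complex.ofReal_mul, ← Real.rpow_add hρ, add_neg_cancel, Real.rpow_zero,
      Complex.ofReal_one, one_mul]
    congr 1
    push_cast
    field_simp
    ring
  rw [h2] at h1
  refine h1.mono ?_
  rw [one_mul, Real.rpow_neg hρ.le]
  refine mul_le_mul_of_nonneg_left (max_le ?_ le_rfl) (by positivity)
  have := Real.rpow_le_one hρ.le hρ1 hα.le
  exact this.trans ((one_le_inv₀ (by positivity)).2 this)

theorem SphDerivLE.pangRescale {f : ℂ → ℂ} {α C : ℝ} {z : ℂ} {ρ : ℝ} (hα : 0 < α)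
    (hρ : 0 < ρ) (hρ1 : ρ ≤ 1) (hC : 0 ≤ C) (h : SphDerivLE f C z) :
    SphDerivLE (pangRescale f α z ρ) (C * ρ ^ (1 - α)) 0 := by
  have h1 : SphDerivLE (fun x => ((ρ ^ (-α) : ℝ) : ℂ) * f (z + ρ * x))
      (C * ρ * max (ρ ^ (-α)) (ρ ^ (-α))⁻¹) 0 :=
    SphDerivLE.comp_affine (by positivity) hρ.le hC (by simpa using h)
  refine h1.mono ?_
  rw [sub_eq_add_neg, Real.rpow_add hρ, Real.rpow_one, mul_assoc]
  refine mul_le_mul_of_nonneg_left ?_ hC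
  refine mul_le_mul_of_nonneg_left (max_le le_rfl ?_) hρ.le
  rw [Real.rpow_neg hρ.le, inv_inv]
  have := Real.rpow_le_one hρ.le hρ1 hα.le
  exact this.trans ((one_le_inv₀ (by positivity)).2 this)

/-- Point picking for the rescaled functions. -/
theorem exists_pangRescale_point {f : ℂ → ℂ} {α C R ρ₀ : ℝ} {z₀ : ℂ} (hα : 0 < α) (hα1 : α < 1)
    (hC : 0 ≤ C) (hR : 0 ≤ R) (hρ₀ : 0 < ρ₀) (hρ₀1 : ρ₀ ≤ 1)
    (hf : ∀ w ∈ Metric.closedBall z₀ (2 * R * ρ₀), SphDerivLE f C w)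
    (hbad : ¬ SphDerivLE (pangRescale f α z₀ ρ₀) 1 0) :
    ∃ z ρ, 0 < ρ ∧ ρ ≤ ρ₀ ∧ ‖z - z₀‖ ≤ 2 * R * ρ₀ ∧ ¬ SphDerivLE (pangRescale f α z ρ) 1 0 ∧
      ∀ ζ, ‖ζ‖ < R → SphDerivLE (pangRescale f α z ρ) 4 ζ := by
  set P : ℕ → Prop := fun m => ∃ z, ‖z - z₀‖ ≤ 2 * R * ρ₀ * (1 - (1 / 2) ^ m) ∧
    ¬ SphDerivLE (_root_.pangRescale f α z (ρ₀ * (1 / 2) ^ m)) 1 0 with hP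
  have hle : ∀ m : ℕ, 2 * R * ρ₀ * (1 - (1 / 2) ^ m) ≤ 2 * R * ρ₀ := fun m =>
    mul_le_of_le_one_right (by positivity) (by linarith [pow_pos (one_half_pos (α := ℝ)) m])
  have hρm : ∀ m : ℕ, ρ₀ * (1 / 2) ^ m ≤ ρ₀ := fun m =>
    mul_le_of_le_one_right hρ₀.le (pow_le_one₀ (by norm_num) (by norm_num))
  have hP0 : P 0 := ⟨z₀, by simp, by simpa using hbad⟩
  have hlim : Tendsto (fun m : ℕ => C * (ρ₀ * (1 / 2 : ℝ) ^ m) ^ (1 - α)) atTop (𝓝 0) := by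
    have h1 : Tendsto (fun m : ℕ => ρ₀ * (1 / 2 : ℝ) ^ m) atTop (𝓝 0) := by
      simpa using (tendsto_pow_atTop_nhds_zero_of_lt_one (r := (1 / 2 : ℝ)) (by norm_num)
        (by norm_num)).const_mul ρ₀
    have h2 := ((Real.continuousAt_rpow_const 0 (1 - α) (Or.inr (by linarith))).tendsto.comp
      h1).const_mul C
    rw [Real.zero_rpow (by linarith), mul_zero] at h2
    exact h2
  obtain ⟨M, hM⟩ := Filter.eventually_atTop.1 (hlim.eventually_le_const one_pos)
  have hPM : ∀ m, P m → m ≤ M := fun m ⟨z, hz, hzb⟩ => by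
    by_contra! hlt
    refine hzb ((SphDerivLE.pangRescale hα (by positivity) ((hρm m).trans hρ₀1) hC
      (hf z ?_)).mono (hM m hlt.le))
    rw [mem_closedBall_iff_norm]
    exact hz.trans (hle m)
  set m := Nat.findGreatest P M
  obtain ⟨z, hz, hzb⟩ : P m := Nat.findGreatest_spec (P := P) (Nat.zero_le M) hP0
  have hmax : ¬ P (m + 1) := fun h => by
    have := Nat.le_findGreatest (hPM _ h) h
    omega
  refine ⟨z, ρ₀ * (1 / 2) ^ m, by positivity, hρm m, hz.trans (hle m), hzb, fun ζ hζ => ?_⟩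
  refine SphDerivLE.pangRescale_four hα hα1 (by positivity) ?_
  by_contra hcon
  refine hmax ⟨z + (ρ₀ * (1 / 2) ^ m : ℝ) * ζ, ?_, ?_⟩
  · have h1 : ‖((ρ₀ * (1 / 2) ^ m : ℝ) : ℂ) * ζ‖ ≤ ρ₀ * (1 / 2) ^ m * R := by
      rw [norm_mul, Complex.norm_real, Real.norm_of_nonneg (by positivity)]
      gcongr
    rw [add_sub_right_comm]
    refine (norm_add_le _ _).trans ((add_le_add hz h1).trans_eq ?_)
    rw [pow_succ]
    ring
  · rw [pow_succ, ← mul_assoc, mul_one_div]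
    exact hcon

/-- Rescaled functions with normalized derivative at the origin do not exist on large discs. -/
theorem exists_sphDerivLE_one {n k : ℕ} (hk : 1 ≤ k) (hkn : k + 2 ≤ n) {g : ℕ → ℂ → ℂ}
    (hsph : ∀ (j : ℕ) ζ, ‖ζ‖ < j + 1 → SphDerivLE (g j) 4 ζ)
    (hne : ∀ (j : ℕ) ζ, ‖ζ‖ < j + 1 → AnalyticAt ℂ (g j) ζ → iteratedDeriv k (g j ^ n) ζ ≠ 1) :
    ∃ j, SphDerivLE (g j) 1 0 := by
  set l : Ultrafilter ℕ := hyperfilter ℕ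
  have hl : (l : Filter ℕ) ≤ atTop := by
    rw [← Nat.cofinite_eq_atTop]; exact hyperfilter_le_cofinite
  have hev : ∀ x : ℝ, ∀ᶠ j : ℕ in l, x ≤ j := fun x =>
    hl (tendsto_natCast_atTop_atTop.eventually_ge_atTop x)
  have hin : ∀ {j : ℕ} {z w : ℂ}, ‖z‖ ≤ j → w ∈ Metric.ball z 1 → ‖w‖ < j + 1 :=
    fun {j z w} h1 h2 => by
      have h3 := norm_le_norm_add_norm_sub' w z
      rw [mem_ball_iff_norm] at h2
      linarith
  have hfinal : ∀ {f : ℕ → ℂ → ℂ} {c : ℂ}, ConvNear l f (fun _ => c) 0 →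
      ∃ j, AnalyticAt ℂ (f j) 0 ∧ ‖deriv (f j) 0‖ ≤ 1 * (1 + ‖f j 0‖ ^ 2) := by
    intro f c hc
    have h1 := hc.deriv.tendsto.norm
    rw [deriv_const, norm_zero] at h1
    obtain ⟨r, hr, h2, -⟩ := hc
    obtain ⟨j, hj1, hj2⟩ := (h2.and (h1.eventually_le_const one_pos)).exists
    exact ⟨j, hj1 0 (Metric.mem_ball_self hr), hj2.trans (by nlinarith [sq_nonneg ‖f j 0‖])⟩
  rcases inftyNear_or_convNear (l := l) (g := g) isOpen_univ isPreconnected_univ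
    (fun z _ => ⟨1, one_pos, 4, by norm_num, (hev ‖z‖).mono fun j hj w hw =>
      hsph j w (hin hj hw)⟩) with h1 | h1
  · obtain ⟨r, hr, h2, h3⟩ := h1 0 (mem_univ 0)
    obtain ⟨j, hj⟩ := hfinal (f := fun j => (g j)⁻¹) (c := 0) ⟨r, hr, h2.mono fun j hj => hj.1, h3⟩
    exact ⟨j, Or.inr hj⟩
  · have hL : IsLimitFun n k 4 (filterLim l g) := isLimitFun_of_convSphNear hk (by omega)
      (fun z => h1 z (mem_univ z))
      (fun z => (hev ‖z‖).mono fun j hj => hsph j z (by linarith))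
      (fun z => ⟨1, one_pos, (hev ‖z‖).mono fun j hj w hw => hne j w (hin hj hw)⟩)
    have hc : filterLim l g = fun _ => filterLim l g 0 := funext (hL.eq_const hk hkn)
    rcases h1 0 (mem_univ 0) with h2 | ⟨h2, -⟩
    · rw [hc] at h2
      obtain ⟨j, hj⟩ := hfinal h2
      exact ⟨j, Or.inl hj⟩
    · rw [hc] at h2
      obtain ⟨j, hj⟩ := hfinal (c := (filterLim l g 0)⁻¹) h2
      exact ⟨j, Or.inr hj⟩

theorem exists_forall_sphDerivLE_of_isCompact {f : ℂ → ℂ} {S : Set ℂ} (hS : IsCompact S)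
    (h : ∀ z ∈ S, ∃ C, ∀ᶠ w in 𝓝 z, SphDerivLE f C w) :
    ∃ C ≥ 0, ∀ w ∈ S, SphDerivLE f C w := by
  refine hS.induction_on (p := fun T => ∃ C ≥ 0, ∀ w ∈ T, SphDerivLE f C w) ?_ ?_ ?_ ?_
  · exact ⟨0, le_rfl, by simp⟩
  · rintro s t hst ⟨C, hC, h1⟩
    exact ⟨C, hC, fun w hw => h1 w (hst hw)⟩
  · rintro s t ⟨C, hC, h1⟩ ⟨C', hC', h2⟩
    refine ⟨max C C', le_max_of_le_left hC, ?_⟩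
    rintro w (hw | hw)
    · exact (h1 w hw).mono (le_max_left _ _)
    · exact (h2 w hw).mono (le_max_right _ _)
  · intro z hz
    obtain ⟨C, hC⟩ := h z hz
    exact ⟨_, mem_nhdsWithin_of_mem_nhds hC, max C 0, le_max_right _ _, fun w hw =>
      SphDerivLE.mono hw (le_max_left _ _)⟩

/-- The locally uniform bound of the spherical derivative. -/
theorem exists_forall_sphDerivLE {n k : ℕ} (hk : 1 ≤ k) (hkn : k + 2 ≤ n) {D : Set ℂ}
    (hD : IsOpen D) {𝓖 : Set (ℂ → ℂ)}
    (hloc : ∀ f ∈ 𝓖, ∀ z ∈ D, ∃ C, ∀ᶠ w in 𝓝 z, SphDerivLE f C w)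
    (hne : ∀ f ∈ 𝓖, ∀ z ∈ D, AnalyticAt ℂ f z → iteratedDeriv k (f ^ n) z ≠ 1) {z : ℂ}
    (hz : z ∈ D) : ∃ r > 0, ∃ C ≥ 0, ∀ f ∈ 𝓖, ∀ w ∈ Metric.ball z r, SphDerivLE f C w := by
  obtain ⟨s, hs, hsD⟩ := Metric.isOpen_iff.1 hD z hz
  set r := min 1 (s / 4) with hr
  have hr0 : 0 < r := by positivity
  have hr1 : r ≤ 1 := min_le_left _ _
  have hrs : r ≤ s / 4 := min_le_right _ _
  by_contra! hcon
  set α : ℝ := (k : ℝ) / n with hα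
  have hn0 : (0 : ℝ) < n := Nat.cast_pos.2 (by omega)
  have hk0 : (0 : ℝ) < k := Nat.cast_pos.2 (by omega)
  have hα0 : 0 < α := by positivity
  have hα1 : α < 1 := by
    rw [hα, div_lt_one hn0]
    exact_mod_cast (by omega : k < n)
  set ρ : ℕ → ℝ := fun j => r / 2 / (j + 1) ^ 2 with hρ
  have hρ0 : ∀ j, 0 < ρ j := fun j => by positivity
  have hρr : ∀ j : ℕ, 2 * ((j : ℝ) + 1) * ρ j ≤ r := fun j => by
    have hj : (1 : ℝ) ≤ j + 1 := by linarith [Nat.cast_nonneg (α := ℝ) j]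
    have : 2 * ((j : ℝ) + 1) * ρ j = r / (j + 1) := by simp only [hρ]; field_simp
    rw [this]
    exact div_le_self hr0.le hj
  have hρ1 : ∀ j : ℕ, ρ j ≤ 1 := fun j => by
    have hj : (0 : ℝ) ≤ j := Nat.cast_nonneg j
    have := hρr j
    nlinarith [mul_nonneg hj (hρ0 j).le, hρ0 j]
  have hex : ∀ j : ℕ, ∃ f ∈ 𝓖, ∃ y t, 0 < t ∧ t ≤ ρ j ∧ ‖y - z‖ ≤ 2 * r ∧
      ¬ SphDerivLE (pangRescale f α y t) 1 0 ∧
      ∀ ζ, ‖ζ‖ < j + 1 → SphDerivLE (pangRescale f α y t) 4 ζ := by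
    intro j
    obtain ⟨f, hf, w, hw, hwb⟩ := hcon r hr0 ((ρ j)⁻¹ * ρ j ^ (-α))
      (mul_nonneg (inv_nonneg.2 (hρ0 j).le) (Real.rpow_nonneg (hρ0 j).le _))
    have hwn : ‖w - z‖ < r := mem_ball_iff_norm.1 hw
    obtain ⟨C, hC, hCf⟩ := exists_forall_sphDerivLE_of_isCompact
      (isCompact_closedBall w (2 * ((j : ℝ) + 1) * ρ j)) (f := f) (fun x hx => hloc f hf x (hsD (by
        rw [mem_closedBall_iff_norm] at hx
        rw [mem_ball_iff_norm]
        have := norm_sub_le_norm_sub_add_norm_sub x w z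
        linarith [hρr j])))
    obtain ⟨y, t, h1, h2, h3, h4, h5⟩ := exists_pangRescale_point hα0 hα1 hC
      (by positivity : (0 : ℝ) ≤ (j : ℝ) + 1) (hρ0 j) (hρ1 j) hCf
      (fun h => hwb (h.of_pangRescale hα0 (hρ0 j) (hρ1 j)))
    refine ⟨f, hf, y, t, h1, h2, ?_, h4, h5⟩
    have := norm_sub_le_norm_sub_add_norm_sub y w z
    linarith [hρr j]
  choose f hf y t ht htρ hy hbad hsph using hex
  obtain ⟨j, hj⟩ := exists_sphDerivLE_one hk hkn hsph (fun j ζ hζ ha => by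
    have e1 : (((t j ^ (-α) : ℝ) : ℂ)) ^ n * (t j : ℂ) ^ k = 1 := by
      rw [← Complex.ofReal_pow, ← Complex.ofReal_pow, ← Complex.ofReal_mul, ← Real.rpow_natCast,
        ← Real.rpow_mul (ht j).le, ← Real.rpow_natCast (t j) k, ← Real.rpow_add (ht j),
        show -α * n + k = 0 by rw [hα]; field_simp; ring, Real.rpow_zero, Complex.ofReal_one]
    have e2 : iteratedDeriv k (pangRescale (f j) α (y j) (t j) ^ n) ζ =
        iteratedDeriv k (f j ^ n) (y j + t j * ζ) := by
      have := iteratedDeriv_pow_comp_affine k n (f j) ((t j ^ (-α) : ℝ) : ℂ) (y j) (t j) ζ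
      rw [e1, one_mul] at this
      exact this
    rw [e2]
    refine hne _ (hf j) _ (hsD ?_) ?_
    · rw [mem_ball_iff_norm, add_sub_right_comm]
      refine (norm_add_le _ _).trans_lt ?_
      rw [norm_mul, Complex.norm_real, Real.norm_of_nonneg (ht j).le]
      have h1 : t j * ‖ζ‖ ≤ ρ j * (j + 1) := mul_le_mul (htρ j) hζ.le (norm_nonneg _) (hρ0 j).le
      linarith [hρr j, hy j]
    · have htc : (t j : ℂ) ≠ 0 := Complex.ofReal_ne_zero.2 (ht j).ne'
      have hac : ((t j ^ (-α) : ℝ) : ℂ) ≠ 0 :=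
        Complex.ofReal_ne_zero.2 (Real.rpow_pos_of_pos (ht j) _).ne'
      set A : ℂ → ℂ := fun x => (x - y j) / t j with hA
      have haff : AnalyticAt ℂ A (y j + t j * ζ) := by fun_prop
      have h1 : AnalyticAt ℂ (pangRescale (f j) α (y j) (t j))
          (A (y j + t j * ζ)) := by
        simp only [hA]
        convert ha using 1
        field_simp
        ring
      have h2 := (analyticAt_const (v := ((t j ^ (-α) : ℝ) : ℂ)⁻¹)).mul (h1.comp haff)
      refine h2.congr (Eventually.of_forall fun x => ?_)
      simp only [Pi.mul_apply, Function.comp_apply, pangRescale, hA]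
      rw [inv_mul_cancel_left₀ hac, mul_div_cancel₀ _ htc, add_sub_cancel])
  exact hbad j hj

/-- The point of the Riemann sphere with inverse `u`. -/
def sphereInv (u : ℂ) : OnePoint ℂ := if u = 0 then OnePoint.infty else ((u⁻¹ : ℂ) : OnePoint ℂ)

theorem sphDist_coe (z w : ℂ) : sphDist z w =
    ‖z - w‖ / (Real.sqrt (1 + ‖z‖ ^ 2) * Real.sqrt (1 + ‖w‖ ^ 2)) := rfl

theorem sphDist_coe_infty (z : ℂ) : sphDist z OnePoint.infty = 1 / Real.sqrt (1 + ‖z‖ ^ 2) := rfl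

theorem sphDist_infty_coe (z : ℂ) : sphDist OnePoint.infty z = 1 / Real.sqrt (1 + ‖z‖ ^ 2) := rfl

theorem sphDist_infty_infty : sphDist OnePoint.infty OnePoint.infty = 0 := rfl

theorem one_le_sqrt_one_add_norm_sq (z : ℂ) : 1 ≤ Real.sqrt (1 + ‖z‖ ^ 2) :=
  Real.one_le_sqrt.2 (by nlinarith [sq_nonneg ‖z‖])

theorem norm_le_sqrt_one_add_norm_sq (z : ℂ) : ‖z‖ ≤ Real.sqrt (1 + ‖z‖ ^ 2) :=
  Real.le_sqrt_of_sq_le (by linarith)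

theorem sphDist_coe_le (z w : ℂ) : sphDist z w ≤ ‖z - w‖ := by
  rw [sphDist_coe]
  refine div_le_self (norm_nonneg _) ?_
  nlinarith [one_le_sqrt_one_add_norm_sq z, one_le_sqrt_one_add_norm_sq w]

theorem sphDist_sphereInv_le (u v : ℂ) : sphDist (sphereInv u) (sphereInv v) ≤ ‖u - v‖ := by
  have key : ∀ u : ℂ, u ≠ 0 → 1 / Real.sqrt (1 + ‖u⁻¹‖ ^ 2) ≤ ‖u‖ := fun u hu => by
    rw [div_le_iff₀ (one_pos.trans_le (one_le_sqrt_one_add_norm_sq _))]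
    have h1 := mul_le_mul_of_nonneg_left (norm_le_sqrt_one_add_norm_sq u⁻¹) (norm_nonneg u)
    rwa [← norm_mul, mul_inv_cancel₀ hu, norm_one] at h1
  unfold sphereInv
  by_cases hu : u = 0 <;> by_cases hv : v = 0
  · rw [if_pos hu, if_pos hv, sphDist_infty_infty]
    exact norm_nonneg _
  · rw [if_pos hu, if_neg hv, hu, zero_sub, norm_neg, sphDist_infty_coe]
    exact key v hv
  · rw [if_neg hu, if_pos hv, hv, sub_zero, sphDist_coe_infty]
    exact key u hu
  · rw [if_neg hu, if_neg hv, sphDist_coe]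
    have e : ‖u⁻¹ - v⁻¹‖ = ‖u - v‖ * (‖u‖⁻¹ * ‖v‖⁻¹) := by
      rw [inv_sub_inv hu hv, norm_div, norm_mul, norm_sub_rev, div_eq_mul_inv, mul_inv]
    have h1 : (‖u‖⁻¹ * ‖v‖⁻¹) / (Real.sqrt (1 + ‖u⁻¹‖ ^ 2) * Real.sqrt (1 + ‖v⁻¹‖ ^ 2)) ≤ 1 := by
      refine div_le_one_of_le₀ ?_ (by positivity)
      rw [← norm_inv, ← norm_inv]
      exact mul_le_mul (norm_le_sqrt_one_add_norm_sq _) (norm_le_sqrt_one_add_norm_sq _)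
        (norm_nonneg _) (Real.sqrt_nonneg _)
    rw [e, mul_div_assoc]
    exact mul_le_of_le_one_right (norm_nonneg _) h1

theorem not_tendsto_norm_atTop_of_continuousAt {f : ℂ → ℂ} {z : ℂ} (h : ContinuousAt f z) :
    ¬ Tendsto (fun w => ‖f w‖) (𝓝[≠] z) atTop := fun ht =>
  not_tendsto_nhds_of_tendsto_atTop ht _ (h.norm.tendsto.mono_left nhdsWithin_le_nhds)

theorem toSphere_of_analyticAt {f : ℂ → ℂ} {z : ℂ} (h : AnalyticAt ℂ f z) :
    toSphere f z = (f z : OnePoint ℂ) :=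
  if_neg (not_tendsto_norm_atTop_of_continuousAt h.continuousAt)

theorem tendsto_norm_atTop_of_inv_eq_zero {f : ℂ → ℂ} {z : ℂ} (h : AnalyticAt ℂ f⁻¹ z)
    (h0 : f⁻¹ z = 0) (hne : ¬ ∀ᶠ w in 𝓝 z, f w = 0) :
    Tendsto (fun w => ‖f w‖) (𝓝[≠] z) atTop := by
  have h1 : ∀ᶠ w in 𝓝[≠] z, f⁻¹ w ≠ 0 := by
    refine h.eventually_eq_zero_or_eventually_ne_zero.resolve_left fun h2 => hne ?_
    exact h2.mono fun w hw => by simpa using hw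
  have h2 : Tendsto f⁻¹ (𝓝[≠] z) (𝓝[≠] 0) := by
    refine tendsto_nhdsWithin_iff.2 ⟨?_, h1⟩
    have := h.continuousAt.tendsto
    rw [h0] at this
    exact this.mono_left nhdsWithin_le_nhds
  simpa [Function.comp_def] using (tendsto_norm_inv_nhdsNE_zero_atTop (α := ℂ)).comp h2

theorem analyticAt_of_inv_ne_zero {f : ℂ → ℂ} {z : ℂ} (h : AnalyticAt ℂ f⁻¹ z)
    (h0 : f⁻¹ z ≠ 0) : AnalyticAt ℂ f z := by
  have := h.inv h0
  rwa [inv_inv] at this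

theorem toSphere_of_analyticAt_inv {f : ℂ → ℂ} {z : ℂ} (h : AnalyticAt ℂ f⁻¹ z)
    (hne : ¬ ∀ᶠ w in 𝓝 z, f w = 0) : toSphere f z = sphereInv (f⁻¹ z) := by
  unfold sphereInv
  by_cases h0 : f⁻¹ z = 0
  · rw [if_pos h0, toSphere, if_pos (tendsto_norm_atTop_of_inv_eq_zero h h0 hne)]
  · rw [if_neg h0, toSphere_of_analyticAt (analyticAt_of_inv_ne_zero h h0), Pi.inv_apply, inv_inv]

theorem MeromorphicNiceOn.analyticAt_or {f : ℂ → ℂ} {D : Set ℂ} (h : MeromorphicNiceOn f D) {z : ℂ}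
    (hz : z ∈ D) : AnalyticAt ℂ f z ∨ Tendsto (fun w => ‖f w‖) (𝓝[≠] z) atTop :=
  (h.2 z hz).imp_left (h.1 z hz).analyticAt

theorem nfExt_eventuallyEq {f : ℂ → ℂ} {z : ℂ} (h : AnalyticAt ℂ f z) : nfExt f =ᶠ[𝓝 z] f :=
  h.eventually_analyticAt.mono fun _ hw => nfExt_eq hw

theorem analyticAt_nfExt_inv {f : ℂ → ℂ} {z : ℂ} (h : MeromorphicAt f z)
    (ht : Tendsto (fun w => ‖f w‖) (𝓝[≠] z) atTop) : AnalyticAt ℂ (nfExt f)⁻¹ z := by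
  set T := toMeromorphicNFAt f z with hT
  have h0 : meromorphicOrderAt f z < 0 :=
    (tendsto_cobounded_iff_meromorphicOrderAt_neg h).1 (tendsto_norm_atTop_iff_cobounded.1 ht)
  have h1 : MeromorphicNFAt T⁻¹ z := (meromorphicNFAt_toMeromorphicNFAt (f := f) (x := z)).inv
  have h2 : 0 ≤ meromorphicOrderAt T⁻¹ z := by
    rw [meromorphicOrderAt_inv, hT, meromorphicOrderAt_congr h.eq_nhdsNE_toMeromorphicNFAt.symm]
    obtain ⟨m, hm⟩ := WithTop.ne_top_iff_exists.1 h0.ne_top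
    rw [← hm] at h0 ⊢
    rw [← WithTop.LinearOrderedAddCommGroup.coe_neg]
    have : m < 0 := by exact_mod_cast h0
    exact_mod_cast (by omega : 0 ≤ -m)
  have h3 : AnalyticAt ℂ T⁻¹ z := h1.meromorphicOrderAt_nonneg_iff_analyticAt.1 h2
  refine h3.congr (Filter.EventuallyEq.inv ?_)
  have h4 : T =ᶠ[𝓝[≠] z] nfExt f :=
    h.eq_nhdsNE_toMeromorphicNFAt.symm.trans (nfExt_eventuallyEq_nhdsNE h).symm
  exact (eventually_nhdsWithin_iff.1 h4).mono fun w hw => by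
    by_cases hwz : w = z
    · subst hwz; rfl
    · exact hw hwz

theorem MeromorphicNiceOn.analyticAt_of_nfExt {f : ℂ → ℂ} {D : Set ℂ} (h : MeromorphicNiceOn f D)
    {z : ℂ} (hz : z ∈ D) (ha : AnalyticAt ℂ (nfExt f) z) : AnalyticAt ℂ f z := by
  refine (h.analyticAt_or hz).resolve_right fun ht => ?_
  refine not_tendsto_norm_atTop_of_continuousAt ha.continuousAt (ht.congr' ?_)
  filter_upwards [nfExt_eventuallyEq_nhdsNE (h.1 z hz)] with w hw
  rw [hw]

theorem MeromorphicNiceOn.toSphere_nfExt {f : ℂ → ℂ} {D : Set ℂ} (h : MeromorphicNiceOn f D)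
    {z : ℂ} (hz : z ∈ D) : toSphere (nfExt f) z = toSphere f z := by
  rcases h.analyticAt_or hz with ha | ht
  · rw [toSphere_of_analyticAt ha, toSphere_of_analyticAt (ha.congr (nfExt_eventuallyEq ha).symm),
      nfExt_eq ha]
  · rw [toSphere, toSphere, if_pos ht, if_pos (ht.congr' ?_)]
    filter_upwards [nfExt_eventuallyEq_nhdsNE (h.1 z hz)] with w hw
    rw [hw]

theorem exists_eventually_sphDerivLE {g : ℂ → ℂ} {z : ℂ}
    (h : AnalyticAt ℂ g z ∨ AnalyticAt ℂ g⁻¹ z) : ∃ C, ∀ᶠ w in 𝓝 z, SphDerivLE g C w := by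
  have key : ∀ f : ℂ → ℂ, AnalyticAt ℂ f z → ∃ C, ∀ᶠ w in 𝓝 z,
      AnalyticAt ℂ f w ∧ ‖deriv f w‖ ≤ C * (1 + ‖f w‖ ^ 2) := fun f hf => by
    refine ⟨‖deriv f z‖ + 1, ?_⟩
    filter_upwards [hf.eventually_analyticAt, hf.deriv.continuousAt.norm.eventually_le_const
      (lt_add_one ‖deriv f z‖)] with w h1 h2
    refine ⟨h1, h2.trans ?_⟩
    exact le_mul_of_one_le_right (by positivity) (by nlinarith [sq_nonneg ‖f w‖])
  rcases h with h | h
  · obtain ⟨C, hC⟩ := key g h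
    exact ⟨C, hC.mono fun w hw => Or.inl hw⟩
  · obtain ⟨C, hC⟩ := key g⁻¹ h
    exact ⟨C, hC.mono fun w hw => Or.inr hw⟩

theorem MeromorphicNiceOn.analyticAt_nfExt_or {f : ℂ → ℂ} {D : Set ℂ} (h : MeromorphicNiceOn f D)
    {z : ℂ} (hz : z ∈ D) : AnalyticAt ℂ (nfExt f) z ∨ AnalyticAt ℂ (nfExt f)⁻¹ z :=
  (h.analyticAt_or hz).imp (fun ha => ha.congr (nfExt_eventuallyEq ha).symm)
    (analyticAt_nfExt_inv (h.1 z hz))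

theorem ConvNear.eventually_sphDist_lt {l : Filter ℕ} [l.NeBot] {g : ℕ → ℂ → ℂ} {h : ℂ → ℂ} {z : ℂ}
    (hc : ConvNear l g h z) : ∃ r > 0, ∀ ε > 0, ∀ᶠ j in l, ∀ w ∈ Metric.ball z r,
      sphDist (toSphere (g j) w) (toSphere h w) < ε := by
  obtain ⟨s, hs, hs'⟩ := Metric.eventually_nhds_iff_ball.1 hc.eventually
  obtain ⟨r, hr, h1, h2⟩ := hc
  refine ⟨min r s, lt_min hr hs, fun ε hε => ?_⟩
  filter_upwards [h1, Metric.tendstoUniformlyOn_iff.1 h2 ε hε] with j hj1 hj2 w hw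
  have hwr := Metric.ball_subset_ball (min_le_left r s) hw
  rw [toSphere_of_analyticAt (hj1 w hwr),
    toSphere_of_analyticAt (hs' w (Metric.ball_subset_ball (min_le_right r s) hw)).analyticAt]
  refine (sphDist_coe_le _ _).trans_lt ?_
  rw [norm_sub_rev, ← dist_eq_norm]
  exact hj2 w hwr

theorem not_eventually_eq_zero_of_ball {g : ℂ → ℂ} {z w : ℂ} {r : ℝ}
    (hg : ∀ x ∈ Metric.ball z r, AnalyticAt ℂ g⁻¹ x) {y : ℂ} (hy : y ∈ Metric.ball z r)
    (hy0 : g y ≠ 0) (hw : w ∈ Metric.ball z r) : ¬ ∀ᶠ x in 𝓝 w, g x = 0 := fun h0 => by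
  have h1 : ∀ᶠ x in 𝓝[≠] w, g⁻¹ x = 0 :=
    (h0.filter_mono nhdsWithin_le_nhds).mono fun x hx => by simpa using hx
  have := eventually_eq_zero_on_ball hg hw h1.frequently y hy
  exact hy0 (by simpa using this)

theorem InftyNear.eventually_sphDist_lt {l : Filter ℕ} {g : ℕ → ℂ → ℂ} {z : ℂ}
    (hc : InftyNear l g z) : ∃ r > 0, ∀ ε > 0, ∀ᶠ j in l, ∀ w ∈ Metric.ball z r,
      sphDist (toSphere (g j) w) OnePoint.infty < ε := by
  obtain ⟨r, hr, h1, h2⟩ := hc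
  refine ⟨r, hr, fun ε hε => ?_⟩
  filter_upwards [h1, Metric.tendstoUniformlyOn_iff.1 h2 ε hε] with j hj1 hj2 w hw
  obtain ⟨y, hy, hy0⟩ := hj1.2
  rw [toSphere_of_analyticAt_inv (hj1.1 w hw) (not_eventually_eq_zero_of_ball hj1.1 hy hy0 hw),
    show OnePoint.infty = sphereInv 0 by simp [sphereInv]]
  refine (sphDist_sphereInv_le _ _).trans_lt ?_
  rw [norm_sub_rev, ← dist_eq_norm]
  exact hj2 w hw

theorem ConvSphNear.eventually_sphDist_lt {l : Filter ℕ} [l.NeBot] {g : ℕ → ℂ → ℂ} {h : ℂ → ℂ}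
    {z : ℂ} (hc : ConvSphNear l g h z) : ∃ r > 0, ∀ ε > 0, ∀ᶠ j in l, ∀ w ∈ Metric.ball z r,
      sphDist (toSphere (g j) w) (toSphere h w) < ε := by
  rcases hc with hc | ⟨hc, hne⟩
  · exact hc.eventually_sphDist_lt
  obtain ⟨s, hs, hs'⟩ := Metric.eventually_nhds_iff_ball.1 hc.eventually
  obtain ⟨r, hr, h1, h2⟩ := hc
  have hball : Metric.ball z (min r s) ∈ 𝓝 z := Metric.ball_mem_nhds _ (lt_min hr hs)
  obtain ⟨y, hy0, hy⟩ := (hne.and (mem_nhdsWithin_of_mem_nhds hball)).exists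
  have hyr := Metric.ball_subset_ball (min_le_left r s) hy
  have hgy : ∀ᶠ j in l, g j y ≠ 0 := by
    filter_upwards [(h2.tendsto_at hyr).eventually_ne (inv_ne_zero hy0)] with j hj h0
    exact hj (by simp [h0])
  refine ⟨min r s, lt_min hr hs, fun ε hε => ?_⟩
  filter_upwards [h1, hgy, Metric.tendstoUniformlyOn_iff.1 h2 ε hε] with j hj1 hj2 hj3 w hw
  have hwr := Metric.ball_subset_ball (min_le_left r s) hw
  have hh : ∀ x ∈ Metric.ball z (min r s), AnalyticAt ℂ h⁻¹ x := fun x hx =>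
    (hs' x (Metric.ball_subset_ball (min_le_right r s) hx)).analyticAt
  rw [toSphere_of_analyticAt_inv (hj1 w hwr) (not_eventually_eq_zero_of_ball hj1 hyr hj2 hwr),
    toSphere_of_analyticAt_inv (hh w hw) (not_eventually_eq_zero_of_ball hh hy hy0 hw)]
  refine (sphDist_sphereInv_le _ _).trans_lt ?_
  rw [norm_sub_rev, ← dist_eq_norm]
  exact hj3 w hwr

theorem meromorphicNiceOn_of_convSphNear {l : Filter ℕ} [l.NeBot] {g : ℕ → ℂ → ℂ} {h : ℂ → ℂ}
    {D : Set ℂ} (hc : ∀ z ∈ D, ConvSphNear l g h z) : MeromorphicNiceOn h D := by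
  refine ⟨fun z hz => meromorphicAt_of_analyticAt_or
    ((hc z hz).imp (fun h => h.analyticAt) fun h => h.1.analyticAt), fun z hz => ?_⟩
  rcases hc z hz with h1 | ⟨h1, hne⟩
  · exact Or.inl h1.analyticAt.continuousAt
  · by_cases h0 : h⁻¹ z = 0
    · refine Or.inr (tendsto_norm_atTop_of_inv_eq_zero h1.analyticAt h0 fun hev => ?_)
      obtain ⟨w, hw1, hw2⟩ := (hne.and (hev.filter_mono nhdsWithin_le_nhds)).exists
      exact hw1 hw2
    · exact Or.inl (analyticAt_of_inv_ne_zero h1.analyticAt h0).continuousAt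

/-- Extraction of a subsequence converging uniformly on compact subsets of an open set. -/
theorem exists_strictMono_forall_isCompact {l : Filter ℕ} [l.NeBot] (hl : l ≤ atTop) {D : Set ℂ}
    (hD : IsOpen D) {d : ℕ → ℂ → ℝ}
    (h : ∀ z ∈ D, ∃ r > 0, ∀ ε > 0, ∀ᶠ j in l, ∀ w ∈ Metric.ball z r, w ∈ D → d j w < ε) :
    ∃ φ : ℕ → ℕ, StrictMono φ ∧ ∀ K ⊆ D, IsCompact K → ∀ ε > 0, ∀ᶠ j in atTop, ∀ z ∈ K,
      d (φ j) z < ε := by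
  have hK : ∀ K ⊆ D, IsCompact K → ∀ ε > 0, ∀ᶠ j in l, ∀ z ∈ K, d j z < ε := by
    intro K hKD hK ε hε
    have := hK.induction_on (p := fun T => ∀ᶠ j in l, ∀ z ∈ T, z ∈ D → d j z < ε) (by simp)
      (fun s t hst ht => ht.mono fun j hj z hz => hj z (hst hz))
      (fun s t h1 h2 => (h1.and h2).mono fun j hj z hz => hz.elim (hj.1 z) (hj.2 z))
      (fun z hz => by
        obtain ⟨r, hr, hr'⟩ := h z (hKD hz)
        exact ⟨_, mem_nhdsWithin_of_mem_nhds (Metric.ball_mem_nhds z hr), hr' ε hε⟩)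
    exact this.mono fun j hj z hz => hj z hz (hKD hz)
  have : LocallyCompactSpace D := hD.locallyCompactSpace
  set E := CompactExhaustion.choice D
  obtain ⟨φ, hφ, hφ'⟩ := Filter.extraction_forall_of_frequently
    (P := fun m j => ∀ z ∈ Subtype.val '' E m, d j z < 1 / ((m : ℝ) + 1)) (fun m =>
      (hK _ (by rintro _ ⟨x, _, rfl⟩; exact x.2) ((E.isCompact m).image continuous_subtype_val) _
        (by positivity)).frequently.filter_mono hl)
  refine ⟨φ, hφ, fun K hKD hKc ε hε => ?_⟩
  obtain ⟨m, hm⟩ := E.exists_superset_of_isCompact (s := (Subtype.val ⁻¹' K : Set D))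
    (Topology.IsInducing.subtypeVal.isCompact_preimage' hKc (by simpa using hKD))
  filter_upwards [eventually_ge_atTop m,
    tendsto_one_div_add_atTop_nhds_zero_nat.eventually_lt_const hε] with j hj1 hj2 z hz
  refine (hφ' j z ⟨⟨z, hKD hz⟩, E.subset hj1 (hm ?_), rfl⟩).trans hj2
  exact hz

/-- **Strengthened Schwick criterion.** If `n ≥ k + 2` and every `f` in a family `𝓕` of
meromorphic functions on a domain `D` satisfies `(fⁿ)⁽ᵏ⁾(z) ≠ 1` on `D`,
then `𝓕` is normal in `D`. -/
theorem schwick_normality_strengthened (n k : ℕ) (hn : 1 ≤ n) (hk : 1 ≤ k) (hnk : k + 2 ≤ n)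
    (D : Set ℂ) (hD : IsOpen D) (hDconn : IsConnected D)
    (𝓕 : Set (ℂ → ℂ)) (hmero : ∀ f ∈ 𝓕, MeromorphicNiceOn f D)
    (hne : ∀ f ∈ 𝓕, ∀ z ∈ D, iteratedDeriv k (f ^ n) z ≠ 1) :
    NormalFamilyOn 𝓕 D := by
  intro f hf
  set g : ℕ → ℂ → ℂ := fun j => nfExt (f j) with hg
  have hsph : ∀ j, ∀ z ∈ D, toSphere (g j) z = toSphere (f j) z := fun j z hz =>
    (hmero _ (hf j)).toSphere_nfExt hz
  set l : Ultrafilter ℕ := hyperfilter ℕ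
  have hl : (l : Filter ℕ) ≤ atTop := by
    rw [← Nat.cofinite_eq_atTop]; exact hyperfilter_le_cofinite
  have hbound : ∀ z ∈ D, ∃ r > 0, ∃ C ≥ 0, ∀ᶠ j in (l : Filter ℕ), ∀ w ∈ Metric.ball z r,
      SphDerivLE (g j) C w := fun z hz => by
    obtain ⟨r, hr, C, hC, h⟩ := exists_forall_sphDerivLE (𝓖 := range g) (n := n) hk hnk hD
      (by
        rintro _ ⟨j, rfl⟩ w hw
        exact exists_eventually_sphDerivLE ((hmero _ (hf j)).analyticAt_nfExt_or hw))
      (by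
        rintro _ ⟨j, rfl⟩ w hw ha
        have ha' := (hmero _ (hf j)).analyticAt_of_nfExt hw ha
        rw [((nfExt_eventuallyEq ha').pow_const n).iteratedDeriv_eq k]
        exact hne _ (hf j) w hw) hz
    exact ⟨r, hr, C, hC, Eventually.of_forall fun j => h _ ⟨j, rfl⟩⟩
  rcases inftyNear_or_convNear hD hDconn.isPreconnected hbound with h | h
  · obtain ⟨φ, hφ, hφ'⟩ := exists_strictMono_forall_isCompact hl hD
      (d := fun j w => sphDist (toSphere (f j) w) OnePoint.infty) fun z hz => by
        obtain ⟨r, hr, h1⟩ := (h z hz).eventually_sphDist_lt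
        exact ⟨r, hr, fun ε hε => (h1 ε hε).mono fun j hj w hw hwD => hsph j w hwD ▸ hj w hw⟩
    exact ⟨φ, hφ, Or.inr hφ'⟩
  · obtain ⟨φ, hφ, hφ'⟩ := exists_strictMono_forall_isCompact hl hD
      (d := fun j w => sphDist (toSphere (f j) w) (toSphere (filterLim l g) w)) fun z hz => by
        obtain ⟨r, hr, h1⟩ := ConvSphNear.eventually_sphDist_lt (h z hz)
        exact ⟨r, hr, fun ε hε => (h1 ε hε).mono fun j hj w hw hwD => hsph j w hwD ▸ hj w hw⟩
    exact ⟨φ, hφ, Or.inl ⟨_, meromorphicNiceOn_of_convSphNear h, hφ'⟩⟩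

end
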